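/- Fix t ∈ (0,1/4) and set k = 4t. The characteristic function F(t,b) = Σ_{w excursion} t^{|w|}·e^{ibθ^w} satisfies: for b ∈ ℝ∖ℤ, F(t,b) = (1/cos(πb/2))·[1 − (π·tan(πb/4)/(2K(k)))·θ₁'(πb/4, √q_k)/θ₁(πb/4, √q_k)]; for b ∈ 4ℤ, F(t,b) = 1 − π/(2K(k)); for b ∈ 2ℤ+1, F(t,b) = 1 − 2E(k)/π; and for b ∈ 4ℤ+2, F(t,b) = −1 + 4E(k)/π − (1−k²)·2K(k)/π. Here θ₁(z,q) = 2·Σ_{n=0}^∞ (−1)^n·q^{(n+1/2)²}·sin((2n+1)z) and θ₁'(z,q) is its derivative in z. -/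

import Mathlib

open Complex Real Set

noncomputable section

/-- A lattice point `(x,y)` viewed as the complex number `x + iy`. -/
def ptC (p : ℤ × ℤ) : ℂ := (p.1 : ℂ) + (p.2 : ℂ) * Complex.I

/-- A diagonal step on `ℤ²`. -/
def IsDiagStep (a b : ℤ × ℤ) : Prop :=
  b - a = (1, 1) ∨ b - a = (1, -1) ∨ b - a = (-1, -1) ∨ b - a = (-1, 1)

/-- A rectilinear step on `ℤ²`. -/
def IsRectStep (a b : ℤ × ℤ) : Prop :=
  b - a = (1, 0) ∨ b - a = (-1, 0) ∨ b - a = (0, 1) ∨ b - a = (0, -1)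

/-- `w` encodes a simple diagonal walk `(w₀, …, w_n)` as a list of length `n+1`. -/
def IsWalkList (w : List (ℤ × ℤ)) : Prop := w ≠ [] ∧ w.Chain' IsDiagStep

/-- Winding angle of the walk `w` around the origin up to time `i`. -/
def windTo (w : List (ℤ × ℤ)) (i : ℕ) : ℝ :=
  ∑ j ∈ Finset.range i, (ptC (w.getD (j + 1) 0) / ptC (w.getD j 0)).arg

/-- The full winding angle of the walk `w` around the origin. -/
def wind (w : List (ℤ × ℤ)) : ℝ := windTo w (w.length - 1)

/-- The condition on walks counted by `W^{(α,I)}_{l,p}`: a simple diagonal walk on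
`ℤ² ∖ {0}` from `(p,0)` to a point on one of the axes at distance `l` from the origin,
with full winding angle `α` and intermediate winding angles in `I`. -/
def WCond (l p : ℕ) (α : ℝ) (I : Set ℝ) (w : List (ℤ × ℤ)) : Prop :=
  IsWalkList w ∧ (∀ x ∈ w, x ≠ (0, 0)) ∧ w.head? = some ((p : ℤ), 0) ∧
    (w.getLast? = some ((l : ℤ), 0) ∨ w.getLast? = some (-(l : ℤ), 0) ∨
      w.getLast? = some (0, (l : ℤ)) ∨ w.getLast? = some (0, -(l : ℤ))) ∧
    wind w = α ∧ (∀ i, 1 ≤ i → i ≤ w.length - 2 → windTo w i ∈ I)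

/-- The generating function `W^{(α,I)}_{l,p}(t)`. -/
def Wgen (t : ℝ) (l p : ℕ) (α : ℝ) (I : Set ℝ) : ℝ :=
  ∑' w : {w : List (ℤ × ℤ) // WCond l p α I w}, t ^ (w.val.length - 1)

/-- The complete elliptic integral of the first kind `K(k)`. -/
def Kell (k : ℝ) : ℝ := ∫ y in (0:ℝ)..1, 1 / Real.sqrt ((1 - y ^ 2) * (1 - k ^ 2 * y ^ 2))

/-- The complete elliptic integral of the second kind `E(k)`. -/
def Eell (k : ℝ) : ℝ := ∫ y in (0:ℝ)..1, Real.sqrt (1 - k ^ 2 * y ^ 2) / Real.sqrt (1 - y ^ 2)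

/-- The complementary modulus `k' = √(1-k²)`. -/
def kComp (k : ℝ) : ℝ := Real.sqrt (1 - k ^ 2)

/-- The elliptic nome `q_k = exp(-π K(k')/K(k))`. -/
def qNome (k : ℝ) : ℝ := Real.exp (-π * Kell (kComp k) / Kell k)

/-- The descending Landen transformation `k₁ = (1-k')/(1+k')`. -/
def kLanden (k : ℝ) : ℝ := (1 - kComp k) / (1 + kComp k)

/-- `T_k = K(k')/(4K(k))`. -/
def Tell (k : ℝ) : ℝ := Kell (kComp k) / (4 * Kell k)

/-- The plane minus the two real slits `{z ∈ ℝ : z² ≥ κ}`. -/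
def slitDom (κ : ℝ) : Set ℂ := {z : ℂ | ¬(z.im = 0 ∧ κ ≤ z.re ^ 2)}

/-- `v` is the analytic function `v_κ` on `ℂ ∖ {z ∈ ℝ : z² ≥ κ}` with `v 0 = 0` and
`v'(z) = 1/(4K(κ)√((κ-z²)(1-κz²)))`, the branch of the square root being positive on
`(-√κ, √κ)` (by analytic continuation this determines `v` uniquely). -/
structure IsVmap (κ : ℝ) (v : ℂ → ℂ) : Prop where
  map_zero : v 0 = 0
  analytic : AnalyticOnNhd ℂ v (slitDom κ)
  deriv_real : ∀ x : ℝ, x ^ 2 < κ →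
    HasDerivAt v ((1 / (4 * Kell κ * Real.sqrt ((κ - x ^ 2) * (1 - κ * x ^ 2))) : ℝ) : ℂ)
      (x : ℂ)

/-- The function `f_m(z) = cos(2πm(v(z) + 1/4)) - cos(πm/2)` built from `v = v_{k₁}`. -/
def fmFun (v : ℂ → ℂ) (m : ℕ) (z : ℂ) : ℂ :=
  Complex.cos (2 * (π : ℂ) * m * (v z + 1 / 4)) - Complex.cos ((π : ℂ) * m / 2)

/-- `a n m` is the (real) Taylor coefficient `[zⁿ] f_m(z)` at `0`. -/
def IsCoeff (κ : ℝ) (v : ℂ → ℂ) (a : ℕ → ℕ → ℝ) : Prop :=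
  ∀ m : ℕ, 1 ≤ m → ∀ z : ℂ, z ∈ slitDom κ → ‖z‖ < 1 →
    HasSum (fun n : ℕ => (a n m : ℂ) * z ^ n) (fmFun v m z)

/-- An excursion: a nonempty simple diagonal walk from the origin to the origin with no
intermediate visits to the origin. -/
def IsExcursion (w : List (ℤ × ℤ)) : Prop :=
  2 ≤ w.length ∧ w.Chain' IsDiagStep ∧ w.head? = some (0, 0) ∧ w.getLast? = some (0, 0) ∧
    ∀ i, 1 ≤ i → i ≤ w.length - 2 → w.getD i 0 ≠ (0, 0)

/-- The winding angle sequence of an excursion: `θ₀ = θ₁ = 0`, increments of the first and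
last step do not contribute, and `θ_n = θ_{n-1}`. -/
def windExcTo (w : List (ℤ × ℤ)) (i : ℕ) : ℝ :=
  ∑ j ∈ Finset.Icc 2 (min i (w.length - 2)), (ptC (w.getD j 0) / ptC (w.getD (j - 1) 0)).arg

/-- The full winding angle of an excursion. -/
def windExc (w : List (ℤ × ℤ)) : ℝ := windExcTo w (w.length - 1)

/-- `F^{(α)}(t)`: generating function of excursions with winding angle `α`. -/
def Fgen (t α : ℝ) : ℝ :=
  ∑' w : {w : List (ℤ × ℤ) // IsExcursion w ∧ windExc w = α}, t ^ (w.val.length - 1)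

/-- `F(t,b) = Σ_w t^{|w|} e^{i b θ^w}`, the characteristic function of excursions. -/
def Fchar (t b : ℝ) : ℂ :=
  ∑' w : {w : List (ℤ × ℤ) // IsExcursion w},
    (t : ℂ) ^ (w.val.length - 1) * Complex.exp (Complex.I * b * windExc w.val)

/-- `ψ_k(z) = (1 - √(1-kz²))/(√k z)` (principal square root), `ψ_k(0) = 0`. -/
def psiK (k : ℝ) (z : ℂ) : ℂ :=
  if z = 0 then 0 else (1 - (1 - (k : ℂ) * z ^ 2) ^ ((1 : ℂ) / 2)) / ((Real.sqrt k : ℂ) * z)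

/-- The first Jacobi theta function `θ₁(z,q) = 2 Σ_{n≥0} (-1)ⁿ q^{(n+1/2)²} sin((2n+1)z)`. -/
def theta1 (z q : ℝ) : ℝ :=
  2 * ∑' n : ℕ, (-1 : ℝ) ^ n * q ^ (((n : ℝ) + 1 / 2) ^ 2) * Real.sin ((2 * n + 1) * z)

/-- The `z`-derivative `θ₁'(z,q)`. -/
def theta1' (z q : ℝ) : ℝ := deriv (fun u : ℝ => theta1 u q) z

/-- The four diagonal steps. -/
def diagSteps : Finset (ℤ × ℤ) := {(1, 1), (1, -1), (-1, -1), (-1, 1)}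

lemma isDiagStep_iff (x y : ℤ × ℤ) : IsDiagStep x y ↔ y - x ∈ diagSteps := by
  simp [IsDiagStep, diagSteps]

lemma sum_diagSteps {M : Type*} [AddCommMonoid M] (f : ℤ × ℤ → M) :
    ∑ s ∈ diagSteps, f s = f (1, 1) + f (1, -1) + f (-1, -1) + f (-1, 1) := by
  rw [diagSteps, Finset.sum_insert (by decide), Finset.sum_insert (by decide),
    Finset.sum_insert (by decide), Finset.sum_singleton]
  simp only [add_assoc]

lemma card_diagSteps : diagSteps.card = 4 := by decide

/-- Walks with `n` steps from `x` that visit the origin exactly at the last step. -/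
def hitWalks : ℕ → ℤ × ℤ → Finset (List (ℤ × ℤ))
  | 0, x => if x = 0 then {[x]} else ∅
  | n + 1, x => if x = 0 then ∅ else
      diagSteps.biUnion fun s => (hitWalks n (x + s)).image (x :: ·)

lemma mem_hitWalks (n : ℕ) (x : ℤ × ℤ) (w : List (ℤ × ℤ)) :
    w ∈ hitWalks n x ↔ w.length = n + 1 ∧ w.Chain' IsDiagStep ∧ w.head? = some x ∧
      w.getLast? = some 0 ∧ ∀ i < n, w.getD i 0 ≠ 0 := by
  induction n generalizing x w with
  | zero =>
    simp only [hitWalks]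
    constructor
    · intro h
      split_ifs at h with hx
      · simp only [Finset.mem_singleton] at h
        subst h; subst hx; simp; exact List.isChain_singleton _
      · simp at h
    · rintro ⟨h1, -, h2, h3, -⟩
      obtain ⟨a, rfl⟩ := List.length_eq_one_iff.1 h1
      simp only [List.head?_cons, Option.some.injEq, List.getLast?_singleton] at h2 h3
      subst h2; subst h3; simp
  | succ n ih =>
    constructor
    · intro h
      simp only [hitWalks] at h
      split_ifs at h with hx
      · simp at h
      · simp only [Finset.mem_biUnion, Finset.mem_image] at h
        obtain ⟨s, hs, v, hv, rfl⟩ := h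
        obtain ⟨h1, h2, h3, h4, h5⟩ := (ih _ _).1 hv
        cases v with
        | nil => simp at h1
        | cons y v =>
          simp only [List.head?_cons, Option.some.injEq] at h3
          subst h3
          refine ⟨by simpa using h1, ?_, rfl, by simpa using h4, ?_⟩
          · refine List.isChain_cons_cons.2 ⟨?_, h2⟩
            rw [isDiagStep_iff]; simpa using hs
          · intro i hi
            cases i with
            | zero => simpa using hx
            | succ i => simpa using h5 i (by omega)
    · rintro ⟨h1, h2, h3, h4, h5⟩
      match w, h1, h2, h3, h4, h5 with
      | a :: y :: v, h1, h2, h3, h4, h5 =>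
        simp only [List.head?_cons, Option.some.injEq] at h3
        subst h3
        have hx : a ≠ 0 := by simpa using h5 0 (by omega)
        simp only [hitWalks, if_neg hx, Finset.mem_biUnion, Finset.mem_image]
        have h2' := List.isChain_cons_cons.1 h2
        refine ⟨y - a, (isDiagStep_iff _ _).1 h2'.1, y :: v, (ih _ _).2 ⟨by simpa using h1, h2'.2,
          by simp, by simpa using h4, ?_⟩, rfl⟩
        intro i hi
        simpa using h5 (i + 1) (by omega)

/-- Excursions with `n + 1` steps. -/
def excWalks (n : ℕ) : Finset (List (ℤ × ℤ)) :=
  diagSteps.biUnion fun s => (hitWalks n s).image (0 :: ·)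

lemma mem_excWalks (n : ℕ) (w : List (ℤ × ℤ)) :
    w ∈ excWalks n ↔ w.length = n + 2 ∧ IsExcursion w := by
  simp only [excWalks, Finset.mem_biUnion, Finset.mem_image]
  constructor
  · rintro ⟨s, hs, v, hv, rfl⟩
    obtain ⟨h1, h2, h3, h4, h5⟩ := (mem_hitWalks _ _ _).1 hv
    cases v with
    | nil => simp at h1
    | cons y v =>
      simp only [List.head?_cons, Option.some.injEq] at h3
      subst h3
      refine ⟨by simpa using h1, by simp, ?_, rfl, by simpa [Prod.mk_zero_zero] using h4, ?_⟩
      · refine List.isChain_cons_cons.2 ⟨?_, h2⟩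
        rw [isDiagStep_iff]; simpa using hs
      · intro i hi hi'
        obtain ⟨j, rfl⟩ : ∃ j, i = j + 1 := ⟨i - 1, by omega⟩
        have := h5 j (by simp at h1 hi'; omega)
        simpa [Prod.mk_zero_zero] using this
  · rintro ⟨h1, h2, h3, h4, h5, h6⟩
    match w, h1, h3, h4, h5, h6 with
    | a :: y :: v, h1, h3, h4, h5, h6 =>
      simp only [List.head?_cons, Option.some.injEq] at h4
      subst h4
      have h2' := List.isChain_cons_cons.1 h3
      refine ⟨y, by simpa [Prod.mk_zero_zero] using (isDiagStep_iff _ _).1 h2'.1, y :: v,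
        (mem_hitWalks _ _ _).2
        ⟨by simpa using h1, h2'.2, by simp, by simpa [Prod.mk_zero_zero] using h5, ?_⟩, rfl⟩
      intro i hi
      simpa [Prod.mk_zero_zero] using h6 (i + 1) (by omega) (by simp at h1 ⊢; omega)

lemma card_hitWalks_le (n : ℕ) (x : ℤ × ℤ) : (hitWalks n x).card ≤ 4 ^ n := by
  induction n generalizing x with
  | zero => simp only [hitWalks]; split_ifs <;> simp
  | succ n ih =>
    simp only [hitWalks]
    split_ifs
    · simp
    · refine Finset.card_biUnion_le.trans ?_
      calc _ ≤ ∑ s ∈ diagSteps, 4 ^ n :=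
            Finset.sum_le_sum fun s _ => Finset.card_image_le.trans (ih _)
        _ = 4 ^ (n + 1) := by simp [card_diagSteps, pow_succ, mul_comm]

lemma card_excWalks_le (n : ℕ) : (excWalks n).card ≤ 4 ^ (n + 1) := by
  refine Finset.card_biUnion_le.trans ?_
  calc _ ≤ ∑ s ∈ diagSteps, 4 ^ n :=
        Finset.sum_le_sum fun s _ => Finset.card_image_le.trans (card_hitWalks_le _ _)
    _ = 4 ^ (n + 1) := by simp [card_diagSteps, pow_succ, mul_comm]

/-- The phase factor of a step from `x` to `y`. -/
def stepPhase (b : ℝ) (x y : ℤ × ℤ) : ℂ :=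
  Complex.exp (Complex.I * b * ((ptC y / ptC x).arg : ℝ))

lemma norm_stepPhase (b : ℝ) (x y : ℤ × ℤ) : ‖stepPhase b x y‖ = 1 := by
  rw [stepPhase, mul_assoc, ← Complex.ofReal_mul, mul_comm, Complex.norm_exp_ofReal_mul_I]

/-- The phase-weighted number of walks with `n` steps from `x` first hitting the origin at the
last step. -/
def hitSum (b : ℝ) (n : ℕ) (x : ℤ × ℤ) : ℂ :=
  ∑ w ∈ hitWalks n x, Complex.exp (Complex.I * b * wind w)

lemma wind_cons_cons (x y : ℤ × ℤ) (v : List (ℤ × ℤ)) :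
    wind (x :: y :: v) = (ptC y / ptC x).arg + wind (y :: v) := by
  simp only [wind, windTo, List.length_cons, Nat.add_sub_cancel]
  rw [Finset.sum_range_succ', add_comm]
  simp

lemma ptC_zero : ptC 0 = 0 := by simp [ptC]

lemma windExc_zero_cons (n : ℕ) (x : ℤ × ℤ) (w : List (ℤ × ℤ)) (hw : w ∈ hitWalks n x) :
    windExc (0 :: w) = wind w := by
  obtain ⟨h1, h2, h3, h4, h5⟩ := (mem_hitWalks _ _ _).1 hw
  have e : windExc (0 :: w) = windTo w (n - 1) := by
    simp only [windExc, windExcTo, windTo, List.length_cons, h1]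
    have : min (n + 1 + 1 - 1) (n + 1 + 1 - 2) = n := by omega
    rw [this, ← Finset.Ico_add_one_right_eq_Icc, Finset.sum_Ico_eq_sum_range]
    have : n + 1 - 2 = n - 1 := by omega
    rw [this]
    refine Finset.sum_congr rfl fun i _ => ?_
    rw [show 2 + i = (i + 1) + 1 by ring, List.getD_cons_succ, Nat.add_sub_cancel,
      List.getD_cons_succ]
  rw [e, wind, h1, Nat.add_sub_cancel]
  cases n with
  | zero => rfl
  | succ n =>
    simp only [Nat.add_sub_cancel, windTo]
    rw [Finset.sum_range_succ]
    have : w.getD (n + 1) 0 = 0 := by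
      rw [List.getLast?_eq_getElem?, h1] at h4
      rw [List.getD_eq_getElem?_getD]
      simp only [Nat.add_sub_cancel] at h4
      rw [h4]; rfl
    rw [this, ptC_zero]; simp

lemma sum_cons_biUnion (n : ℕ) (x y : ℤ × ℤ) (f : List (ℤ × ℤ) → ℂ) :
    ∑ w ∈ diagSteps.biUnion (fun s => (hitWalks n (y + s)).image (x :: ·)), f w =
      ∑ s ∈ diagSteps, ∑ w ∈ hitWalks n (y + s), f (x :: w) := by
  rw [Finset.sum_biUnion]
  · refine Finset.sum_congr rfl fun s _ => ?_
    rw [Finset.sum_image]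
    intro a _ b _ h
    simpa using h
  · intro s _ s' _ hss
    refine Finset.disjoint_left.2 fun w hw hw' => hss ?_
    simp only [Finset.mem_image] at hw hw'
    obtain ⟨v, hv, rfl⟩ := hw
    obtain ⟨v', hv', h⟩ := hw'
    simp only [List.cons.injEq, true_and] at h
    subst h
    have h1 := ((mem_hitWalks _ _ _).1 hv).2.2.1
    have h2 := ((mem_hitWalks _ _ _).1 hv').2.2.1
    rw [h1] at h2
    simpa using h2

lemma hitSum_zero (b : ℝ) (x : ℤ × ℤ) : hitSum b 0 x = if x = 0 then 1 else 0 := by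
  simp only [hitSum, hitWalks]
  split_ifs <;> simp [wind, windTo]

lemma hitSum_succ_origin (b : ℝ) (n : ℕ) : hitSum b (n + 1) 0 = 0 := by
  simp [hitSum, hitWalks]

lemma hitSum_succ (b : ℝ) (n : ℕ) {x : ℤ × ℤ} (hx : x ≠ 0) :
    hitSum b (n + 1) x = ∑ s ∈ diagSteps, stepPhase b x (x + s) * hitSum b n (x + s) := by
  simp only [hitSum, hitWalks, if_neg hx]
  rw [sum_cons_biUnion]
  refine Finset.sum_congr rfl fun s _ => ?_
  rw [Finset.mul_sum]
  refine Finset.sum_congr rfl fun w hw => ?_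
  obtain ⟨h1, h2, h3, h4, h5⟩ := (mem_hitWalks _ _ _).1 hw
  cases w with
  | nil => simp at h1
  | cons y v =>
    simp only [List.head?_cons, Option.some.injEq] at h3
    subst h3
    rw [wind_cons_cons, stepPhase, ← Complex.exp_add]
    push_cast; ring_nf

lemma sum_excWalks (b : ℝ) (n : ℕ) :
    ∑ w ∈ excWalks n, Complex.exp (Complex.I * b * windExc w) =
      ∑ s ∈ diagSteps, hitSum b n s := by
  have := sum_cons_biUnion n 0 0 fun w => Complex.exp (Complex.I * b * windExc w)
  simp only [zero_add] at this
  rw [excWalks, this]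
  refine Finset.sum_congr rfl fun s _ => ?_
  refine Finset.sum_congr rfl fun w hw => ?_
  rw [windExc_zero_cons n s w hw]

/-- Excursions, sorted by length. -/
def excEquiv : (Σ n : ℕ, {w // w ∈ excWalks n}) ≃ {w : List (ℤ × ℤ) // IsExcursion w} where
  toFun p := ⟨p.2.1, ((mem_excWalks _ _).1 p.2.2).2⟩
  invFun w := ⟨w.1.length - 2, w.1, (mem_excWalks _ _).2 ⟨by have := w.2.1; omega, w.2⟩⟩
  left_inv := by
    rintro ⟨n, w, hw⟩
    have h := ((mem_excWalks _ _).1 hw).1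
    obtain rfl : n = w.length - 2 := by omega
    rfl
  right_inv w := rfl

/-- A solution of polynomial growth of the twisted walk equation with boundary value `1` at the
origin determines the characteristic function of excursions. -/
theorem Fchar_eq_sum {t b : ℝ} (ht0 : 0 < t) (ht : t < 1 / 4) {h : ℤ × ℤ → ℂ} {C : ℝ}
    (hC : ∀ x, ‖h x‖ ≤ C * (1 + ‖x‖) ^ 2) (h0 : h 0 = 1)
    (heq : ∀ x, x ≠ 0 → h x = t * ∑ s ∈ diagSteps, stepPhase b x (x + s) * h (x + s)) :
    Fchar t b = t * ∑ s ∈ diagSteps, h s := by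
  have hC0 : 0 ≤ C := by have := hC 0; rw [h0] at this; simp at this; linarith
  have bound : ∀ (N : ℕ) (x : ℤ × ℤ), ‖h x - ∑ n ∈ Finset.range N, (t : ℂ) ^ n * hitSum b n x‖ ≤
      (4 * t) ^ N * (C * (1 + ‖x‖ + N) ^ 2) := by
    intro N
    induction N with
    | zero => intro x; simpa using hC x
    | succ N ih =>
      intro x
      rw [Finset.sum_range_succ']
      by_cases hx : x = 0
      · subst hx
        simp only [hitSum_succ_origin, hitSum_zero, h0]
        simp
        positivity
      · have e : h x - (∑ n ∈ Finset.range N, (t : ℂ) ^ (n + 1) * hitSum b (n + 1) x +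
            (t : ℂ) ^ 0 * hitSum b 0 x) = t * ∑ s ∈ diagSteps, stepPhase b x (x + s) *
              (h (x + s) - ∑ n ∈ Finset.range N, (t : ℂ) ^ n * hitSum b n (x + s)) := by
          simp only [hitSum_zero, if_neg hx, hitSum_succ b _ hx, mul_sub, Finset.sum_sub_distrib]
          rw [← heq x hx]
          simp only [mul_zero, add_zero, Finset.mul_sum]
          rw [Finset.sum_comm]
          congr 1
          refine Finset.sum_congr rfl fun s _ => Finset.sum_congr rfl fun n _ => ?_
          ring
        rw [e, norm_mul, Complex.norm_real, Real.norm_of_nonneg ht0.le]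
        have : ‖∑ s ∈ diagSteps, stepPhase b x (x + s) *
              (h (x + s) - ∑ n ∈ Finset.range N, (t : ℂ) ^ n * hitSum b n (x + s))‖ ≤
            ∑ s ∈ diagSteps, (4 * t) ^ N * (C * (1 + ‖x‖ + (N + 1)) ^ 2) := by
          refine (norm_sum_le _ _).trans (Finset.sum_le_sum fun s hs => ?_)
          rw [norm_mul, norm_stepPhase, one_mul]
          refine (ih _).trans ?_
          have hs1 : ‖s‖ ≤ 1 := by
            simp only [diagSteps, Finset.mem_insert, Finset.mem_singleton] at hs
            rcases hs with rfl | rfl | rfl | rfl <;> simp [Prod.norm_def]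
          have hn := norm_add_le x s
          have : 1 + ‖x + s‖ + N ≤ 1 + ‖x‖ + (N + 1) := by linarith
          gcongr
        rw [Finset.sum_const, card_diagSteps] at this
        calc _ ≤ t * (4 • ((4 * t) ^ N * (C * (1 + ‖x‖ + (N + 1)) ^ 2))) := by gcongr
          _ = _ := by push_cast; simp only [nsmul_eq_mul]; push_cast; ring
  have lim : ∀ x, Filter.Tendsto (fun N => ∑ n ∈ Finset.range N, (t : ℂ) ^ n * hitSum b n x)
      Filter.atTop (nhds (h x)) := by
    intro x
    rw [tendsto_iff_norm_sub_tendsto_zero]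
    have hl : Filter.Tendsto (fun N : ℕ => (4 * t) ^ N * (C * (1 + ‖x‖ + N) ^ 2))
        Filter.atTop (nhds 0) := by
      have h4 : |4 * t| < 1 := by rw [abs_of_pos (by linarith)]; linarith
      have a0 := tendsto_pow_const_mul_const_pow_of_abs_lt_one 0 h4
      have a1 := tendsto_pow_const_mul_const_pow_of_abs_lt_one 1 h4
      have a2 := tendsto_pow_const_mul_const_pow_of_abs_lt_one 2 h4
      have := ((a0.const_mul (C * (1 + ‖x‖) ^ 2)).add (a1.const_mul (2 * C * (1 + ‖x‖)))).add
        (a2.const_mul C)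
      simp only [mul_zero, add_zero] at this
      refine this.congr fun N => ?_
      ring
    refine squeeze_zero (fun _ => norm_nonneg _) (fun N => ?_) hl
    rw [norm_sub_rev]; exact bound N x
  have key : ∀ p : (Σ n : ℕ, {w // w ∈ excWalks n}),
      (t : ℂ) ^ ((excEquiv p).val.length - 1) *
        Complex.exp (Complex.I * b * windExc (excEquiv p).val) =
      (t : ℂ) ^ (p.1 + 1) * Complex.exp (Complex.I * b * windExc p.2.1) := by
    rintro ⟨n, w, hw⟩
    have h := ((mem_excWalks _ _).1 hw).1
    simp only [excEquiv, Equiv.coe_fn_mk]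
    rw [h]; rfl
  have nrm : ∀ p : (Σ n : ℕ, {w // w ∈ excWalks n}),
      ‖(t : ℂ) ^ (p.1 + 1) * Complex.exp (Complex.I * b * windExc p.2.1)‖ = t ^ (p.1 + 1) := by
    intro p
    rw [norm_mul, mul_assoc, ← Complex.ofReal_mul, mul_comm Complex.I,
      Complex.norm_exp_ofReal_mul_I, norm_pow, Complex.norm_real, Real.norm_of_nonneg ht0.le,
      mul_one]
  have summ : Summable fun p : (Σ n : ℕ, {w // w ∈ excWalks n}) =>
      (t : ℂ) ^ (p.1 + 1) * Complex.exp (Complex.I * b * windExc p.2.1) := by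
    refine Summable.of_norm ?_
    simp only [nrm]
    rw [summable_sigma_of_nonneg (fun p => by positivity)]
    refine ⟨fun n => (hasSum_fintype _).summable, ?_⟩
    have hg : Summable fun n : ℕ => (4 * t) ^ (n + 1) :=
      (summable_nat_add_iff 1).2 (summable_geometric_of_lt_one (by linarith) (by linarith))
    refine Summable.of_nonneg_of_le (fun n => tsum_nonneg fun _ => by positivity) (fun n => ?_) hg
    simp only
    rw [tsum_fintype, Finset.sum_const, Finset.card_univ, Fintype.card_coe, nsmul_eq_mul, mul_pow]
    have : ((excWalks n).card : ℝ) ≤ 4 ^ (n + 1) := by exact_mod_cast card_excWalks_le n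
    gcongr
  have hs2 := (excEquiv.hasSum_iff (f := fun w : {w : List (ℤ × ℤ) // IsExcursion w} =>
      (t : ℂ) ^ (w.val.length - 1) * Complex.exp (Complex.I * b * windExc w.val))
      (a := Fchar t b)).2 (by
        rw [Fchar]
        refine Summable.hasSum ?_
        rw [← excEquiv.summable_iff]
        exact summ.congr fun p => (key p).symm)
  have hs3 := hs2.sigma (fun n => hasSum_fintype _)
  have hs4 := hs3.tendsto_sum_nat
  have l2 := (tendsto_finsetSum diagSteps fun s _ => lim s).const_mul (t : ℂ)
  refine tendsto_nhds_unique hs4 (l2.congr fun N => ?_)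
  rw [Finset.sum_comm, Finset.mul_sum]
  refine Finset.sum_congr rfl fun n _ => ?_
  simp only [Function.comp_apply, key]
  rw [Finset.univ_eq_attach, Finset.sum_attach (excWalks n) (fun w => (t : ℂ) ^ (n + 1) *
    Complex.exp (Complex.I * b * windExc w))]
  have := sum_excWalks b n
  rw [← Finset.mul_sum, ← Finset.mul_sum, this]
  ring

/-- The number of one-dimensional simple walks with `n` steps from `0` to `a`. -/
def lineWalks : ℕ → ℤ → ℕ
  | 0, a => if a = 0 then 1 else 0
  | n + 1, a => lineWalks n (a - 1) + lineWalks n (a + 1)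

lemma lineWalks_le (n : ℕ) (a : ℤ) : lineWalks n a ≤ 2 ^ n := by
  induction n generalizing a with
  | zero => simp only [lineWalks]; split_ifs <;> simp
  | succ n ih =>
    have h1 := ih (a - 1)
    have h2 := ih (a + 1)
    simp only [lineWalks, pow_succ]
    omega

lemma lineWalks_neg (n : ℕ) (a : ℤ) : lineWalks n (-a) = lineWalks n a := by
  induction n generalizing a with
  | zero => simp [lineWalks]
  | succ n ih =>
    simp only [lineWalks]
    rw [show -a - 1 = -(a + 1) by ring, show -a + 1 = -(a - 1) by ring, ih, ih, add_comm]

lemma lineWalks_of_odd (n : ℕ) (a : ℤ) (h : Odd (a + n)) : lineWalks n a = 0 := by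
  induction n generalizing a with
  | zero =>
    have : a ≠ 0 := by rintro rfl; simp at h
    simp [lineWalks, this]
  | succ n ih =>
    simp only [lineWalks]
    push_cast at h
    rw [ih, ih]
    · convert h using 1; ring
    · have : Odd (a + (n + 1) - 2) := by
        rw [Int.odd_sub]; simp [h]
      convert this using 1; ring

lemma lineWalks_of_lt (n : ℕ) (a : ℤ) (h : a < -n) : lineWalks n a = 0 := by
  induction n generalizing a with
  | zero =>
    have : a ≠ 0 := by rintro rfl; simp at h
    simp [lineWalks, this]
  | succ n ih =>
    simp only [lineWalks]
    push_cast at h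
    rw [ih _ (by linarith), ih _ (by linarith)]

lemma lineWalks_eq_choose (n j : ℕ) : lineWalks n (2 * j - n) = n.choose j := by
  induction n generalizing j with
  | zero =>
    cases j with
    | zero => simp [lineWalks]
    | succ j =>
      have : (2 * ((j + 1 : ℕ) : ℤ) - (0 : ℕ)) ≠ 0 := by push_cast; omega
      simp only [lineWalks, if_neg this, Nat.choose_zero_succ]
  | succ n ih =>
    cases j with
    | zero =>
      have h1 := ih 0
      simp only [lineWalks]
      rw [lineWalks_of_lt n _ (by push_cast; linarith), show
        (2 * ((0 : ℕ) : ℤ) - ((n + 1 : ℕ) : ℤ) + 1) = 2 * ((0 : ℕ) : ℤ) - (n : ℤ) by push_cast; ring,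
        h1]
      simp
    | succ j =>
      simp only [lineWalks]
      rw [show (2 * ((j + 1 : ℕ) : ℤ) - ((n + 1 : ℕ) : ℤ) - 1) = 2 * (j : ℤ) - (n : ℤ) by
        push_cast; ring, show (2 * ((j + 1 : ℕ) : ℤ) - ((n + 1 : ℕ) : ℤ) + 1) =
        2 * ((j + 1 : ℕ) : ℤ) - (n : ℤ) by push_cast; ring, ih, ih, Nat.choose_succ_succ]

/-- The Green function of the diagonal walk at fugacity `t`. -/
def diagGreen (t : ℝ) (x : ℤ × ℤ) : ℝ := ∑' n : ℕ, t ^ n * (lineWalks n x.1 * lineWalks n x.2)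

lemma diagGreen_term_le {t : ℝ} (ht0 : 0 < t) (n : ℕ) (x : ℤ × ℤ) :
    t ^ n * (lineWalks n x.1 * lineWalks n x.2 : ℝ) ≤ (4 * t) ^ n := by
  have h1 : (lineWalks n x.1 : ℝ) ≤ 2 ^ n := by exact_mod_cast lineWalks_le n x.1
  have h2 : (lineWalks n x.2 : ℝ) ≤ 2 ^ n := by exact_mod_cast lineWalks_le n x.2
  calc t ^ n * (lineWalks n x.1 * lineWalks n x.2 : ℝ) ≤ t ^ n * (2 ^ n * 2 ^ n) := by gcongr
    _ = (4 * t) ^ n := by rw [← mul_pow, ← mul_pow]; ring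

lemma hasSum_diagGreen {t : ℝ} (ht0 : 0 < t) (ht : t < 1 / 4) (x : ℤ × ℤ) :
    HasSum (fun n : ℕ => t ^ n * (lineWalks n x.1 * lineWalks n x.2 : ℝ)) (diagGreen t x) :=
  (Summable.of_nonneg_of_le (fun n => by positivity) (fun n => diagGreen_term_le ht0 n x)
    (summable_geometric_of_lt_one (by linarith) (by linarith))).hasSum

lemma diagGreen_nonneg {t : ℝ} (ht0 : 0 < t) (x : ℤ × ℤ) : 0 ≤ diagGreen t x :=
  tsum_nonneg fun n => by positivity

lemma diagGreen_le {t : ℝ} (ht0 : 0 < t) (ht : t < 1 / 4) (x : ℤ × ℤ) :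
    diagGreen t x ≤ (1 - 4 * t)⁻¹ :=
  hasSum_le (fun n => diagGreen_term_le ht0 n x) (hasSum_diagGreen ht0 ht x)
    (hasSum_geometric_of_lt_one (by linarith) (by linarith))

lemma diagGreen_eq {t : ℝ} (ht0 : 0 < t) (ht : t < 1 / 4) (x : ℤ × ℤ) :
    diagGreen t x = (if x = 0 then 1 else 0) + t * ∑ s ∈ diagSteps, diagGreen t (x + s) := by
  have h := (hasSum_nat_add_iff' 1).2 (hasSum_diagGreen ht0 ht x)
  have h2 := (hasSum_sum fun s (_ : s ∈ diagSteps) => hasSum_diagGreen ht0 ht (x + s)).mul_left t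
  have e : diagGreen t x - ∑ i ∈ Finset.range 1, t ^ i * (lineWalks i x.1 * lineWalks i x.2 : ℝ) =
      t * ∑ s ∈ diagSteps, diagGreen t (x + s) := by
    refine h.unique (h2.congr_fun ?_)
    intro n
    simp only [sum_diagSteps, lineWalks, Prod.fst_add, Prod.snd_add, sub_eq_add_neg]
    push_cast; ring
  rw [← e]
  rcases x with ⟨a, b⟩
  simp only [Finset.range_one, Finset.sum_singleton, pow_zero, one_mul, lineWalks, Prod.ext_iff,
    Prod.fst_zero, Prod.snd_zero]
  by_cases ha : a = 0 <;> by_cases hb : b = 0 <;> simp [ha, hb]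

lemma diagGreen_rot (t : ℝ) (a b : ℤ) : diagGreen t (-b, a) = diagGreen t (a, b) := by
  simp only [diagGreen, lineWalks_neg]
  congr 1; ext n; ring

lemma diagGreen_neg (t : ℝ) (a b : ℤ) : diagGreen t (-a, -b) = diagGreen t (a, b) := by
  simp only [diagGreen, lineWalks_neg]

lemma hasSum_diagGreen_even {t : ℝ} (ht0 : 0 < t) (ht : t < 1 / 4) (i j : ℕ) :
    HasSum (fun n : ℕ => t ^ (2 * n) * ((2 * n).choose (n + i) * (2 * n).choose (n + j) : ℝ))
      (diagGreen t (2 * i, 2 * j)) := by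
  have h := hasSum_diagGreen ht0 ht (2 * i, 2 * j)
  have hinj : Function.Injective fun n : ℕ => 2 * n := fun a b h => by simpa using h
  rw [← hinj.hasSum_iff] at h
  · refine h.congr_fun fun n => ?_
    have := lineWalks_eq_choose (2 * n) (n + i)
    have h2 := lineWalks_eq_choose (2 * n) (n + j)
    simp only [Function.comp_apply]
    rw [← this, ← h2]
    congr 5 <;> push_cast <;> ring
  · intro n hn
    have hn' : Odd n := by
      rw [← Nat.not_even_iff_odd]
      rintro ⟨r, rfl⟩
      exact hn ⟨r, by simp; ring⟩
    simp only
    rw [lineWalks_of_odd n (2 * i) (by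
      have : Odd (n : ℤ) := by exact_mod_cast hn'
      exact (even_two_mul _).add_odd this)]
    simp

/-- The unit vector in direction `x`, to the power `m`. -/
def dirPow (m : ℤ) (x : ℤ × ℤ) : ℂ := Complex.exp (Complex.I * m * (ptC x).arg)

lemma ptC_ne_zero {x : ℤ × ℤ} (hx : x ≠ 0) : ptC x ≠ 0 := by
  intro h
  apply hx
  have h1 := congrArg Complex.re h
  have h2 := congrArg Complex.im h
  simp [ptC] at h1 h2
  exact Prod.ext (by simpa using h1) (by simpa using h2)

lemma exp_int_mul_arg {m : ℤ} {z : ℂ} (hz : z ≠ 0) :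
    Complex.exp (Complex.I * m * z.arg) = (z / ‖z‖) ^ m := by
  have h := Complex.norm_mul_exp_arg_mul_I z
  have hn : (‖z‖ : ℂ) ≠ 0 := by simpa using hz
  rw [eq_div_of_mul_eq hn ((mul_comm _ _).trans h) |>.symm, ← Complex.exp_int_mul]
  congr 1; ring

lemma dirPow_ne_zero (m : ℤ) (x : ℤ × ℤ) : dirPow m x ≠ 0 := Complex.exp_ne_zero _

lemma norm_dirPow (m : ℤ) (x : ℤ × ℤ) : ‖dirPow m x‖ = 1 := by
  rw [dirPow, show Complex.I * m * (ptC x).arg = ((m * (ptC x).arg : ℝ) : ℂ) * Complex.I by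
    push_cast; ring, Complex.norm_exp_ofReal_mul_I]

lemma stepPhase_mul_dirPow (m : ℤ) {x y : ℤ × ℤ} (hx : x ≠ 0) (hy : y ≠ 0) :
    stepPhase m x y * (dirPow m y)⁻¹ = (dirPow m x)⁻¹ := by
  have hx' := ptC_ne_zero hx
  have hy' := ptC_ne_zero hy
  have e : stepPhase m x y = dirPow m y / dirPow m x := by
    rw [stepPhase, dirPow, dirPow]
    push_cast
    rw [exp_int_mul_arg (div_ne_zero hy' hx'), exp_int_mul_arg hx', exp_int_mul_arg hy',
      ← div_zpow, norm_div]
    push_cast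
    congr 1
    field_simp
  rw [e]
  have := dirPow_ne_zero m x
  have := dirPow_ne_zero m y
  field_simp

theorem Fchar_int_eq_sum {t : ℝ} (m : ℤ) (ht0 : 0 < t) (ht : t < 1 / 4) {H : ℤ × ℤ → ℂ} {C : ℝ}
    (hC : ∀ x, ‖H x‖ ≤ C)
    (heq : ∀ x, x ≠ 0 → H x = t * ∑ s ∈ diagSteps, if x + s = 0 then dirPow m x else H (x + s)) :
    Fchar t m = t * ∑ s ∈ diagSteps, (dirPow m s)⁻¹ * H s := by
  have key := Fchar_eq_sum (t := t) (b := m) (h := fun x => if x = 0 then 1 else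
    (dirPow m x)⁻¹ * H x) (C := 1 + C) ht0 ht ?_ (by simp) ?_
  · rw [key]
    congr 1
  · intro x
    have hC0 : 0 ≤ C := (norm_nonneg _).trans (hC 0)
    have h1 : ‖(if x = 0 then 1 else (dirPow m x)⁻¹ * H x : ℂ)‖ ≤ 1 + C := by
      split_ifs
      · simpa using hC0
      · rw [norm_mul, norm_inv, norm_dirPow, inv_one, one_mul]
        linarith [hC x]
    refine h1.trans (le_mul_of_one_le_right (by linarith) ?_)
    have := norm_nonneg x
    nlinarith
  · intro x hx
    simp only [if_neg hx]
    rw [heq x hx, mul_left_comm, Finset.mul_sum]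
    congr 1
    refine Finset.sum_congr rfl fun s _ => ?_
    split_ifs with h
    · rw [h, stepPhase, ptC_zero]
      simp [dirPow_ne_zero]
    · rw [← mul_assoc, stepPhase_mul_dirPow m hx h]

lemma dirPow_rot (m : ℤ) {a b : ℤ} (h : (a, b) ≠ 0) :
    dirPow m (-b, a) = Complex.I ^ m * dirPow m (a, b) := by
  have h' : ((-b, a) : ℤ × ℤ) ≠ 0 := by
    simp only [ne_eq, Prod.ext_iff, Prod.fst_zero, Prod.snd_zero, neg_eq_zero] at h ⊢
    tauto
  have e : ptC (-b, a) = Complex.I * ptC (a, b) := by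
    simp only [ptC]; push_cast; linear_combination (-(b : ℂ)) * Complex.I_sq
  rw [dirPow, dirPow, exp_int_mul_arg (ptC_ne_zero h), exp_int_mul_arg (ptC_ne_zero h'), e,
    ← mul_zpow, norm_mul, Complex.norm_I, one_mul, mul_div_assoc]

lemma dirPow_four (m : ℤ) (s : ℤ × ℤ) (hs : s ∈ diagSteps) : dirPow (4 * m) s = (-1) ^ m := by
  have h0 : s ≠ 0 := by rintro rfl; revert hs; decide
  rw [dirPow, exp_int_mul_arg (ptC_ne_zero h0), zpow_mul]
  congr 1
  have hn : ‖ptC s‖ ^ 2 = 2 := by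
    rw [← Complex.normSq_eq_norm_sq]
    simp only [diagSteps, Finset.mem_insert, Finset.mem_singleton] at hs
    rcases hs with rfl | rfl | rfl | rfl <;> norm_num [ptC, Complex.normSq_apply]
  have hn4 : (‖ptC s‖ : ℂ) ^ 4 = 4 := by
    have : (‖ptC s‖ : ℂ) ^ 2 = 2 := by exact_mod_cast hn
    linear_combination (2 + (‖ptC s‖ : ℂ) ^ 2) * this
  have hp : ptC s ^ 4 = -4 := by
    have I4 : Complex.I ^ 4 = 1 := Complex.I_pow_four
    have I2 := Complex.I_sq
    have I3 : Complex.I ^ 3 = - Complex.I := Complex.I_pow_three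
    simp only [diagSteps, Finset.mem_insert, Finset.mem_singleton] at hs
    rcases hs with rfl | rfl | rfl | rfl <;> simp only [ptC] <;> push_cast <;> ring_nf <;>
      simp only [I2, I3, I4] <;> ring
  have : ((ptC s / ‖ptC s‖) ^ (4 : ℕ) : ℂ) = -1 := by
    rw [div_pow, hp, hn4]; norm_num
  exact_mod_cast this

lemma one_le_diagGreen_zero {t : ℝ} (ht0 : 0 < t) (ht : t < 1 / 4) : 1 ≤ diagGreen t 0 := by
  rw [diagGreen_eq ht0 ht, if_pos rfl]
  have : 0 ≤ ∑ s ∈ diagSteps, diagGreen t (0 + s) :=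
    Finset.sum_nonneg fun s _ => diagGreen_nonneg ht0 _
  nlinarith

theorem Fchar_four_mul {t : ℝ} (ht0 : 0 < t) (ht : t < 1 / 4) (m : ℤ) :
    Fchar t ((4 * m : ℤ) : ℝ) = ((1 - 1 / diagGreen t 0 : ℝ) : ℂ) := by
  have g0 := one_le_diagGreen_zero ht0 ht
  have gne : (diagGreen t 0 : ℂ) ≠ 0 := by
    have : diagGreen t 0 ≠ 0 := by linarith
    exact_mod_cast this
  have h0 := diagGreen_eq ht0 ht 0
  rw [if_pos rfl] at h0
  have h0' : (diagGreen t 0 : ℂ) = 1 + t * ∑ s ∈ diagSteps, (diagGreen t s : ℂ) := by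
    simp only [zero_add] at h0
    exact_mod_cast h0
  have h1 : ((-1 : ℂ) ^ m) ≠ 0 := zpow_ne_zero _ (by norm_num)
  have n1 : ‖((-1 : ℂ) ^ m)‖ = 1 := by simp
  rw [Fchar_int_eq_sum (4 * m) ht0 ht (H := fun x => (-1) ^ m * (diagGreen t x / diagGreen t 0))
    (C := (1 - 4 * t)⁻¹)]
  · have : ∀ s ∈ diagSteps, (dirPow (4 * m) s)⁻¹ * ((-1) ^ m * (diagGreen t s / diagGreen t 0)) =
        diagGreen t s / (diagGreen t 0 : ℂ) := by
      intro s hs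
      rw [dirPow_four m s hs]
      field_simp
    rw [Finset.sum_congr rfl this, ← Finset.sum_div]
    push_cast
    field_simp
    linear_combination -h0'
  · intro x
    rw [norm_mul, n1, one_mul, norm_div, Complex.norm_real, Complex.norm_real,
      Real.norm_of_nonneg (diagGreen_nonneg ht0 _), Real.norm_of_nonneg (by linarith)]
    exact (div_le_self (diagGreen_nonneg ht0 _) g0).trans (diagGreen_le ht0 ht x)
  · intro x hx
    have e : ∀ s ∈ diagSteps, (if x + s = 0 then dirPow (4 * m) x else
        (-1) ^ m * (diagGreen t (x + s) / diagGreen t 0 : ℂ)) =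
        (-1) ^ m * (diagGreen t (x + s) / diagGreen t 0 : ℂ) := by
      intro s hs
      split_ifs with h
      · have hx' : x ∈ diagSteps := by
          rw [eq_neg_of_add_eq_zero_left h]
          simp only [diagSteps, Finset.mem_insert, Finset.mem_singleton] at hs
          rcases hs with rfl | rfl | rfl | rfl <;> decide
        rw [dirPow_four m x hx', h, div_self gne, mul_one]
      · rfl
    rw [Finset.sum_congr rfl e, ← Finset.mul_sum, ← Finset.sum_div]
    have hx2 := diagGreen_eq ht0 ht x
    rw [if_neg hx, zero_add] at hx2
    have hx3 : (diagGreen t x : ℂ) = t * ∑ s ∈ diagSteps, (diagGreen t (x + s) : ℂ) := by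
      exact_mod_cast hx2
    rw [hx3]; ring

theorem Fchar_of_ne_four_mul {t : ℝ} (ht0 : 0 < t) (ht : t < 1 / 4) (m : ℤ) {l : ℂ}
    (hl : l = Complex.I ^ m) (hs : 1 + l + l ^ 2 + l ^ 3 = 0) :
    Fchar t (m : ℝ) = 4 * t ^ 2 * (diagGreen t 0 + l * diagGreen t (2, 0) +
      l ^ 2 * diagGreen t (2, 2) + l ^ 3 * diagGreen t (0, 2)) := by
  have hn : ‖l‖ = 1 := by rw [hl, norm_zpow, Complex.norm_I, one_zpow]
  have hl0 : l ≠ 0 := by intro h; simp [h] at hn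
  have hl4 : l ^ 4 = 1 := by linear_combination (l - 1) * hs
  set w := dirPow m (1, 1) with hw
  have hw0 : w ≠ 0 := dirPow_ne_zero _ _
  have r1 : dirPow m (-1, 1) = l * w := by rw [hl]; exact dirPow_rot m (by decide)
  have r2 : dirPow m (-1, -1) = l ^ 2 * w := by
    have := dirPow_rot m (a := -1) (b := 1) (by decide)
    rw [this, ← hl, r1]; ring
  have r3 : dirPow m (1, -1) = l ^ 3 * w := by
    have := dirPow_rot m (a := -1) (b := -1) (by decide)
    rw [show (1, -1) = ((-(-1), -1) : ℤ × ℤ) by rfl, this, ← hl, r2]; ring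
  set D : ℤ × ℤ → ℂ := fun x => diagGreen t (x - (1, 1)) + l * diagGreen t (x - (-1, 1)) +
    l ^ 2 * diagGreen t (x - (-1, -1)) + l ^ 3 * diagGreen t (x - (1, -1)) with hD
  have D0 : D 0 = 0 := by
    have e1 : diagGreen t (0 - (1, 1)) = diagGreen t (1, 1) := diagGreen_neg t 1 1
    have e2 : diagGreen t (0 - (-1, 1)) = diagGreen t (1, 1) :=
      (diagGreen_rot t (-1) (-1)).trans (diagGreen_neg t 1 1)
    have e3 : diagGreen t (0 - (-1, -1)) = diagGreen t (1, 1) := rfl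
    have e4 : diagGreen t (0 - (1, -1)) = diagGreen t (1, 1) := diagGreen_rot t 1 1
    simp only [hD, e1, e2, e3, e4]
    linear_combination (diagGreen t (1, 1) : ℂ) * hs
  have Deq : ∀ x, D x = (if x = (1, 1) then 1 else 0) + l * (if x = (-1, 1) then 1 else 0) +
      l ^ 2 * (if x = (-1, -1) then 1 else 0) + l ^ 3 * (if x = (1, -1) then 1 else 0) +
      t * ∑ s ∈ diagSteps, D (x + s) := by
    intro x
    have g : ∀ v : ℤ × ℤ, (diagGreen t (x - v) : ℂ) = (if x = v then 1 else 0) +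
        t * ∑ s ∈ diagSteps, (diagGreen t (x + s - v) : ℂ) := by
      intro v
      have := diagGreen_eq ht0 ht (x - v)
      simp only [sub_eq_zero] at this
      rw [this]
      push_cast
      simp only [sub_add_eq_add_sub]
      congr 1
      split_ifs <;> simp
    simp only [hD, g, Finset.sum_add_distrib, ← Finset.mul_sum]
    ring
  have Dbound : ∀ x, ‖D x‖ ≤ 4 * (1 - 4 * t)⁻¹ := by
    intro x
    have g : ∀ v : ℤ × ℤ, ‖(diagGreen t v : ℂ)‖ ≤ (1 - 4 * t)⁻¹ := by
      intro v
      rw [Complex.norm_real, Real.norm_of_nonneg (diagGreen_nonneg ht0 _)]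
      exact diagGreen_le ht0 ht v
    refine (norm_add_le_of_le (norm_add_le_of_le (norm_add_le_of_le (g _)
      (r₂ := (1 - 4 * t)⁻¹) ?_) (r₂ := (1 - 4 * t)⁻¹) ?_) (r₂ := (1 - 4 * t)⁻¹) ?_).trans
        (by linarith)
    all_goals
      simp only [norm_mul, norm_pow, hn, one_pow, one_mul]
      exact g _
  rw [Fchar_int_eq_sum m ht0 ht (H := fun x => w * t * D x) (C := t * (4 * (1 - 4 * t)⁻¹))]
  · rw [sum_diagSteps, r1, r2, r3]
    have d1 : D (1, 1) = diagGreen t 0 + l * diagGreen t (2, 0) +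
      l ^ 2 * diagGreen t (2, 2) + l ^ 3 * diagGreen t (0, 2) := rfl
    have sym : diagGreen t (0, 2) = diagGreen t (2, 0) := diagGreen_rot t 2 0 ▸ by
      simp
    have d2 : D (-1, 1) = l * D (1, 1) := by
      have e1 : diagGreen t ((-1, 1) - (1, 1)) = diagGreen t (2, 0) := diagGreen_neg t 2 0
      have e2 : diagGreen t ((-1, 1) - (-1, 1)) = diagGreen t 0 := rfl
      have e3 : diagGreen t ((-1, 1) - (-1, -1)) = diagGreen t (0, 2) := rfl
      have e4 : diagGreen t ((-1, 1) - (1, -1)) = diagGreen t (2, 2) := diagGreen_rot t 2 2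
      rw [d1]
      simp only [hD, e1, e2, e3, e4, sym]
      linear_combination -(diagGreen t (2, 0) : ℂ) * hl4
    have d3 : D (-1, -1) = l ^ 2 * D (1, 1) := by
      have e1 : diagGreen t ((-1, -1) - (1, 1)) = diagGreen t (2, 2) := diagGreen_neg t 2 2
      have e2 : diagGreen t ((-1, -1) - (-1, 1)) = diagGreen t (2, 0) :=
        (diagGreen_neg t 0 2).trans sym
      have e3 : diagGreen t ((-1, -1) - (-1, -1)) = diagGreen t 0 := rfl
      have e4 : diagGreen t ((-1, -1) - (1, -1)) = diagGreen t (2, 0) := diagGreen_neg t 2 0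
      rw [d1]
      simp only [hD, e1, e2, e3, e4, sym]
      linear_combination -(diagGreen t (2, 2) + l * diagGreen t (2, 0) : ℂ) * hl4
    have d4 : D (1, -1) = l ^ 3 * D (1, 1) := by
      have e1 : diagGreen t ((1, -1) - (1, 1)) = diagGreen t (2, 0) :=
        (diagGreen_neg t 0 2).trans sym
      have e2 : diagGreen t ((1, -1) - (-1, 1)) = diagGreen t (2, 2) := 
        (diagGreen_rot t (-2) (-2)).trans (diagGreen_neg t 2 2) |> fun h => by simpa using h
      have e3 : diagGreen t ((1, -1) - (-1, -1)) = diagGreen t (2, 0) := rfl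
      have e4 : diagGreen t ((1, -1) - (1, -1)) = diagGreen t 0 := rfl
      rw [d1]
      simp only [hD, e1, e2, e3, e4, sym]
      linear_combination -(diagGreen t (2, 0) + l * diagGreen t (2, 2) +
        l ^ 2 * diagGreen t (2, 0) : ℂ) * hl4
    rw [d2, d3, d4, ← d1, ← hw]
    field_simp
    ring
  · intro x
    rw [norm_mul, norm_mul, hw, norm_dirPow, one_mul, Complex.norm_real,
      Real.norm_of_nonneg ht0.le]
    gcongr
    exact Dbound x
  · intro x hx
    have e : ∀ s ∈ diagSteps, (if x + s = 0 then dirPow m x else w * t * D (x + s)) =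
        (if x + s = 0 then dirPow m x else 0) + w * t * D (x + s) := by
      intro s _
      split_ifs with h
      · rw [h, D0]; ring
      · ring
    rw [Finset.sum_congr rfl e, Finset.sum_add_distrib, ← Finset.mul_sum, Deq x, sum_diagSteps,
      sum_diagSteps]
    have c : ∀ v : ℤ × ℤ, x + v = 0 ↔ x = -v := fun v => add_eq_zero_iff_eq_neg
    simp only [c]
    have i1 : -((1, 1) : ℤ × ℤ) = (-1, -1) := rfl
    have i2 : -((1, -1) : ℤ × ℤ) = (-1, 1) := rfl
    have i3 : -((-1, -1) : ℤ × ℤ) = (1, 1) := rfl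
    have i4 : -((-1, 1) : ℤ × ℤ) = (1, -1) := rfl
    rw [i1, i2, i3, i4]
    have j : ∀ (v : ℤ × ℤ) (c : ℂ), dirPow m v = c →
        (if x = v then dirPow m x else 0) = c * if x = v then 1 else 0 := by
      rintro v c rfl
      split_ifs with h
      · rw [h, mul_one]
      · rw [mul_zero]
    rw [j _ _ r1, j _ _ r2, j _ _ r3, j _ _ hw.symm]
    ring

theorem Fchar_odd {t : ℝ} (ht0 : 0 < t) (ht : t < 1 / 4) (m : ℤ) :
    Fchar t ((2 * m + 1 : ℤ) : ℝ) =
      ((4 * t ^ 2 * (diagGreen t (0, 0) - diagGreen t (2, 2)) : ℝ) : ℂ) := by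
  have h2 : (Complex.I ^ (2 * m + 1)) ^ 2 = -1 := by
    rw [← zpow_natCast, ← zpow_mul, show (2 * m + 1) * ((2 : ℕ) : ℤ) = 2 * (2 * m + 1) by
      push_cast; ring, zpow_mul]
    have : Complex.I ^ (2 : ℤ) = -1 := by exact_mod_cast Complex.I_sq
    rw [this]
    exact Odd.neg_one_zpow ⟨m, rfl⟩
  have sym : diagGreen t (0, 2) = diagGreen t (2, 0) := diagGreen_rot t 2 0 ▸ by
    simp
  have h := Fchar_of_ne_four_mul ht0 ht (2 * m + 1) rfl
    (by linear_combination (1 + Complex.I ^ (2 * m + 1)) * h2)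
  rw [h, sym]
  push_cast
  rw [show diagGreen t 0 = diagGreen t (0, 0) from rfl]
  linear_combination 4 * (t : ℂ) ^ 2 * (diagGreen t (2, 2) +
    Complex.I ^ (2 * m + 1) * diagGreen t (2, 0)) * h2

theorem Fchar_four_mul_add_two {t : ℝ} (ht0 : 0 < t) (ht : t < 1 / 4) (m : ℤ) :
    Fchar t ((4 * m + 2 : ℤ) : ℝ) = ((4 * t ^ 2 *
      (diagGreen t (0, 0) - 2 * diagGreen t (2, 0) + diagGreen t (2, 2)) : ℝ) : ℂ) := by
  have h2 : (Complex.I ^ (4 * m + 2)) = -1 := by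
    rw [show (4 * m + 2) = 2 * (2 * m + 1) by ring, zpow_mul]
    have : Complex.I ^ (2 : ℤ) = -1 := by exact_mod_cast Complex.I_sq
    rw [this]
    exact Odd.neg_one_zpow ⟨m, rfl⟩
  have sym : diagGreen t (0, 2) = diagGreen t (2, 0) := diagGreen_rot t 2 0 ▸ by
    simp
  have h := Fchar_of_ne_four_mul ht0 ht (4 * m + 2) h2.symm (by norm_num)
  rw [h, sym]
  push_cast
  rw [show diagGreen t 0 = diagGreen t (0, 0) from rfl]
  ring

lemma integral_zero_one_eq_integral_sin (g : ℝ → ℝ) :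
    ∫ y in (0:ℝ)..1, g y = ∫ θ in (0:ℝ)..(π / 2), Real.cos θ * g (Real.sin θ) := by
  have hπ : (0:ℝ) ≤ π / 2 := by positivity
  have himg : Real.sin '' Ioo 0 (π / 2) = Ioo 0 1 := by
    ext y
    constructor
    · rintro ⟨θ, ⟨h1, h2⟩, rfl⟩
      refine ⟨Real.sin_pos_of_pos_of_lt_pi h1 (by linarith), ?_⟩
      rw [← Real.sin_pi_div_two]
      exact Real.sin_lt_sin_of_lt_of_le_pi_div_two (by linarith) le_rfl h2
    · rintro ⟨h1, h2⟩
      exact ⟨Real.arcsin y, ⟨Real.arcsin_pos.2 h1, Real.arcsin_lt_pi_div_two.2 h2⟩,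
        Real.sin_arcsin (by linarith) h2.le⟩
  rw [intervalIntegral.integral_of_le zero_le_one, intervalIntegral.integral_of_le hπ,
    MeasureTheory.integral_Ioc_eq_integral_Ioo, MeasureTheory.integral_Ioc_eq_integral_Ioo, ← himg,
    MeasureTheory.integral_image_eq_integral_abs_deriv_smul measurableSet_Ioo
      (fun x _ => (Real.hasDerivAt_sin x).hasDerivWithinAt)]
  · refine MeasureTheory.setIntegral_congr_fun measurableSet_Ioo fun θ hθ => ?_
    simp only [smul_eq_mul]
    rw [abs_of_nonneg (Real.cos_nonneg_of_mem_Icc ⟨by linarith [hθ.1], hθ.2.le⟩)]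
  · exact Real.injOn_sin.mono fun θ (hθ : θ ∈ Ioo 0 (π / 2)) =>
      (⟨by linarith [hθ.1], hθ.2.le⟩ : θ ∈ Icc (-(π / 2)) (π / 2))

lemma Kell_eq_integral (k : ℝ) :
    Kell k = ∫ θ in (0:ℝ)..(π / 2), 1 / Real.sqrt (1 - k ^ 2 * Real.sin θ ^ 2) := by
  have hπ : (0:ℝ) ≤ π / 2 := by positivity
  rw [Kell, integral_zero_one_eq_integral_sin, intervalIntegral.integral_of_le hπ,
    intervalIntegral.integral_of_le hπ, MeasureTheory.integral_Ioc_eq_integral_Ioo,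
    MeasureTheory.integral_Ioc_eq_integral_Ioo]
  refine MeasureTheory.setIntegral_congr_fun measurableSet_Ioo fun θ hθ => ?_
  have hc := Real.cos_pos_of_mem_Ioo ⟨by linarith [hθ.1], hθ.2⟩
  have : 1 - Real.sin θ ^ 2 = Real.cos θ ^ 2 := by rw [Real.cos_sq']
  rw [this, Real.sqrt_mul (sq_nonneg _), Real.sqrt_sq hc.le]
  field_simp

lemma Eell_eq_integral (k : ℝ) :
    Eell k = ∫ θ in (0:ℝ)..(π / 2), Real.sqrt (1 - k ^ 2 * Real.sin θ ^ 2) := by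
  have hπ : (0:ℝ) ≤ π / 2 := by positivity
  rw [Eell, integral_zero_one_eq_integral_sin, intervalIntegral.integral_of_le hπ,
    intervalIntegral.integral_of_le hπ, MeasureTheory.integral_Ioc_eq_integral_Ioo,
    MeasureTheory.integral_Ioc_eq_integral_Ioo]
  refine MeasureTheory.setIntegral_congr_fun measurableSet_Ioo fun θ hθ => ?_
  have hc := Real.cos_pos_of_mem_Ioo ⟨by linarith [hθ.1], hθ.2⟩
  have : 1 - Real.sin θ ^ 2 = Real.cos θ ^ 2 := by rw [Real.cos_sq']
  rw [this, Real.sqrt_sq hc.le]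
  field_simp

/-- The Wallis ratio `(2n choose n) / 4 ^ n`. -/
def wallisRatio (n : ℕ) : ℝ := ∏ i ∈ Finset.range n, (2 * (i : ℝ) + 1) / (2 * i + 2)

lemma wallisRatio_zero : wallisRatio 0 = 1 := by simp [wallisRatio]

lemma wallisRatio_succ (n : ℕ) :
    wallisRatio (n + 1) = wallisRatio n * ((2 * n + 1) / (2 * n + 2)) := by
  rw [wallisRatio, Finset.prod_range_succ, wallisRatio]

lemma wallisRatio_nonneg (n : ℕ) : 0 ≤ wallisRatio n := Finset.prod_nonneg fun i _ => by positivity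

lemma wallisRatio_le_one (n : ℕ) : wallisRatio n ≤ 1 := by
  refine Finset.prod_le_one (fun i _ => by positivity) fun i _ => ?_
  rw [div_le_one (by positivity)]; linarith

lemma integral_sin_pow_two_mul (n : ℕ) :
    ∫ θ in (0:ℝ)..(π / 2), Real.sin θ ^ (2 * n) = π / 2 * wallisRatio n := by
  have h := EulerSine.integral_cos_pow_eq (2 * n)
  rw [integral_sin_pow_even] at h
  have h2 := intervalIntegral.integral_comp_sub_left (a := 0) (b := π / 2)
    (fun θ => Real.cos θ ^ (2 * n)) (π / 2)
  simp only [Real.cos_pi_div_two_sub, sub_self, sub_zero] at h2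
  rw [h2, h, wallisRatio]; ring

lemma choose_add_sub_one_eq_prod (r : ℝ) (n : ℕ) :
    Ring.choose (r + n - 1) n = ∏ i ∈ Finset.range n, (r + i) / (i + 1) := by
  rw [← Ring.multichoose_eq]
  have h : ∀ n : ℕ, (n.factorial : ℝ) * Ring.multichoose r n =
      ∏ i ∈ Finset.range n, (r + (i : ℝ)) := by
    intro n
    rw [← nsmul_eq_mul, Ring.factorial_nsmul_multichoose_eq_ascPochhammer]
    induction n with
    | zero => simp
    | succ n ih =>
      rw [Finset.prod_range_succ, ← ih, Polynomial.ascPochhammer_smeval_eq_eval, Polynomial.ascPochhammer_smeval_eq_eval,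
        ascPochhammer_succ_eval]
  have hf : (n.factorial : ℝ) ≠ 0 := by exact_mod_cast n.factorial_ne_zero
  rw [Finset.prod_div_distrib, ← h n]
  have : ∏ i ∈ Finset.range n, ((i : ℝ) + 1) = n.factorial := by
    rw [← Finset.prod_range_add_one_eq_factorial]; push_cast; rfl
  rw [this]
  field_simp

lemma hasSum_one_div_one_sub_rpow (r : ℝ) {x : ℝ} (hx : |x| < 1) :
    HasSum (fun n : ℕ => (∏ i ∈ Finset.range n, (r + i) / (i + 1)) * x ^ n)
      (1 / (1 - x) ^ r) := by
  have h := (Real.one_div_one_sub_rpow_hasFPowerSeriesOnBall_zero r).hasSum (y := x)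
    (by simpa [enorm_eq_nnnorm, ← NNReal.coe_lt_coe] using hx)
  simp only [zero_add] at h
  refine h.congr_fun fun n => ?_
  rw [← choose_add_sub_one_eq_prod]
  simp [mul_comm]

lemma hasSum_one_div_sqrt_one_sub {x : ℝ} (hx : |x| < 1) :
    HasSum (fun n : ℕ => wallisRatio n * x ^ n) (1 / Real.sqrt (1 - x)) := by
  have h := hasSum_one_div_one_sub_rpow (1 / 2) hx
  rw [← Real.sqrt_eq_rpow] at h
  refine h.congr_fun fun n => ?_
  rw [wallisRatio]
  congr 1
  refine Finset.prod_congr rfl fun i _ => ?_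
  field_simp
  ring

lemma hasSum_sqrt_one_sub {x : ℝ} (hx : |x| < 1) :
    HasSum (fun n : ℕ => wallisRatio n / (1 - 2 * n) * x ^ n) (Real.sqrt (1 - x)) := by
  have h := hasSum_one_div_one_sub_rpow (-(1 / 2)) hx
  have h1 : 0 ≤ 1 - x := by linarith [(abs_lt.1 hx).2]
  rw [Real.rpow_neg h1, ← Real.sqrt_eq_rpow, one_div (Real.sqrt _)⁻¹, inv_inv] at h
  refine h.congr_fun fun n => ?_
  congr 1
  have hn : ∀ n : ℕ, (1 - 2 * (n : ℝ)) ≠ 0 := by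
    intro n h
    have : (2 * n : ℝ) = 1 := by linarith
    have : 2 * n = 1 := by exact_mod_cast this
    omega
  rw [div_eq_iff (hn n)]
  induction n with
  | zero => simp [wallisRatio]
  | succ n ih =>
    rw [wallisRatio_succ, ih, Finset.prod_range_succ]
    push_cast
    field_simp
    ring

lemma hasSum_integral_sin_series {a : ℕ → ℝ} {f : ℝ → ℝ} (ha : ∀ n, |a n| ≤ 1)
    {k : ℝ} (hk0 : 0 ≤ k) (hk1 : k < 1)
    (hf : ∀ x, |x| < 1 → HasSum (fun n : ℕ => a n * x ^ n) (f x)) :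
    HasSum (fun n : ℕ => a n * wallisRatio n * k ^ (2 * n))
      (2 / π * ∫ θ in (0:ℝ)..(π / 2), f (k ^ 2 * Real.sin θ ^ 2)) := by
  have hk2 : k ^ 2 < 1 := by nlinarith
  have hx : ∀ θ : ℝ, |k ^ 2 * Real.sin θ ^ 2| ≤ k ^ 2 := by
    intro θ
    rw [abs_of_nonneg (by positivity)]
    exact mul_le_of_le_one_right (by positivity) (Real.sin_sq_le_one θ)
  have h := intervalIntegral.hasSum_integral_of_dominated_convergence (a := 0) (b := π / 2)
    (μ := MeasureTheory.volume) (F := fun n θ => a n * (k ^ 2 * Real.sin θ ^ 2) ^ n)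
    (f := fun θ => f (k ^ 2 * Real.sin θ ^ 2)) (fun n _ => (k ^ 2) ^ n)
    (fun n => Continuous.aestronglyMeasurable (by fun_prop))
    (fun n => Filter.Eventually.of_forall fun θ _ => by
      rw [norm_mul, norm_pow, Real.norm_eq_abs, Real.norm_eq_abs]
      calc _ ≤ 1 * (k ^ 2) ^ n := by gcongr; exacts [ha n, hx θ]
        _ = _ := one_mul _)
    (Filter.Eventually.of_forall fun θ _ => summable_geometric_of_lt_one (by positivity) hk2)
    (by simp)
    (Filter.Eventually.of_forall fun θ _ => hf _ ((hx θ).trans_lt hk2))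
  refine (h.mul_left (2 / π)).congr_fun fun n => ?_
  have : ∀ θ : ℝ, a n * (k ^ 2 * Real.sin θ ^ 2) ^ n = a n * k ^ (2 * n) * Real.sin θ ^ (2 * n) := by
    intro θ; rw [mul_pow, ← pow_mul, ← pow_mul]; ring
  simp only [this]
  rw [intervalIntegral.integral_const_mul, integral_sin_pow_two_mul]
  have := Real.pi_ne_zero
  field_simp

lemma hasSum_Kell {k : ℝ} (hk0 : 0 ≤ k) (hk1 : k < 1) :
    HasSum (fun n : ℕ => wallisRatio n ^ 2 * k ^ (2 * n)) (2 / π * Kell k) := by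
  rw [Kell_eq_integral]
  have := hasSum_integral_sin_series (fun n => by
    rw [abs_of_nonneg (wallisRatio_nonneg n)]; exact wallisRatio_le_one n) hk0 hk1
    (fun x => hasSum_one_div_sqrt_one_sub)
  simpa only [sq] using this

lemma hasSum_Eell {k : ℝ} (hk0 : 0 ≤ k) (hk1 : k < 1) :
    HasSum (fun n : ℕ => wallisRatio n ^ 2 / (1 - 2 * n) * k ^ (2 * n)) (2 / π * Eell k) := by
  rw [Eell_eq_integral]
  have := hasSum_integral_sin_series (fun n => by
    rw [abs_div, abs_of_nonneg (wallisRatio_nonneg n)]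
    refine div_le_one_of_le₀ ((wallisRatio_le_one n).trans ?_) (abs_nonneg _)
    cases n with
    | zero => simp
    | succ n =>
      rw [abs_of_nonpos (by push_cast; linarith)]; push_cast; linarith) hk0 hk1
    (fun x => hasSum_sqrt_one_sub)
  refine this.congr_fun fun n => ?_
  ring

lemma choose_two_mul_self (n : ℕ) : ((2 * n).choose n : ℝ) = 4 ^ n * wallisRatio n := by
  induction n with
  | zero => simp [wallisRatio]
  | succ n ih =>
    have h := Nat.succ_mul_centralBinom_succ n
    have h' : ((n : ℝ) + 1) * ((2 * (n + 1)).choose (n + 1) : ℝ) =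
        2 * (2 * n + 1) * ((2 * n).choose n : ℝ) := by
      exact_mod_cast h
    rw [ih] at h'
    rw [wallisRatio_succ]
    have hn : (n : ℝ) + 1 ≠ 0 := by positivity
    apply mul_left_cancel₀ hn
    rw [h']
    field_simp
    ring

lemma choose_two_mul_succ (n : ℕ) :
    ((2 * n).choose (n + 1) : ℝ) = 4 ^ n * (wallisRatio n * (n / (n + 1))) := by
  have h := Nat.choose_succ_right_eq (2 * n) n
  have h' : ((2 * n).choose (n + 1) : ℝ) * (n + 1) = (2 * n).choose n * n := by
    rw [show 2 * n - n = n by omega] at h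
    exact_mod_cast h
  rw [choose_two_mul_self] at h'
  field_simp
  linarith

lemma hasSum_diagGreen_wallis {t : ℝ} (ht0 : 0 < t) (ht : t < 1 / 4) :
    HasSum (fun n : ℕ => wallisRatio n ^ 2 * (4 * t) ^ (2 * n)) (diagGreen t (0, 0)) ∧
    HasSum (fun n : ℕ => wallisRatio n ^ 2 * (n / (n + 1)) * (4 * t) ^ (2 * n))
      (diagGreen t (2, 0)) ∧
    HasSum (fun n : ℕ => wallisRatio n ^ 2 * (n / (n + 1)) ^ 2 * (4 * t) ^ (2 * n))
      (diagGreen t (2, 2)) := by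
  have e : ∀ n : ℕ, (4 * t) ^ (2 * n) = 4 ^ n * 4 ^ n * t ^ (2 * n) := by
    intro n; rw [mul_pow]; ring
  refine ⟨?_, ?_, ?_⟩
  · refine (hasSum_diagGreen_even ht0 ht 0 0).congr_fun fun n => ?_
    rw [e, add_zero, choose_two_mul_self]; ring
  · refine (hasSum_diagGreen_even ht0 ht 1 0).congr_fun fun n => ?_
    rw [e, add_zero, choose_two_mul_self, choose_two_mul_succ]; ring
  · refine (hasSum_diagGreen_even ht0 ht 1 1).congr_fun fun n => ?_
    rw [e, choose_two_mul_succ]; ring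

lemma diagGreen_zero_eq {t : ℝ} (ht0 : 0 < t) (ht : t < 1 / 4) :
    diagGreen t 0 = 2 / π * Kell (4 * t) :=
  (hasSum_diagGreen_wallis ht0 ht).1.unique (hasSum_Kell (by linarith) (by linarith))

lemma diagGreen_sub_eq {t : ℝ} (ht0 : 0 < t) (ht : t < 1 / 4) :
    4 * t ^ 2 * (diagGreen t (0, 0) - diagGreen t (2, 2)) = 1 - 2 * Eell (4 * t) / π := by
  obtain ⟨h0, -, h2⟩ := hasSum_diagGreen_wallis ht0 ht
  have hE := (hasSum_nat_add_iff' 1).2 (hasSum_Eell (k := 4 * t) (by linarith) (by linarith))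
  have h := (h0.sub h2).mul_left (4 * t ^ 2)
  have h' := hE.neg
  have := h.unique (h'.congr_fun fun n => ?_)
  · rw [this]; simp [wallisRatio_zero]; ring
  · rw [wallisRatio_succ]
    push_cast
    have h1 : (1 - 2 * ((n : ℝ) + 1)) = - (2 * n + 1) := by ring
    rw [h1, mul_add 2 n 1, pow_add (4 * t)]
    have : (2 * (n : ℝ) + 1) ≠ 0 := by positivity
    have : ((n : ℝ) + 1) ≠ 0 := by positivity
    field_simp
    ring

lemma diagGreen_combination_eq {t : ℝ} (ht0 : 0 < t) (ht : t < 1 / 4) :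
    4 * t ^ 2 * (diagGreen t (0, 0) - 2 * diagGreen t (2, 0) + diagGreen t (2, 2)) =
      -1 + 4 * Eell (4 * t) / π - (1 - (4 * t) ^ 2) * (2 * Kell (4 * t)) / π := by
  obtain ⟨h0, h1, h2⟩ := hasSum_diagGreen_wallis ht0 ht
  have hK0 := hasSum_Kell (k := 4 * t) (by linarith) (by linarith)
  have hE := (hasSum_nat_add_iff' 1).2 (hasSum_Eell (k := 4 * t) (by linarith) (by linarith))
  have hK := (hasSum_nat_add_iff' 1).2 hK0
  have h := ((h0.sub (h1.mul_left 2)).add h2).mul_left (4 * t ^ 2)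
  have h' := ((hE.mul_left 2).sub hK).add (hK0.mul_left ((4 * t) ^ 2))
  have := h.unique (h'.congr_fun fun n => ?_)
  · rw [this]; simp [wallisRatio_zero]; ring
  · rw [wallisRatio_succ]
    push_cast
    have h1 : (1 - 2 * ((n : ℝ) + 1)) = - (2 * n + 1) := by ring
    rw [h1, mul_add 2 n 1, pow_add (4 * t)]
    have : (2 * (n : ℝ) + 1) ≠ 0 := by positivity
    have : ((n : ℝ) + 1) ≠ 0 := by positivity
    field_simp
    ring

/-- The incomplete elliptic integral of the first kind. -/
def ellF (k φ : ℝ) : ℝ := ∫ θ in (0:ℝ)..φ, 1 / Real.sqrt (1 - k ^ 2 * Real.sin θ ^ 2)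

lemma one_sub_sq_mul_sq_pos {k : ℝ} (hk : k ∈ Ioo (0:ℝ) 1) {s : ℝ} (hs : s ^ 2 ≤ 1) :
    0 < 1 - k ^ 2 * s ^ 2 := by
  have := hk.1
  have := hk.2
  nlinarith [sq_nonneg s, mul_nonneg (sq_nonneg k) (sub_nonneg.2 hs)]

lemma ellF_integrand_continuous {k : ℝ} (hk : k ∈ Ioo (0:ℝ) 1) :
    Continuous fun θ : ℝ => 1 / Real.sqrt (1 - k ^ 2 * Real.sin θ ^ 2) := by
  refine continuous_const.div (by fun_prop) fun θ => ?_
  exact (Real.sqrt_pos.2 (one_sub_sq_mul_sq_pos hk (Real.sin_sq_le_one θ))).ne'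

lemma hasDerivAt_ellF {k : ℝ} (hk : k ∈ Ioo (0:ℝ) 1) (φ : ℝ) :
    HasDerivAt (ellF k) (1 / Real.sqrt (1 - k ^ 2 * Real.sin φ ^ 2)) φ :=
  (ellF_integrand_continuous hk).integral_hasStrictDerivAt 0 φ |>.hasDerivAt

lemma strictMono_ellF {k : ℝ} (hk : k ∈ Ioo (0:ℝ) 1) : StrictMono (ellF k) := by
  refine strictMono_of_deriv_pos fun φ => ?_
  rw [(hasDerivAt_ellF hk φ).deriv]
  have := Real.sqrt_pos.2 (one_sub_sq_mul_sq_pos hk (Real.sin_sq_le_one φ))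
  positivity

lemma ellF_neg (k φ : ℝ) : ellF k (-φ) = -ellF k φ := by
  have := intervalIntegral.integral_comp_neg (a := 0) (b := φ)
    (fun θ => 1 / Real.sqrt (1 - k ^ 2 * Real.sin θ ^ 2))
  simp only [Real.sin_neg, neg_sq, neg_zero] at this
  rw [ellF, ellF, this, intervalIntegral.integral_symm]

lemma ellF_zero (k : ℝ) : ellF k 0 = 0 := by simp [ellF]

lemma ellF_pi_div_two (k : ℝ) : ellF k (π / 2) = Kell k := (Kell_eq_integral k).symm

lemma ellF_add_pi {k : ℝ} (hk : k ∈ Ioo (0:ℝ) 1) (φ : ℝ) :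
    ellF k (φ + π) = ellF k φ + 2 * Kell k := by
  have hi := fun a b : ℝ => (ellF_integrand_continuous hk).intervalIntegrable
    (μ := MeasureTheory.volume) a b
  have hp : Function.Periodic (fun θ : ℝ => 1 / Real.sqrt (1 - k ^ 2 * Real.sin θ ^ 2)) π := by
    intro θ; simp [Real.sin_add_pi]
  have h1 := hp.intervalIntegral_add_eq φ (-(π / 2))
  rw [show -(π / 2) + π = π / 2 by ring] at h1
  rw [ellF, ← intervalIntegral.integral_add_adjacent_intervals (hi 0 φ) (hi φ (φ + π)), h1,
    ← intervalIntegral.integral_add_adjacent_intervals (hi (-(π / 2)) 0) (hi 0 (π / 2)),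
    intervalIntegral.integral_symm 0 (-(π / 2))]
  have e1 := ellF_neg k (π / 2)
  have e2 := ellF_pi_div_two k
  simp only [ellF] at e1 e2 ⊢
  rw [e1, e2]; ring

lemma Kell_pos {k : ℝ} (hk : k ∈ Ioo (0:ℝ) 1) : 0 < Kell k := by
  rw [← ellF_pi_div_two, ← ellF_zero k]
  exact strictMono_ellF hk (by positivity)

lemma continuous_ellF {k : ℝ} (hk : k ∈ Ioo (0:ℝ) 1) : Continuous (ellF k) :=
  continuous_iff_continuousAt.2 fun φ => (hasDerivAt_ellF hk φ).continuousAt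

lemma surjective_ellF {k : ℝ} (hk : k ∈ Ioo (0:ℝ) 1) : Function.Surjective (ellF k) := by
  have hn : ∀ n : ℕ, ellF k (n * π) = n * (2 * Kell k) := by
    intro n
    induction n with
    | zero => simp [ellF_zero]
    | succ n ih =>
      push_cast
      rw [add_mul, one_mul, ellF_add_pi hk, ih]; ring
  have hK := Kell_pos hk
  intro y
  obtain ⟨n, hn'⟩ := exists_nat_ge (|y| / (2 * Kell k))
  rw [div_le_iff₀ (by positivity), abs_le] at hn'
  have := intermediate_value_Icc (a := -(n * π)) (b := n * π) (by
    have := Real.pi_pos; nlinarith [(Nat.cast_nonneg n : (0:ℝ) ≤ n)])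
    (continuous_ellF hk).continuousOn
  rw [ellF_neg, hn] at this
  obtain ⟨x, -, hx⟩ := this ⟨hn'.1, hn'.2⟩
  exact ⟨x, hx⟩

/-- The Jacobi amplitude. -/
def jam (k : ℝ) : ℝ → ℝ := Function.invFun (ellF k)

/-- The Jacobi elliptic function `sn`. -/
def jsn (k u : ℝ) : ℝ := Real.sin (jam k u)

/-- The Jacobi elliptic function `cn`. -/
def jcn (k u : ℝ) : ℝ := Real.cos (jam k u)

/-- The Jacobi elliptic function `dn`. -/
def jdn (k u : ℝ) : ℝ := Real.sqrt (1 - k ^ 2 * jsn k u ^ 2)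

section Jacobi

variable {k : ℝ}

lemma ellF_jam (hk : k ∈ Ioo (0:ℝ) 1) (u : ℝ) : ellF k (jam k u) = u :=
  Function.rightInverse_invFun (surjective_ellF hk) u

lemma jam_ellF (hk : k ∈ Ioo (0:ℝ) 1) (φ : ℝ) : jam k (ellF k φ) = φ :=
  Function.leftInverse_invFun (strictMono_ellF hk).injective φ

lemma strictMono_jam (hk : k ∈ Ioo (0:ℝ) 1) : StrictMono (jam k) := by
  intro u v h
  by_contra! hc
  have := (strictMono_ellF hk).monotone hc
  rw [ellF_jam hk, ellF_jam hk] at this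
  linarith

lemma continuous_jam (hk : k ∈ Ioo (0:ℝ) 1) : Continuous (jam k) :=
  (strictMono_jam hk).monotone.continuous_of_surjective fun φ => ⟨_, jam_ellF hk φ⟩

lemma jsn_sq_add_jcn_sq (k u : ℝ) : jsn k u ^ 2 + jcn k u ^ 2 = 1 := Real.sin_sq_add_cos_sq _

lemma jsn_sq_le_one (k u : ℝ) : jsn k u ^ 2 ≤ 1 := Real.sin_sq_le_one _

lemma jdn_pos (hk : k ∈ Ioo (0:ℝ) 1) (u : ℝ) : 0 < jdn k u :=
  Real.sqrt_pos.2 (one_sub_sq_mul_sq_pos hk (jsn_sq_le_one k u))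

lemma jdn_sq (hk : k ∈ Ioo (0:ℝ) 1) (u : ℝ) : jdn k u ^ 2 = 1 - k ^ 2 * jsn k u ^ 2 :=
  Real.sq_sqrt (one_sub_sq_mul_sq_pos hk (jsn_sq_le_one k u)).le

lemma jdn_le_one (hk : k ∈ Ioo (0:ℝ) 1) (u : ℝ) : jdn k u ≤ 1 := by
  have h1 := jdn_sq hk u
  have h2 := jdn_pos hk u
  nlinarith [sq_nonneg (k * jsn k u)]

lemma hasDerivAt_jam (hk : k ∈ Ioo (0:ℝ) 1) (u : ℝ) : HasDerivAt (jam k) (jdn k u) u := by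
  have h := HasDerivAt.of_local_left_inverse (f := ellF k) (g := jam k) (a := u)
    (continuous_jam hk).continuousAt (hasDerivAt_ellF hk (jam k u))
    (by
      have := Real.sqrt_pos.2 (one_sub_sq_mul_sq_pos hk (Real.sin_sq_le_one (jam k u)))
      positivity) (Filter.Eventually.of_forall fun v => ellF_jam hk v)
  refine h.congr_deriv ?_
  rw [one_div, inv_inv]
  rfl

lemma hasDerivAt_jsn (hk : k ∈ Ioo (0:ℝ) 1) (u : ℝ) :
    HasDerivAt (jsn k) (jcn k u * jdn k u) u := (hasDerivAt_jam hk u).sin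

lemma hasDerivAt_jcn (hk : k ∈ Ioo (0:ℝ) 1) (u : ℝ) :
    HasDerivAt (jcn k) (-jsn k u * jdn k u) u := (hasDerivAt_jam hk u).cos

lemma hasDerivAt_jdn (hk : k ∈ Ioo (0:ℝ) 1) (u : ℝ) :
    HasDerivAt (jdn k) (-(k ^ 2 * jsn k u * jcn k u)) u := by
  have hp := jdn_pos hk u
  have h := ((((hasDerivAt_jsn hk u).pow 2).const_mul (k ^ 2)).const_sub 1).sqrt
    (one_sub_sq_mul_sq_pos hk (jsn_sq_le_one k u)).ne'
  refine h.congr_deriv ?_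
  change _ / (2 * jdn k u) = _
  field_simp
  simp
  ring

lemma jam_zero (hk : k ∈ Ioo (0:ℝ) 1) : jam k 0 = 0 := by
  have := jam_ellF hk 0
  rwa [ellF_zero] at this

lemma jam_Kell (hk : k ∈ Ioo (0:ℝ) 1) : jam k (Kell k) = π / 2 := by
  rw [← ellF_pi_div_two, jam_ellF hk]

lemma jam_neg (hk : k ∈ Ioo (0:ℝ) 1) (u : ℝ) : jam k (-u) = -jam k u := by
  rw [← jam_ellF hk (-jam k u), ellF_neg, ellF_jam hk]

lemma jam_add_two_Kell (hk : k ∈ Ioo (0:ℝ) 1) (u : ℝ) :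
    jam k (u + 2 * Kell k) = jam k u + π := by
  rw [← jam_ellF hk (jam k u + π), ellF_add_pi hk, ellF_jam hk]

lemma jsn_add_two_Kell (hk : k ∈ Ioo (0:ℝ) 1) (u : ℝ) : jsn k (u + 2 * Kell k) = -jsn k u := by
  rw [jsn, jam_add_two_Kell hk, Real.sin_add_pi, jsn]

lemma jcn_add_two_Kell (hk : k ∈ Ioo (0:ℝ) 1) (u : ℝ) : jcn k (u + 2 * Kell k) = -jcn k u := by
  rw [jcn, jam_add_two_Kell hk, Real.cos_add_pi, jcn]

lemma jdn_add_two_Kell (hk : k ∈ Ioo (0:ℝ) 1) (u : ℝ) : jdn k (u + 2 * Kell k) = jdn k u := by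
  rw [jdn, jsn_add_two_Kell hk, neg_sq, jdn]

lemma jsn_neg (hk : k ∈ Ioo (0:ℝ) 1) (u : ℝ) : jsn k (-u) = -jsn k u := by
  rw [jsn, jam_neg hk, Real.sin_neg, jsn]

lemma jcn_neg (hk : k ∈ Ioo (0:ℝ) 1) (u : ℝ) : jcn k (-u) = jcn k u := by
  rw [jcn, jam_neg hk, Real.cos_neg, jcn]

lemma jdn_neg (hk : k ∈ Ioo (0:ℝ) 1) (u : ℝ) : jdn k (-u) = jdn k u := by
  rw [jdn, jsn_neg hk, neg_sq, jdn]

lemma jsn_zero (hk : k ∈ Ioo (0:ℝ) 1) : jsn k 0 = 0 := by simp [jsn, jam_zero hk]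

lemma jcn_zero (hk : k ∈ Ioo (0:ℝ) 1) : jcn k 0 = 1 := by simp [jcn, jam_zero hk]

lemma jdn_zero (hk : k ∈ Ioo (0:ℝ) 1) : jdn k 0 = 1 := by simp [jdn, jsn_zero hk]

lemma jsn_Kell (hk : k ∈ Ioo (0:ℝ) 1) : jsn k (Kell k) = 1 := by simp [jsn, jam_Kell hk]

lemma jcn_Kell (hk : k ∈ Ioo (0:ℝ) 1) : jcn k (Kell k) = 0 := by simp [jcn, jam_Kell hk]

lemma kComp_mem (hk : k ∈ Ioo (0:ℝ) 1) : kComp k ∈ Ioo (0:ℝ) 1 := by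
  have h0 := hk.1
  have h1 := hk.2
  refine ⟨Real.sqrt_pos.2 (by nlinarith), ?_⟩
  rw [kComp, Real.sqrt_lt' one_pos]
  nlinarith

lemma kComp_sq (hk : k ∈ Ioo (0:ℝ) 1) : kComp k ^ 2 = 1 - k ^ 2 := by
  have h0 := hk.1
  have h1 := hk.2
  exact Real.sq_sqrt (by nlinarith)

lemma jdn_kComp_sq (hk : k ∈ Ioo (0:ℝ) 1) (s : ℝ) :
    jdn (kComp k) s ^ 2 = k ^ 2 + (1 - k ^ 2) * jcn (kComp k) s ^ 2 := by
  rw [jdn_sq (kComp_mem hk), kComp_sq hk]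
  linear_combination (-(1 - k ^ 2)) * jsn_sq_add_jcn_sq (kComp k) s

lemma jdn_kComp_Kell (hk : k ∈ Ioo (0:ℝ) 1) : jdn (kComp k) (Kell (kComp k)) = k := by
  have h := jdn_kComp_sq hk (Kell (kComp k))
  rw [jcn_Kell (kComp_mem hk)] at h
  have := jdn_pos (kComp_mem hk) (Kell (kComp k))
  have := hk.1
  nlinarith

lemma jcn_add_jdn_pos (hk : k ∈ Ioo (0:ℝ) 1) {s : ℝ} (hs : s ∈ Ioo (-(2 * Kell (kComp k)))
    (2 * Kell (kComp k))) : 0 < jcn (kComp k) s + jdn (kComp k) s := by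
  have hk' := kComp_mem hk
  have hm : jam (kComp k) (2 * Kell (kComp k)) = π := by
    have := jam_add_two_Kell hk' 0
    rwa [zero_add, jam_zero hk', zero_add] at this
  have h1 : jam (kComp k) s < π := hm ▸ strictMono_jam hk' hs.2
  have h2 : -π < jam (kComp k) s := by
    have := strictMono_jam hk' hs.1
    rwa [jam_neg hk', hm] at this
  have hc : -1 < jcn (kComp k) s := by
    rw [jcn, ← Real.cos_pi, ← Real.cos_abs (jam _ s)]
    exact Real.cos_lt_cos_of_nonneg_of_le_pi (abs_nonneg _) le_rfl (abs_lt.2 ⟨h2, h1⟩)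
  have h3 := jdn_kComp_sq hk s
  have h4 := jdn_pos hk' s
  have h5 : jcn (kComp k) s ≤ 1 := Real.cos_le_one _
  have h6 := hk.1
  by_contra! hneg
  have : jdn (kComp k) s ≤ - jcn (kComp k) s := by linarith
  have h7 : jdn (kComp k) s ^ 2 ≤ jcn (kComp k) s ^ 2 := by nlinarith
  have h8 : jcn (kComp k) s ^ 2 < 1 := by nlinarith
  nlinarith [mul_pos (pow_pos h6 2) (sub_pos.2 h8)]

end Jacobi

/-- The real restriction of the uniformizing function `X`. -/
def xRe (k u : ℝ) : ℝ := k * jsn k u / (1 + jdn k u)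

/-- The derivative of `xRe`. -/
def xRe' (k u : ℝ) : ℝ := k * jcn k u / (1 + jdn k u)

/-- The modulus of the uniformizing function `X` on the imaginary axis, up to sign. -/
def xIm (k s : ℝ) : ℝ := k * jsn (kComp k) s / (jcn (kComp k) s + jdn (kComp k) s)

/-- The derivative of `xIm`. -/
def xIm' (k s : ℝ) : ℝ := k / (jcn (kComp k) s + jdn (kComp k) s)

section Uniformization

variable {k : ℝ}

lemma xRe_sq (hk : k ∈ Ioo (0:ℝ) 1) (u : ℝ) :
    xRe k u ^ 2 = (1 - jdn k u) / (1 + jdn k u) := by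
  have h1 := jdn_pos hk u
  have h2 := jdn_sq hk u
  rw [xRe]
  field_simp
  linear_combination h2

lemma hasDerivAt_xRe (hk : k ∈ Ioo (0:ℝ) 1) (u : ℝ) :
    HasDerivAt (xRe k) (xRe' k u) u := by
  have h1 := jdn_pos hk u
  have h2 := jdn_sq hk u
  have h := ((hasDerivAt_jsn hk u).const_mul k).div ((hasDerivAt_jdn hk u).const_add 1)
    (by positivity)
  refine h.congr_deriv ?_
  rw [xRe']
  field_simp
  linear_combination k * jcn k u * h2

lemma hasDerivAt_xRe' (hk : k ∈ Ioo (0:ℝ) 1) (u : ℝ) :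
    HasDerivAt (xRe' k) (k ^ 2 / 2 * xRe k u * (1 + xRe k u ^ 2) - xRe k u) u := by
  have h1 := jdn_pos hk u
  have h2 := jdn_sq hk u
  have h3 := jsn_sq_add_jcn_sq k u
  have h := ((hasDerivAt_jcn hk u).const_mul k).div ((hasDerivAt_jdn hk u).const_add 1)
    (by positivity)
  refine h.congr_deriv ?_
  rw [xRe_sq hk, xRe]
  field_simp
  linear_combination (-2 * k * jsn k u) * h2 + 2 * k ^ 3 * jsn k u * h3

lemma xRe'_sq (hk : k ∈ Ioo (0:ℝ) 1) (u : ℝ) :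
    xRe' k u ^ 2 = k ^ 2 / 4 * (1 + xRe k u ^ 2) ^ 2 - xRe k u ^ 2 := by
  have h1 := jdn_pos hk u
  have h2 := jdn_sq hk u
  have h3 := jsn_sq_add_jcn_sq k u
  rw [xRe_sq hk, xRe']
  field_simp
  linear_combination -4 * h2 + 4 * k ^ 2 * h3

lemma xIm_sq (hk : k ∈ Ioo (0:ℝ) 1) {s : ℝ}
    (hs : s ∈ Ioo (-(2 * Kell (kComp k))) (2 * Kell (kComp k))) :
    xIm k s ^ 2 = (jdn (kComp k) s - jcn (kComp k) s) / (jcn (kComp k) s + jdn (kComp k) s) := by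
  have h1 := jcn_add_jdn_pos hk hs
  have h2 := jdn_kComp_sq hk s
  have h3 := jsn_sq_add_jcn_sq (kComp k) s
  rw [xIm]
  field_simp
  linear_combination -h2 + k ^ 2 * h3

lemma hasDerivAt_xIm (hk : k ∈ Ioo (0:ℝ) 1) {s : ℝ}
    (hs : s ∈ Ioo (-(2 * Kell (kComp k))) (2 * Kell (kComp k))) :
    HasDerivAt (xIm k) (xIm' k s) s := by
  have h1 := jcn_add_jdn_pos hk hs
  have h2 := jdn_sq (kComp_mem hk) s
  have h3 := jsn_sq_add_jcn_sq (kComp k) s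
  have hk' := kComp_mem hk
  have h := ((hasDerivAt_jsn hk' s).const_mul k).div
    ((hasDerivAt_jcn hk' s).add (hasDerivAt_jdn hk' s)) h1.ne'
  refine h.congr_deriv ?_
  rw [xIm']
  simp only [Pi.add_apply]
  field_simp
  linear_combination k * jcn (kComp k) s * h2 + k * jdn (kComp k) s * h3

lemma hasDerivAt_xIm' (hk : k ∈ Ioo (0:ℝ) 1) {s : ℝ}
    (hs : s ∈ Ioo (-(2 * Kell (kComp k))) (2 * Kell (kComp k))) :
    HasDerivAt (xIm' k) (xIm k s - k ^ 2 / 2 * xIm k s * (1 - xIm k s ^ 2)) s := by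
  have h1 := jcn_add_jdn_pos hk hs
  have hk' := kComp_mem hk
  have h := (hasDerivAt_const s k).div
    ((hasDerivAt_jcn hk' s).add (hasDerivAt_jdn hk' s)) h1.ne'
  refine h.congr_deriv ?_
  rw [xIm_sq hk hs, xIm, kComp_sq hk]
  simp only [Pi.add_apply]
  field_simp
  ring

lemma xIm'_sq (hk : k ∈ Ioo (0:ℝ) 1) {s : ℝ}
    (hs : s ∈ Ioo (-(2 * Kell (kComp k))) (2 * Kell (kComp k))) :
    xIm' k s ^ 2 = k ^ 2 / 4 * (1 - xIm k s ^ 2) ^ 2 + xIm k s ^ 2 := by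
  have h1 := jcn_add_jdn_pos hk hs
  have h2 := jdn_kComp_sq hk s
  rw [xIm_sq hk hs, xIm']
  field_simp
  linear_combination -4 * h2

/-- The uniformizing elliptic function `X`, in real coordinates. -/
def xC (k : ℝ) (z : ℂ) : ℂ :=
  2 / k * ((xRe k z.re * xIm' k z.im + I * (xIm k z.im * xRe' k z.re)) /
    (1 + (xRe k z.re) ^ 2 * (xIm k z.im) ^ 2))

lemma differentiableAt_of_partials {f : ℂ → ℂ} {z f' : ℂ} (hf : DifferentiableAt ℝ f z)
    (h1 : HasDerivAt (fun u : ℝ => f (u + z.im * I)) f' z.re)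
    (h2 : HasDerivAt (fun s : ℝ => f (z.re + s * I)) (I * f') z.im) :
    DifferentiableAt ℂ f z := by
  rw [differentiableAt_complex_iff_differentiableAt_real]
  refine ⟨hf, ?_⟩
  have hz : (z.re : ℂ) + z.im * I = z := Complex.re_add_im z
  have hf' : HasFDerivAt f (fderiv ℝ f z) ((z.re : ℂ) + z.im * I) := by
    rw [hz]; exact hf.hasFDerivAt
  have e1 : HasDerivAt (fun u : ℝ => (u : ℂ) + z.im * I) 1 z.re := by
    simpa using (Complex.ofRealCLM.hasDerivAt (x := z.re)).add_const (z.im * I : ℂ)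
  have e2 : HasDerivAt (fun s : ℝ => (z.re : ℂ) + s * I) I z.im := by
    simpa using ((Complex.ofRealCLM.hasDerivAt (x := z.im)).mul_const I).const_add (z.re : ℂ)
  have g1 := (hf'.comp_hasDerivAt z.re e1).unique h1
  have g2 := (hf'.comp_hasDerivAt z.im e2).unique h2
  rw [g1, g2, smul_eq_mul]

lemma one_add_xRe_xIm_ne_zero (a b : ℝ) : (1 + (a : ℂ) ^ 2 * (b : ℂ) ^ 2) ≠ 0 := by
  have : (0:ℝ) < 1 + a ^ 2 * b ^ 2 := by positivity
  exact_mod_cast this.ne'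

lemma differentiableAt_ofReal_comp_re {f : ℝ → ℝ} {z : ℂ} (hf : DifferentiableAt ℝ f z.re) :
    DifferentiableAt ℝ (fun w : ℂ => (f w.re : ℂ)) z :=
  Complex.ofRealCLM.differentiableAt.comp z (hf.comp z Complex.reCLM.differentiableAt)

lemma differentiableAt_ofReal_comp_im {f : ℝ → ℝ} {z : ℂ} (hf : DifferentiableAt ℝ f z.im) :
    DifferentiableAt ℝ (fun w : ℂ => (f w.im : ℂ)) z :=
  Complex.ofRealCLM.differentiableAt.comp z (hf.comp z Complex.imCLM.differentiableAt)

lemma differentiableAt_xC (hk : k ∈ Ioo (0:ℝ) 1) {z : ℂ}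
    (hs : z.im ∈ Ioo (-(2 * Kell (kComp k))) (2 * Kell (kComp k))) :
    DifferentiableAt ℂ (xC k) z := by
  have a1 := hasDerivAt_xRe hk z.re
  have a2 := hasDerivAt_xRe' hk z.re
  have b1 := hasDerivAt_xIm hk hs
  have b2 := hasDerivAt_xIm' hk hs
  have hk0 : (k : ℂ) ≠ 0 := by exact_mod_cast hk.1.ne'
  have hP := one_add_xRe_xIm_ne_zero (xRe k z.re) (xIm k z.im)
  have A1 := differentiableAt_ofReal_comp_re a1.differentiableAt
  have A2 := differentiableAt_ofReal_comp_re a2.differentiableAt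
  have B1 := differentiableAt_ofReal_comp_im b1.differentiableAt
  have B2 := differentiableAt_ofReal_comp_im b2.differentiableAt
  have hreal : DifferentiableAt ℝ (xC k) z := by
    have hden : DifferentiableAt ℝ
        (fun w : ℂ => 1 + (xRe k w.re : ℂ) ^ 2 * (xIm k w.im : ℂ) ^ 2) z :=
      ((A1.pow 2).mul (B1.pow 2)).const_add 1
    exact (((A1.mul B2).add ((B1.mul A2).const_mul I)).mul (hden.inv hP)).const_mul (2 / (k : ℂ))
  have a1' := a1.ofReal_comp
  have a2' := a2.ofReal_comp
  have b1' := b1.ofReal_comp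
  have b2' := b2.ofReal_comp
  have hu := ((((a1'.mul_const (xIm' k z.im : ℂ)).add
    ((a2'.const_mul (xIm k z.im : ℂ)).const_mul I)).div
    (((a1'.pow 2).mul_const ((xIm k z.im : ℂ) ^ 2)).const_add 1) hP).const_mul (2 / (k : ℂ)))
  have hv := ((((b2'.const_mul (xRe k z.re : ℂ)).add
    ((b1'.mul_const (xRe' k z.re : ℂ)).const_mul I)).div
    (((b1'.pow 2).const_mul ((xRe k z.re : ℂ) ^ 2)).const_add 1) hP).const_mul (2 / (k : ℂ)))
  refine differentiableAt_of_partials hreal (hu.congr_of_eventuallyEq ?_)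
    ((hv.congr_of_eventuallyEq ?_).congr_deriv ?_)
  · exact Filter.Eventually.of_forall fun u => by simp [xC]
  · exact Filter.Eventually.of_forall fun s => by simp [xC]
  · have r1 : ((xRe' k z.re : ℝ) : ℂ) ^ 2 =
        k ^ 2 / 4 * (1 + xRe k z.re ^ 2) ^ 2 - xRe k z.re ^ 2 := by
      exact_mod_cast xRe'_sq hk z.re
    have r2 : ((xIm' k z.im : ℝ) : ℂ) ^ 2 =
        k ^ 2 / 4 * (1 - xIm k z.im ^ 2) ^ 2 + xIm k z.im ^ 2 := by
      exact_mod_cast xIm'_sq hk hs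
    simp only [Pi.add_apply, Pi.pow_apply]
    push_cast
    field_simp
    generalize (xRe k z.re : ℂ) = x at *
    generalize (xRe' k z.re : ℂ) = x' at *
    generalize (xIm k z.im : ℂ) = y at *
    generalize (xIm' k z.im : ℂ) = y' at *
    linear_combination (-4 * x ^ 3 * y) * r2 - 4 * x * y ^ 3 * r1 -
      (x * y * (k ^ 2 * (1 + x ^ 2) - 2) * (1 + x ^ 2 * y ^ 2) - 4 * x * y ^ 3 * x' ^ 2) * I_sq

lemma xC_ofReal (hk : k ∈ Ioo (0:ℝ) 1) (u : ℝ) : xC k u = xRe k u := by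
  have hk0 : (k : ℂ) ≠ 0 := by exact_mod_cast hk.1.ne'
  have hk' := kComp_mem hk
  simp only [xC, xIm, xIm', Complex.ofReal_re, Complex.ofReal_im, jsn_zero hk', jcn_zero hk',
    jdn_zero hk']
  push_cast
  field_simp
  ring

lemma xC_add_Kell (hk : k ∈ Ioo (0:ℝ) 1) (u : ℝ) :
    xC k (u + Kell (kComp k) * I) = jsn k u + I * jcn k u := by
  have hk0 : (k : ℂ) ≠ 0 := by exact_mod_cast hk.1.ne'
  have hk0' := hk.1.ne'
  have h1 := jdn_pos hk u
  have h2 : (1 + jdn k u : ℂ) ≠ 0 := by exact_mod_cast (by positivity : 1 + jdn k u ≠ 0)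
  have hk' := kComp_mem hk
  have e1 : xIm k (Kell (kComp k)) = 1 := by
    simp [xIm, jsn_Kell hk', jcn_Kell hk', jdn_kComp_Kell hk, hk0']
  have e2 : xIm' k (Kell (kComp k)) = 1 := by
    simp [xIm', jcn_Kell hk', jdn_kComp_Kell hk, hk0']
  have e3 : ((xRe k u : ℝ) : ℂ) ^ 2 = (1 - jdn k u) / (1 + jdn k u) := by
    exact_mod_cast xRe_sq hk u
  have e4 : (u + Kell (kComp k) * I : ℂ).re = u := by simp
  have e5 : (u + Kell (kComp k) * I : ℂ).im = Kell (kComp k) := by simp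
  have h3 : (1 + (1 - (jdn k u : ℂ)) / (1 + jdn k u) * ((1:ℝ):ℂ) ^ 2) = 2 / (1 + jdn k u) := by
    push_cast
    field_simp
    ring
  rw [xC, e4, e5, e1, e2, e3, h3, xRe, xRe']
  push_cast
  field_simp

lemma xC_sub_Kell (hk : k ∈ Ioo (0:ℝ) 1) (u : ℝ) :
    xC k (u - Kell (kComp k) * I) = jsn k u - I * jcn k u := by
  have hk0 : (k : ℂ) ≠ 0 := by exact_mod_cast hk.1.ne'
  have hk0' := hk.1.ne'
  have h1 := jdn_pos hk u
  have h2 : (1 + jdn k u : ℂ) ≠ 0 := by exact_mod_cast (by positivity : 1 + jdn k u ≠ 0)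
  have hk' := kComp_mem hk
  have e1 : xIm k (-Kell (kComp k)) = -1 := by
    simp [xIm, jsn_neg hk', jcn_neg hk', jdn_neg hk', jsn_Kell hk', jcn_Kell hk', jdn_kComp_Kell hk, hk0']
  have e2 : xIm' k (-Kell (kComp k)) = 1 := by
    simp [xIm', jcn_neg hk', jdn_neg hk', jcn_Kell hk', jdn_kComp_Kell hk, hk0']
  have e3 : ((xRe k u : ℝ) : ℂ) ^ 2 = (1 - jdn k u) / (1 + jdn k u) := by
    exact_mod_cast xRe_sq hk u
  have e4 : (u - Kell (kComp k) * I : ℂ).re = u := by simp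
  have e5 : (u - Kell (kComp k) * I : ℂ).im = -Kell (kComp k) := by simp
  have h3 : (1 + (1 - (jdn k u : ℂ)) / (1 + jdn k u) * ((-1:ℝ):ℂ) ^ 2) = 2 / (1 + jdn k u) := by
    push_cast
    field_simp
    ring
  rw [xC, e4, e5, e1, e2, e3, h3, xRe, xRe']
  push_cast
  field_simp
  ring

lemma xC_add_two_Kell (hk : k ∈ Ioo (0:ℝ) 1) (z : ℂ) :
    xC k (z + 2 * Kell k) = -xC k z := by
  have e1 : (z + 2 * Kell k).re = z.re + 2 * Kell k := by simp
  have e2 : (z + 2 * Kell k).im = z.im := by simp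
  have e3 : xRe k (z.re + 2 * Kell k) = -xRe k z.re := by
    rw [xRe, xRe, jsn_add_two_Kell hk, jdn_add_two_Kell hk]; ring
  have e4 : xRe' k (z.re + 2 * Kell k) = -xRe' k z.re := by
    rw [xRe', xRe', jcn_add_two_Kell hk, jdn_add_two_Kell hk]; ring
  rw [xC, xC, e1, e2, e3, e4]
  push_cast
  ring

end Uniformization

/-- The integral of a holomorphic periodic function over a period may be shifted vertically. -/
lemma integral_period_shift {f : ℂ → ℂ} {P σ : ℝ} 
    (hf : ∀ z : ℂ, z.im ∈ uIcc 0 σ → DifferentiableAt ℂ f z)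
    (hper : ∀ z, f (z + P) = f z) :
    ∫ u in (0:ℝ)..P, f u = ∫ u in (0:ℝ)..P, f (u + σ * I) := by
  have h := Complex.integral_boundary_rect_eq_zero_of_differentiableOn f 0 (P + σ * I)
    fun z hz => (hf z (by simpa using hz.2)).differentiableWithinAt
  have e : ∀ y : ℝ, f (P + y * I) = f (y * I) := fun y => by rw [add_comm, hper]
  simp only [Complex.zero_re, Complex.zero_im, Complex.add_re, Complex.add_im, Complex.ofReal_re,
    Complex.ofReal_im, Complex.mul_re, Complex.mul_im, Complex.I_re, Complex.I_im, mul_zero,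
    mul_one, zero_add, add_zero, sub_zero, zero_mul, Complex.ofReal_zero, e] at h
  linear_combination h

/-- The Fourier mode `e^{2πinu/P}`. -/
def wave (P : ℝ) (n : ℤ) (z : ℂ) : ℂ := Complex.exp (2 * π * I * n * z / P)

lemma wave_add_period {P : ℝ} (hP : P ≠ 0) (n : ℤ) (z : ℂ) : wave P n (z + P) = wave P n z := by
  have hP' : (P : ℂ) ≠ 0 := by exact_mod_cast hP
  rw [wave, wave, show 2 * π * I * n * (z + P) / P = 2 * π * I * n * z / P + n * (2 * π * I) by
    field_simp, Complex.exp_add, Complex.exp_int_mul_two_pi_mul_I, mul_one]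

lemma wave_zero_left (P : ℝ) (z : ℂ) : wave P 0 z = 1 := by simp [wave]

lemma differentiable_wave (P : ℝ) (n : ℤ) : Differentiable ℂ (wave P n) := by
  unfold wave; fun_prop

lemma continuous_wave_ofReal (P : ℝ) (n : ℤ) : Continuous fun u : ℝ => wave P n u :=
  (differentiable_wave P n).continuous.comp Complex.continuous_ofReal

lemma norm_wave_ofReal (P : ℝ) (n : ℤ) (u : ℝ) : ‖wave P n u‖ = 1 := by
  rw [wave, show 2 * π * I * n * u / P = ((2 * π * n * u / P : ℝ) : ℂ) * I by push_cast; ring,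
    Complex.norm_exp_ofReal_mul_I]

lemma hasDerivAt_wave (P : ℝ) (n : ℤ) (u : ℝ) :
    HasDerivAt (fun u : ℝ => wave P n u) (2 * π * I * n / P * wave P n u) u := by
  have h1 : HasDerivAt (fun u : ℝ => 2 * π * I * n * (u : ℂ) / P) (2 * π * I * n / P) u := by
    simpa using ((Complex.ofRealCLM.hasDerivAt (x := u)).const_mul
      (2 * π * I * n : ℂ)).div_const (P : ℂ)
  exact h1.cexp.congr_deriv (by rw [wave]; ring)

lemma periodic_of_hasDerivAt {φ φ' : ℝ → ℂ} {P : ℝ} (h1 : ∀ u, HasDerivAt φ (φ' u) u)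
    (hper : ∀ u, φ (u + P) = φ u) (u : ℝ) : φ' (u + P) = φ' u := by
  have h := (h1 (u + P)).comp_add_const u P
  simp only [hper] at h
  exact h.unique (h1 u)

lemma integral_deriv_mul_wave {φ φ' : ℝ → ℂ} {P : ℝ} (hP : P ≠ 0)
    (h1 : ∀ u, HasDerivAt φ (φ' u) u) (hper : ∀ u, φ (u + P) = φ u) (hc : Continuous φ') (n : ℤ) :
    ∫ u in (0:ℝ)..P, φ' u * wave P n u =
      -(2 * π * I * n / P) * ∫ u in (0:ℝ)..P, φ u * wave P n u := by
  have h := intervalIntegral.integral_mul_deriv_eq_deriv_mul (a := 0) (b := P) (u := φ) (u' := φ')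
    (fun x _ => h1 x) (fun x _ => hasDerivAt_wave P n x) (hc.intervalIntegrable _ _)
    ((continuous_const.mul (continuous_wave_ofReal P n)).intervalIntegrable _ _)
  have e1 : φ P = φ 0 := by simpa using hper 0
  have e2 : wave P n P = wave P n 0 := by simpa using wave_add_period hP n 0
  rw [Complex.ofReal_zero, e1, e2, sub_self, zero_sub] at h
  rw [← neg_eq_iff_eq_neg.2 h, ← intervalIntegral.integral_const_mul,
    ← intervalIntegral.integral_neg]
  congr 1
  ext u
  ring

lemma norm_integral_mul_wave_le {φ φ' φ'' : ℝ → ℂ} {P M : ℝ} (hP : 0 < P)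
    (h1 : ∀ u, HasDerivAt φ (φ' u) u) (h2 : ∀ u, HasDerivAt φ' (φ'' u) u)
    (hper : ∀ u, φ (u + P) = φ u) (hc : Continuous φ'') (hM : ∀ u, ‖φ'' u‖ ≤ M) {n : ℤ}
    (hn : n ≠ 0) :
    ‖∫ u in (0:ℝ)..P, φ u * wave P n u‖ ≤ M * P ^ 3 / (n : ℝ) ^ 2 := by
  have hc' : Continuous φ' := continuous_iff_continuousAt.2 fun u => (h2 u).continuousAt
  have e := integral_deriv_mul_wave hP.ne' h2 (periodic_of_hasDerivAt h1 hper) hc n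
  rw [integral_deriv_mul_wave hP.ne' h1 hper hc' n] at e
  have hb : ‖∫ u in (0:ℝ)..P, φ'' u * wave P n u‖ ≤ M * |P - 0| :=
    intervalIntegral.norm_integral_le_of_norm_le_const fun u _ => by
      rw [norm_mul, norm_wave_ofReal, mul_one]; exact hM u
  rw [sub_zero, abs_of_pos hP, e] at hb
  have hn2 : (1:ℝ) ≤ (n : ℝ) ^ 2 := by
    have : (1:ℤ) ≤ n ^ 2 := by have := sq_pos_of_ne_zero hn; omega
    exact_mod_cast this
  simp only [norm_mul, norm_neg, norm_div, Complex.norm_real, Complex.norm_I, mul_one,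
    Complex.norm_intCast, Complex.norm_ofNat, Real.norm_eq_abs, abs_of_pos hP,
    abs_of_pos Real.pi_pos] at hb
  set J := ‖∫ u in (0:ℝ)..P, φ u * wave P n u‖
  rw [le_div_iff₀ (by positivity)]
  have hpi : (1:ℝ) ≤ (2 * π) ^ 2 := by nlinarith [Real.pi_gt_three]
  have hJ : 0 ≤ J := norm_nonneg _
  have e2 : 2 * π * |(n:ℝ)| / P * (2 * π * |(n:ℝ)| / P * J) = (2 * π) ^ 2 * (n:ℝ) ^ 2 * J / P ^ 2 := by
    rw [← sq_abs (n : ℝ)]; field_simp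
  rw [e2, div_le_iff₀ (by positivity)] at hb
  calc J * (n:ℝ) ^ 2 ≤ (2 * π) ^ 2 * (J * (n:ℝ) ^ 2) := le_mul_of_one_le_left (by positivity) hpi
    _ ≤ M * P ^ 3 := by linarith

lemma summable_inv_int_sq : Summable fun n : ℤ => 1 / (n : ℝ) ^ 2 := by
  simpa using (Real.summable_one_div_int_pow (p := 2)).2 (by norm_num)

lemma summable_int_of_norm_le {f : ℤ → ℂ} {C : ℝ} 
    (h : ∀ n : ℤ, n ≠ 0 → ‖f n‖ ≤ C / (n : ℝ) ^ 2) : Summable f := by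
  refine Summable.of_norm_bounded_eventually (summable_inv_int_sq.mul_left C) ?_
  filter_upwards [(Set.finite_singleton (0:ℤ)).compl_mem_cofinite] with n hn
  rw [mul_one_div]
  exact h n hn

lemma hasSum_integral_mul_wave {φ φ' φ'' : ℝ → ℂ} {P M : ℝ} (hP : 0 < P)
    (h1 : ∀ u, HasDerivAt φ (φ' u) u) (h2 : ∀ u, HasDerivAt φ' (φ'' u) u)
    (hper : ∀ u, φ (u + P) = φ u) (hc : Continuous φ'') (hM : ∀ u, ‖φ'' u‖ ≤ M) :
    HasSum (fun n : ℤ => ∫ u in (0:ℝ)..P, φ u * wave P n u) (P * φ 0) := by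
  have : Fact (0 < P) := ⟨hP⟩
  have hcont : Continuous φ := continuous_iff_continuousAt.2 fun u => (h1 u).continuousAt
  have hlift : Continuous (Function.Periodic.lift (f := φ) (c := P) hper) :=
    continuous_quot_lift _ hcont
  set f : C(AddCircle P, ℂ) := ⟨_, hlift⟩ with hf
  have hcoef : ∀ n : ℤ, fourierCoeff f n = (1 / P : ℂ) * ∫ u in (0:ℝ)..P, φ u * wave P (-n) u := by
    intro n
    rw [fourierCoeff_eq_intervalIntegral f n 0, zero_add, Complex.real_smul]
    push_cast
    congr 2
    ext u
    rw [fourier_coe_apply, smul_eq_mul, mul_comm]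
    rfl
  have hsum0 : Summable fun n : ℤ => ∫ u in (0:ℝ)..P, φ u * wave P n u :=
    summable_int_of_norm_le fun n hn => norm_integral_mul_wave_le hP h1 h2 hper hc hM hn
  have hsum : Summable (fourierCoeff f) := by
    have := ((Equiv.neg ℤ).summable_iff.2 hsum0).mul_left (1 / P : ℂ)
    exact this.congr fun n => (hcoef n).symm
  have key := has_pointwise_sum_fourier_series_of_summable hsum (((0:ℝ) : AddCircle P))
  have e0 : f ((0:ℝ) : AddCircle P) = φ 0 := rfl
  rw [e0] at key
  have hP' : (P : ℂ) ≠ 0 := by exact_mod_cast hP.ne'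
  have key2 := (Equiv.neg ℤ).hasSum_iff.2 (key.mul_left (P : ℂ))
  have e : ∀ n : ℤ, (P : ℂ) * fourierCoeff f (-n) • fourier (-n) ((0:ℝ) : AddCircle P) =
      ∫ u in (0:ℝ)..P, φ u * wave P n u := fun n => by
    rw [hcoef, neg_neg, fourier_coe_apply, smul_eq_mul, Complex.ofReal_zero, mul_zero, zero_div,
      Complex.exp_zero]
    field_simp
  simpa only [Function.comp_def, Equiv.neg_apply, e] using key2

/-- The power `Y^b` of the unimodular function `Y = sn + i cn`. -/
def yPow (k : ℝ) (b : ℤ) (u : ℝ) : ℂ := Complex.exp (I * b * (π / 2 - jam k u))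

/-- The function `X^a Y^b` on the real axis. -/
def ePhi (k : ℝ) (a : ℕ) (b : ℤ) (u : ℝ) : ℂ := (xRe k u : ℂ) ^ a * yPow k b u

/-- The Fourier coefficients of `X^a Y^b` over the period `2K`. -/
def eCoef (k : ℝ) (n : ℤ) (a : ℕ) (b : ℤ) : ℂ :=
  ∫ u in (0:ℝ)..2 * Kell k, ePhi k a b u * wave (2 * Kell k) n u

section Coefficients

variable {k : ℝ}

lemma yPow_add (k : ℝ) (a b : ℤ) (u : ℝ) : yPow k (a + b) u = yPow k a u * yPow k b u := by
  rw [yPow, yPow, yPow, ← Complex.exp_add]; congr 1; push_cast; ring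

lemma yPow_zero (k u : ℝ) : yPow k 0 u = 1 := by simp [yPow]

lemma yPow_one (k u : ℝ) : yPow k 1 u = jsn k u + I * jcn k u := by
  rw [yPow, show I * ((1:ℤ):ℂ) * (π / 2 - jam k u) = ((π / 2 - jam k u : ℝ) : ℂ) * I by
    push_cast; ring, Complex.exp_mul_I, ← Complex.ofReal_cos, ← Complex.ofReal_sin,
    Real.cos_pi_div_two_sub, Real.sin_pi_div_two_sub, jsn, jcn, mul_comm I]

lemma yPow_neg_one (k u : ℝ) : yPow k (-1) u = jsn k u - I * jcn k u := by
  rw [yPow, show I * ((-1:ℤ):ℂ) * (π / 2 - jam k u) = ((-(π / 2 - jam k u) : ℝ) : ℂ) * I by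
    push_cast; ring, Complex.exp_mul_I, ← Complex.ofReal_cos, ← Complex.ofReal_sin,
    Real.cos_neg, Real.sin_neg, Real.cos_pi_div_two_sub, Real.sin_pi_div_two_sub, jsn, jcn]
  push_cast
  ring

lemma yPow_natCast (k : ℝ) (b : ℕ) (u : ℝ) : yPow k b u = (jsn k u + I * jcn k u) ^ b := by
  rw [← yPow_one, yPow, yPow, ← Complex.exp_nat_mul]; congr 1; push_cast; ring

lemma yPow_neg_natCast (k : ℝ) (b : ℕ) (u : ℝ) :
    yPow k (-b) u = (jsn k u - I * jcn k u) ^ b := by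
  rw [← yPow_neg_one, yPow, yPow, ← Complex.exp_nat_mul]; congr 1; push_cast; ring

lemma norm_yPow (k : ℝ) (b : ℤ) (u : ℝ) : ‖yPow k b u‖ = 1 := by
  rw [yPow, show I * (b:ℂ) * (π / 2 - jam k u) = ((b * (π / 2 - jam k u) : ℝ) : ℂ) * I by
    push_cast; ring, Complex.norm_exp_ofReal_mul_I]

lemma hasDerivAt_yPow (hk : k ∈ Ioo (0:ℝ) 1) (b : ℤ) (u : ℝ) :
    HasDerivAt (yPow k b) (-(I * b * jdn k u) * yPow k b u) u := by
  have h := (((hasDerivAt_jam hk u).ofReal_comp.const_sub ((π : ℂ) / 2)).const_mul (I * b)).cexp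
  refine h.congr_deriv ?_
  rw [yPow]; ring

lemma yPow_add_two_Kell (hk : k ∈ Ioo (0:ℝ) 1) (b : ℤ) (u : ℝ) :
    yPow k b (u + 2 * Kell k) = (-1) ^ b * yPow k b u := by
  have h : (-1 : ℂ) = Complex.exp (-(π * I)) := by
    rw [Complex.exp_neg, Complex.exp_pi_mul_I, inv_neg, inv_one]
  rw [yPow, jam_add_two_Kell hk, yPow, h, ← Complex.exp_int_mul, ← Complex.exp_add]
  congr 1
  push_cast
  ring

lemma xRe_add_two_Kell (hk : k ∈ Ioo (0:ℝ) 1) (u : ℝ) : xRe k (u + 2 * Kell k) = -xRe k u := by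
  rw [xRe, xRe, jsn_add_two_Kell hk, jdn_add_two_Kell hk]; ring

lemma ePhi_add_two_Kell (hk : k ∈ Ioo (0:ℝ) 1) {a : ℕ} {b : ℤ} (hab : Even ((a:ℤ) + b)) (u : ℝ) :
    ePhi k a b (u + 2 * Kell k) = ePhi k a b u := by
  rw [ePhi, ePhi, yPow_add_two_Kell hk, xRe_add_two_Kell hk]
  push_cast
  rw [neg_pow, mul_mul_mul_comm, ← zpow_natCast, ← zpow_add₀ (by norm_num), hab.neg_one_zpow,
    one_mul]

lemma abs_xRe_le_one (hk : k ∈ Ioo (0:ℝ) 1) (u : ℝ) : |xRe k u| ≤ 1 := by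
  have h1 := jdn_pos hk u
  rw [← sq_le_one_iff_abs_le_one, xRe_sq hk, div_le_one (by positivity)]
  linarith

lemma abs_xRe'_le_one (hk : k ∈ Ioo (0:ℝ) 1) (u : ℝ) : |xRe' k u| ≤ 1 := by
  have h1 := jdn_pos hk u
  have h2 : |jcn k u| ≤ 1 := Real.abs_cos_le_one _
  rw [xRe', abs_div, abs_mul, abs_of_pos hk.1, abs_of_pos (by positivity : 0 < 1 + jdn k u),
    div_le_one (by positivity)]
  have := hk.2
  nlinarith [abs_nonneg (jcn k u), hk.1]

/-- The derivative of `ePhi`. -/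
def ePhi' (k : ℝ) (a : ℕ) (b : ℤ) (u : ℝ) : ℂ :=
  (a * (xRe k u : ℂ) ^ (a - 1) * xRe' k u - I * b * jdn k u * (xRe k u : ℂ) ^ a) * yPow k b u

/-- The second derivative of `ePhi`. -/
def ePhi'' (k : ℝ) (a : ℕ) (b : ℤ) (u : ℝ) : ℂ :=
  (a * ((a - 1 : ℕ) * (xRe k u : ℂ) ^ (a - 1 - 1) * xRe' k u) * xRe' k u +
    a * (xRe k u : ℂ) ^ (a - 1) *
      ((k ^ 2 / 2 * xRe k u * (1 + xRe k u ^ 2) - xRe k u : ℝ) : ℂ) +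
    (I * b * (k ^ 2 * jsn k u * jcn k u : ℝ) * (xRe k u : ℂ) ^ a -
      I * b * jdn k u * (a * (xRe k u : ℂ) ^ (a - 1) * xRe' k u))) * yPow k b u -
  (a * (xRe k u : ℂ) ^ (a - 1) * xRe' k u - I * b * jdn k u * (xRe k u : ℂ) ^ a) *
    (I * b * jdn k u * yPow k b u)

lemma hasDerivAt_ePhi (hk : k ∈ Ioo (0:ℝ) 1) (a : ℕ) (b : ℤ) (u : ℝ) :
    HasDerivAt (ePhi k a b) (ePhi' k a b u) u := by
  refine (((hasDerivAt_xRe hk u).ofReal_comp.pow a).mul (hasDerivAt_yPow hk b u)).congr_deriv ?_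
  simp only [ePhi', Pi.pow_apply]
  ring

lemma hasDerivAt_ePhi' (hk : k ∈ Ioo (0:ℝ) 1) (a : ℕ) (b : ℤ) (u : ℝ) :
    HasDerivAt (ePhi' k a b) (ePhi'' k a b u) u := by
  have h1 := (hasDerivAt_xRe hk u).ofReal_comp
  refine ((((((h1.pow (a - 1)).const_mul (a : ℂ)).mul (hasDerivAt_xRe' hk u).ofReal_comp)).sub
    ((((hasDerivAt_jdn hk u).ofReal_comp.const_mul (I * b)).mul (h1.pow a)))).mul
    (hasDerivAt_yPow hk b u)).congr_deriv ?_
  simp only [ePhi'', Pi.pow_apply, Pi.sub_apply, Pi.mul_apply]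
  push_cast
  ring

lemma continuous_ePhi'' (hk : k ∈ Ioo (0:ℝ) 1) (a : ℕ) (b : ℤ) : Continuous (ePhi'' k a b) := by
  have c1 : Continuous (xRe k) :=
    continuous_iff_continuousAt.2 fun u => (hasDerivAt_xRe hk u).continuousAt
  have c2 : Continuous (xRe' k) :=
    continuous_iff_continuousAt.2 fun u => (hasDerivAt_xRe' hk u).continuousAt
  have c3 : Continuous (jsn k) :=
    continuous_iff_continuousAt.2 fun u => (hasDerivAt_jsn hk u).continuousAt
  have c4 : Continuous (jcn k) :=
    continuous_iff_continuousAt.2 fun u => (hasDerivAt_jcn hk u).continuousAt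
  have c5 : Continuous (jdn k) :=
    continuous_iff_continuousAt.2 fun u => (hasDerivAt_jdn hk u).continuousAt
  have c6 : Continuous (yPow k b) :=
    continuous_iff_continuousAt.2 fun u => (hasDerivAt_yPow hk b u).continuousAt
  unfold ePhi''
  fun_prop

lemma norm_ePhi''_le (hk : k ∈ Ioo (0:ℝ) 1) (a : ℕ) (b : ℤ) (u : ℝ) :
    ‖ePhi'' k a b u‖ ≤ 2 * (1 + a + |(b:ℝ)|) ^ 2 := by
  have hx : ‖(xRe k u : ℂ)‖ ≤ 1 := by
    rw [Complex.norm_real, Real.norm_eq_abs]; exact abs_xRe_le_one hk u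
  have hx' : ‖(xRe' k u : ℂ)‖ ≤ 1 := by
    rw [Complex.norm_real, Real.norm_eq_abs]; exact abs_xRe'_le_one hk u
  have hd : ‖(jdn k u : ℂ)‖ ≤ 1 := by
    rw [Complex.norm_real, Real.norm_eq_abs, abs_of_pos (jdn_pos hk u)]; exact jdn_le_one hk u
  have hk2 : k ^ 2 ≤ 1 := by nlinarith [hk.1, hk.2]
  have hx2 : ‖((k ^ 2 / 2 * xRe k u * (1 + xRe k u ^ 2) - xRe k u : ℝ) : ℂ)‖ ≤ 1 := by
    rw [Complex.norm_real, Real.norm_eq_abs, show k ^ 2 / 2 * xRe k u * (1 + xRe k u ^ 2) - xRe k u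
      = xRe k u * (k ^ 2 / 2 * (1 + xRe k u ^ 2) - 1) by ring, abs_mul]
    have h := abs_xRe_le_one hk u
    have h' := (sq_le_one_iff_abs_le_one _).2 h
    refine mul_le_one₀ h (abs_nonneg _) (abs_le.2 ⟨?_, ?_⟩)
    · nlinarith [sq_nonneg k, sq_nonneg (xRe k u), mul_nonneg (sq_nonneg k) (sq_nonneg (xRe k u))]
    · nlinarith [sq_nonneg k, sq_nonneg (xRe k u), mul_nonneg (sq_nonneg k) (sq_nonneg (xRe k u))]
  have hsc : ‖((k ^ 2 * jsn k u * jcn k u : ℝ) : ℂ)‖ ≤ 1 := by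
    rw [Complex.norm_real, Real.norm_eq_abs, abs_mul, abs_mul, abs_of_nonneg (sq_nonneg k)]
    have h1 : |jsn k u| ≤ 1 := Real.abs_sin_le_one _
    have h2 : |jcn k u| ≤ 1 := Real.abs_cos_le_one _
    exact mul_le_one₀ (mul_le_one₀ hk2 (abs_nonneg _) h1) (abs_nonneg _) h2
  have hp : ∀ m : ℕ, ‖(xRe k u : ℂ) ^ m‖ ≤ 1 := fun m => by
    rw [norm_pow]; exact pow_le_one₀ (norm_nonneg _) hx
  have hy := norm_yPow k b u
  have ha : ‖(a : ℂ)‖ = a := Complex.norm_natCast a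
  have ha1 : ‖((a - 1 : ℕ) : ℂ)‖ ≤ a := by
    rw [Complex.norm_natCast]; exact_mod_cast Nat.sub_le a 1
  have hb : ‖(b : ℂ)‖ = |(b : ℝ)| := Complex.norm_intCast b
  have h0 : (0:ℝ) ≤ a := Nat.cast_nonneg a
  have h0' := abs_nonneg (b : ℝ)
  have t1 : ‖a * ((a - 1 : ℕ) * (xRe k u : ℂ) ^ (a - 1 - 1) * xRe' k u) * xRe' k u‖ ≤
      a * (a * 1 * 1) * 1 := by
    simp only [norm_mul, ha]; gcongr; exact hp _
  have t2 : ‖a * (xRe k u : ℂ) ^ (a - 1) *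
      ((k ^ 2 / 2 * xRe k u * (1 + xRe k u ^ 2) - xRe k u : ℝ) : ℂ)‖ ≤ a * 1 * 1 := by
    rw [norm_mul, norm_mul, ha]; gcongr; exact hp _
  have t3 : ‖I * b * (k ^ 2 * jsn k u * jcn k u : ℝ) * (xRe k u : ℂ) ^ a‖ ≤
      1 * |(b:ℝ)| * 1 * 1 := by
    rw [norm_mul, norm_mul, norm_mul, hb, Complex.norm_I]; gcongr; exact hp _
  have t5 : ‖a * (xRe k u : ℂ) ^ (a - 1) * xRe' k u‖ ≤ a * 1 * 1 := by
    simp only [norm_mul, ha]; gcongr; exact hp _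
  have t6 : ‖I * b * jdn k u‖ ≤ 1 * |(b:ℝ)| * 1 := by
    simp only [norm_mul, hb, Complex.norm_I]; gcongr
  have t4 : ‖I * b * jdn k u * (a * (xRe k u : ℂ) ^ (a - 1) * xRe' k u)‖ ≤
      (1 * |(b:ℝ)| * 1) * (a * 1 * 1) := by
    rw [norm_mul]; gcongr
  have t7 : ‖I * b * jdn k u * (xRe k u : ℂ) ^ a‖ ≤ (1 * |(b:ℝ)| * 1) * 1 := by
    rw [norm_mul]; gcongr; exact hp _
  have t8 : ‖I * b * jdn k u * yPow k b u‖ ≤ (1 * |(b:ℝ)| * 1) * 1 := by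
    rw [norm_mul, hy]; gcongr
  rw [ePhi'']
  refine (norm_sub_le _ _).trans ?_
  rw [norm_mul, norm_mul, hy, mul_one]
  have s1 := (norm_add_le _ _).trans (add_le_add ((norm_add_le _ _).trans (add_le_add t1 t2))
    ((norm_sub_le _ _).trans (add_le_add t3 t4)))
  have s2 := mul_le_mul ((norm_sub_le _ _).trans (add_le_add t5 t7)) t8 (norm_nonneg _)
    (by positivity)
  refine (add_le_add s1 s2).trans ?_
  nlinarith [mul_nonneg h0 h0']

lemma norm_eCoef_le (hk : k ∈ Ioo (0:ℝ) 1) {n : ℤ} (hn : n ≠ 0) {a : ℕ} {b : ℤ}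
    (hab : Even ((a:ℤ) + b)) :
    ‖eCoef k n a b‖ ≤ 2 * (2 * Kell k) ^ 3 * (1 + a + |(b:ℝ)|) ^ 2 / (n : ℝ) ^ 2 := by
  have h := norm_integral_mul_wave_le (mul_pos two_pos (Kell_pos hk)) (hasDerivAt_ePhi hk a b)
    (hasDerivAt_ePhi' hk a b) (ePhi_add_two_Kell hk hab) (continuous_ePhi'' hk a b)
    (norm_ePhi''_le hk a b) hn
  refine h.trans_eq ?_
  ring

lemma norm_eCoef_zero_le (hk : k ∈ Ioo (0:ℝ) 1) (a : ℕ) (b : ℤ) :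
    ‖eCoef k 0 a b‖ ≤ 2 * Kell k := by
  have h := intervalIntegral.norm_integral_le_of_norm_le_const (a := 0) (b := 2 * Kell k) (C := 1)
    (f := fun u => ePhi k a b u * wave (2 * Kell k) 0 u) fun u _ => by
      rw [norm_mul, norm_wave_ofReal, mul_one, ePhi, norm_mul, norm_yPow, mul_one, norm_pow,
        Complex.norm_real, Real.norm_eq_abs]
      exact pow_le_one₀ (abs_nonneg _) (abs_xRe_le_one hk u)
  rwa [sub_zero, one_mul, abs_of_pos (mul_pos two_pos (Kell_pos hk))] at h

lemma hasSum_eCoef (hk : k ∈ Ioo (0:ℝ) 1) {a : ℕ} {b : ℤ} (hab : Even ((a:ℤ) + b)) :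
    HasSum (fun n : ℤ => eCoef k n a b) (2 * Kell k * ePhi k a b 0) := by
  have h := hasSum_integral_mul_wave (mul_pos two_pos (Kell_pos hk)) (hasDerivAt_ePhi hk a b)
    (hasDerivAt_ePhi' hk a b) (ePhi_add_two_Kell hk hab) (continuous_ePhi'' hk a b)
    (norm_ePhi''_le hk a b)
  exact_mod_cast h

lemma continuous_ePhi (hk : k ∈ Ioo (0:ℝ) 1) (a : ℕ) (b : ℤ) : Continuous (ePhi k a b) :=
  continuous_iff_continuousAt.2 fun u => (hasDerivAt_ePhi hk a b u).continuousAt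

lemma eCoef_zero_zero (hk : k ∈ Ioo (0:ℝ) 1) {n : ℤ} (hn : n ≠ 0) : eCoef k n 0 0 = 0 := by
  have hP := mul_pos two_pos (Kell_pos hk)
  have h := integral_deriv_mul_wave hP.ne' (φ := fun _ => 1) (φ' := fun _ => 0)
    (fun u => hasDerivAt_const u 1) (fun _ => rfl) continuous_const n
  simp only [zero_mul, intervalIntegral.integral_zero] at h
  have hc : -(2 * π * I * n / (2 * Kell k : ℝ)) ≠ (0:ℂ) := by
    have h2 : (π : ℂ) ≠ 0 := by exact_mod_cast Real.pi_ne_zero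
    have h3 : (n : ℂ) ≠ 0 := by exact_mod_cast hn
    simp [h2, h3, (Kell_pos hk).ne']
  have := (mul_eq_zero.1 h.symm).resolve_left hc
  simpa [eCoef, ePhi, yPow_zero] using this

lemma eCoef_zero_zero_zero (k : ℝ) : eCoef k 0 0 0 = 2 * Kell k := by
  simp [eCoef, ePhi, yPow_zero, wave_zero_left]

lemma eCoef_recurrence (hk : k ∈ Ioo (0:ℝ) 1) (n : ℤ) (a : ℕ) (b : ℤ) :
    4 / k * eCoef k n (a + 1) b = eCoef k n (a + 2) (b + 1) + eCoef k n (a + 2) (b - 1) +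
      eCoef k n a (b - 1) + eCoef k n a (b + 1) := by
  have hi : ∀ a b, IntervalIntegrable (fun u : ℝ => ePhi k a b u * wave (2 * Kell k) n u)
      MeasureTheory.volume 0 (2 * Kell k) := fun a b =>
    ((continuous_ePhi hk a b).mul (continuous_wave_ofReal _ n)).intervalIntegrable _ _
  simp only [eCoef]
  rw [← intervalIntegral.integral_const_mul, ← intervalIntegral.integral_add (hi _ _) (hi _ _),
    ← intervalIntegral.integral_add ((hi _ _).add (hi _ _)) (hi _ _),
    ← intervalIntegral.integral_add (((hi _ _).add (hi _ _)).add (hi _ _)) (hi _ _)]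
  refine intervalIntegral.integral_congr fun u _ => ?_
  have hd : (1 + jdn k u : ℂ) ≠ 0 := by
    have := jdn_pos hk u
    exact_mod_cast (by positivity : 1 + jdn k u ≠ 0)
  have hk0 : (k : ℂ) ≠ 0 := by exact_mod_cast hk.1.ne'
  have e3 : ((xRe k u : ℝ) : ℂ) ^ 2 = (1 - jdn k u) / (1 + jdn k u) := by
    exact_mod_cast xRe_sq hk u
  simp only [ePhi, sub_eq_add_neg, yPow_add, yPow_one, yPow_neg_one]
  have key : 4 / k * (xRe k u : ℂ) = (xRe k u ^ 2 + 1) * (2 * jsn k u) := by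
    rw [e3, xRe]; push_cast; field_simp; ring
  linear_combination (xRe k u : ℂ) ^ a * yPow k b u * wave (2 * Kell k) n u * key

lemma eCoef_shift (hk : k ∈ Ioo (0:ℝ) 1) (n : ℤ) {a b : ℕ} (hab : Even (a + b)) :
    eCoef k n b (-a) = (qNome k : ℂ) ^ n * eCoef k n a b := by
  have hk' := kComp_mem hk
  have hK := Kell_pos hk
  have hK' := Kell_pos hk'
  have hK0 : (Kell k : ℂ) ≠ 0 := by exact_mod_cast hK.ne'
  have h := integral_period_shift (P := 2 * Kell k) (σ := -Kell (kComp k))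
    (f := fun z => xC k z ^ a * xC k (z + Kell (kComp k) * I) ^ b * wave (2 * Kell k) n z)
    (fun z hz => by
      rw [uIcc_of_ge (by linarith)] at hz
      refine ((differentiableAt_xC hk ⟨by linarith [hz.1], by linarith [hz.2]⟩).pow a).mul
        (DifferentiableAt.pow ?_ b) |>.mul (differentiable_wave _ n z)
      have h1 : DifferentiableAt ℂ (xC k) (z + Kell (kComp k) * I) :=
        differentiableAt_xC hk ⟨by simp; linarith [hz.1], by simp; linarith [hz.2]⟩
      exact DifferentiableAt.fun_comp' z h1 (by fun_prop))
    (fun z => by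
      rw [wave_add_period (by positivity), show z + ((2 * Kell k : ℝ) : ℂ) + Kell (kComp k) * I =
        z + Kell (kComp k) * I + 2 * Kell k by push_cast; ring]
      push_cast
      rw [xC_add_two_Kell hk, xC_add_two_Kell hk, neg_pow, neg_pow (xC k (z + _)),
        mul_mul_mul_comm, ← pow_add, hab.neg_one_pow, one_mul])
  have hw : ∀ u : ℝ, (qNome k : ℂ) ^ n * wave (2 * Kell k) n (u + (-Kell (kComp k) : ℝ) * I) =
      wave (2 * Kell k) n u := fun u => by
    rw [qNome, wave, wave, Complex.ofReal_exp, ← Complex.exp_int_mul, ← Complex.exp_add]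
    congr 1
    push_cast
    field_simp
    linear_combination (-(n:ℂ) * Kell (kComp k)) * I_sq
  have e1 : eCoef k n a b = ∫ u in (0:ℝ)..2 * Kell k,
      xC k u ^ a * xC k (u + Kell (kComp k) * I) ^ b * wave (2 * Kell k) n u := by
    simp only [eCoef, ePhi, xC_ofReal hk, xC_add_Kell hk, yPow_natCast]
  rw [e1, h, eCoef, ← intervalIntegral.integral_const_mul]
  refine intervalIntegral.integral_congr fun u _ => ?_
  simp only [ePhi, ← hw u, yPow_neg_natCast]
  rw [show (u : ℂ) + (-Kell (kComp k) : ℝ) * I + Kell (kComp k) * I = u by push_cast; ring,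
    show (u : ℂ) + (-Kell (kComp k) : ℝ) * I = u - Kell (kComp k) * I by push_cast; ring,
    xC_ofReal hk, xC_sub_Kell hk]
  ring

end Coefficients

lemma qNome_pos (k : ℝ) : 0 < qNome k := Real.exp_pos _

lemma qNome_lt_one {k : ℝ} (hk : k ∈ Ioo (0:ℝ) 1) : qNome k < 1 := by
  rw [qNome, Real.exp_lt_one_iff]
  have := Kell_pos hk
  have := Kell_pos (kComp_mem hk)
  rw [neg_mul, neg_div]
  exact neg_lt_zero.2 (by positivity)

lemma one_sub_le_abs_one_sub_zpow {q : ℝ} (h0 : 0 < q) (h1 : q < 1) {n : ℤ} (hn : n ≠ 0) :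
    1 - q ≤ |1 - q ^ n| := by
  rcases lt_or_gt_of_ne hn with h | h
  · have h2 : q⁻¹ ≤ q ^ n := by
      rw [← zpow_neg_one]
      exact zpow_le_zpow_right_of_le_one₀ h0 h1.le (by omega)
    have h3 : 1 - q ≤ q⁻¹ - 1 := by
      have : q * q⁻¹ = 1 := mul_inv_cancel₀ h0.ne'
      nlinarith [sq_nonneg (1 - q), inv_pos.2 h0]
    rw [abs_sub_comm]
    exact le_trans (by linarith) (le_abs_self _)
  · have h2 : q ^ n ≤ q := by
      conv_rhs => rw [← zpow_one q]
      exact zpow_le_zpow_right_of_le_one₀ h0 h1.le (by omega)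
    exact le_trans (by linarith) (le_abs_self _)

/-- The summation weights `1/(1 - λqⁿ)`. -/
def rotWeight (q : ℝ) (l : ℂ) (n : ℤ) : ℂ := (1 - l * (q : ℂ) ^ n)⁻¹

section Weights

variable {q : ℝ} {l : ℂ}

lemma one_sub_mul_zpow_ne_zero (h0 : 0 < q) (h1 : q < 1) (hl : ‖l‖ = 1) (hl1 : l ≠ 1) (n : ℤ) :
    1 - l * (q : ℂ) ^ n ≠ 0 := by
  by_cases hn : n = 0
  · subst hn
    rw [zpow_zero, mul_one]
    exact sub_ne_zero.2 hl1.symm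
  · intro h
    have h2 : ‖l * (q : ℂ) ^ n‖ = 1 := by rw [← sub_eq_zero.1 h, norm_one]
    rw [norm_mul, hl, one_mul, norm_zpow, Complex.norm_real, Real.norm_eq_abs, abs_of_pos h0] at h2
    have h3 := one_sub_le_abs_one_sub_zpow h0 h1 hn
    rw [h2, sub_self, abs_zero] at h3
    linarith

lemma exists_norm_rotWeight_le (h0 : 0 < q) (h1 : q < 1) (hl : ‖l‖ = 1) :
    ∃ C : ℝ, 0 ≤ C ∧ ∀ n : ℤ, ‖rotWeight q l n‖ ≤ C := by
  refine ⟨max ‖(1 - l)⁻¹‖ (1 - q)⁻¹, le_max_of_le_left (norm_nonneg _), fun n => ?_⟩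
  by_cases hn : n = 0
  · subst hn
    rw [rotWeight, zpow_zero, mul_one]
    exact le_max_left _ _
  · refine le_trans ?_ (le_max_right _ _)
    rw [rotWeight, norm_inv]
    refine inv_anti₀ (by linarith) ((one_sub_le_abs_one_sub_zpow h0 h1 hn).trans ?_)
    have h := abs_norm_sub_norm_le (1 : ℂ) (l * (q : ℂ) ^ n)
    rwa [norm_one, norm_mul, hl, one_mul, norm_zpow, Complex.norm_real, Real.norm_eq_abs,
      abs_of_pos h0] at h

end Weights

/-- The multivalued lattice Green's function with monodromy `l` per quarter turn. -/
def rotGreen (k : ℝ) (l : ℂ) (a b : ℤ) : ℂ :=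
  if Even (a + b) then ∑' n : ℤ, rotWeight (qNome k) l n * eCoef k n a.toNat b else 0

section RotGreen

variable {k : ℝ} {l : ℂ}

lemma norm_eCoef_le' (hk : k ∈ Ioo (0:ℝ) 1) (n : ℤ) {a : ℕ} {b : ℤ} (hab : Even ((a:ℤ) + b)) :
    ‖eCoef k n a b‖ ≤ (2 * Kell k + 2 * (2 * Kell k) ^ 3) * (1 + a + |(b:ℝ)|) ^ 2 *
      (if n = 0 then 1 else 1 / (n : ℝ) ^ 2) := by
  have hK := Kell_pos hk
  have h1 : (1:ℝ) ≤ (1 + a + |(b:ℝ)|) ^ 2 := by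
    have h0 : (0:ℝ) ≤ a := Nat.cast_nonneg a
    have h0' := abs_nonneg (b : ℝ)
    nlinarith
  split_ifs with hn
  · subst hn
    refine (norm_eCoef_zero_le hk a b).trans ?_
    nlinarith [pow_pos hK 3]
  · refine (norm_eCoef_le hk hn hab).trans ?_
    rw [mul_one_div]
    gcongr
    linarith

lemma summable_coefBound : Summable fun n : ℤ => if n = 0 then (1:ℝ) else 1 / (n : ℝ) ^ 2 := by
  refine summable_inv_int_sq.congr_cofinite ?_
  filter_upwards [(Set.finite_singleton (0:ℤ)).compl_mem_cofinite] with n hn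
  exact (if_neg hn).symm

lemma summable_rotWeight_mul_eCoef (hk : k ∈ Ioo (0:ℝ) 1) (hl : ‖l‖ = 1) {a : ℕ} {b : ℤ}
    (hab : Even ((a:ℤ) + b)) : Summable fun n : ℤ => rotWeight (qNome k) l n * eCoef k n a b := by
  obtain ⟨C, hC, hw⟩ := exists_norm_rotWeight_le (qNome_pos k) (qNome_lt_one hk) hl
  refine Summable.of_norm_bounded ((summable_coefBound.mul_left
    ((2 * Kell k + 2 * (2 * Kell k) ^ 3) * (1 + a + |(b:ℝ)|) ^ 2)).mul_left C) fun n => ?_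
  rw [norm_mul]
  exact mul_le_mul (hw n) (norm_eCoef_le' hk n hab) (norm_nonneg _) hC

lemma exists_norm_rotGreen_le (hk : k ∈ Ioo (0:ℝ) 1) (hl : ‖l‖ = 1) :
    ∃ C : ℝ, 0 ≤ C ∧ ∀ a b : ℤ, 0 ≤ a → ‖rotGreen k l a b‖ ≤ C * (1 + |(a:ℝ)| + |(b:ℝ)|) ^ 2 := by
  obtain ⟨C, hC, hw⟩ := exists_norm_rotWeight_le (qNome_pos k) (qNome_lt_one hk) hl
  have hK := Kell_pos hk
  set S := ∑' n : ℤ, if n = 0 then (1:ℝ) else 1 / (n : ℝ) ^ 2 with hS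
  have hS0 : 0 ≤ S := tsum_nonneg fun n => by split_ifs <;> positivity
  refine ⟨C * (2 * Kell k + 2 * (2 * Kell k) ^ 3) * S, by positivity, fun a b ha => ?_⟩
  rw [rotGreen]
  split_ifs with hab
  · have hab' : Even ((a.toNat : ℤ) + b) := by rwa [Int.toNat_of_nonneg ha]
    have ha' : ((a.toNat : ℕ) : ℝ) = |(a:ℝ)| := by
      rw [abs_of_nonneg (by exact_mod_cast ha)]
      exact_mod_cast congrArg (Int.cast : ℤ → ℝ) (Int.toNat_of_nonneg ha)
    have hb := summable_coefBound.mul_left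
      (C * ((2 * Kell k + 2 * (2 * Kell k) ^ 3) * (1 + |(a:ℝ)| + |(b:ℝ)|) ^ 2))
    refine (tsum_of_norm_bounded hb.hasSum fun n => ?_).trans ?_
    · rw [norm_mul, mul_assoc, ← ha']
      exact mul_le_mul (hw n) (norm_eCoef_le' hk n hab') (norm_nonneg _) hC
    · rw [tsum_mul_left, ← hS]
      exact le_of_eq (by ring)
  · rw [norm_zero]; positivity

lemma rotGreen_recurrence {t : ℝ} (hk : k ∈ Ioo (0:ℝ) 1) (hkt : k = 4 * t) (hl : ‖l‖ = 1)
    {a : ℤ} (ha : 1 ≤ a) (b : ℤ) :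
    rotGreen k l a b = t * (rotGreen k l (a + 1) (b + 1) + rotGreen k l (a + 1) (b - 1) +
      rotGreen k l (a - 1) (b - 1) + rotGreen k l (a - 1) (b + 1)) := by
  obtain ⟨m, rfl⟩ : ∃ m : ℕ, a = m + 1 := ⟨(a - 1).toNat, by omega⟩
  have p1 : Even ((m:ℤ) + 1 + 1 + (b + 1)) ↔ Even ((m:ℤ) + 1 + b) := by grind
  have p2 : Even ((m:ℤ) + 1 + 1 + (b - 1)) ↔ Even ((m:ℤ) + 1 + b) := by grind
  have p3 : Even ((m:ℤ) + 1 - 1 + (b - 1)) ↔ Even ((m:ℤ) + 1 + b) := by grind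
  have p4 : Even ((m:ℤ) + 1 - 1 + (b + 1)) ↔ Even ((m:ℤ) + 1 + b) := by grind
  simp only [rotGreen, p1, p2, p3, p4]
  split_ifs with hab
  · have n0 : ((m:ℤ) + 1).toNat = m + 1 := by omega
    have n1 : ((m:ℤ) + 1 + 1).toNat = m + 2 := by omega
    have n2 : ((m:ℤ) + 1 - 1).toNat = m := by omega
    rw [n0, n1, n2]
    have ht0 : (t : ℂ) ≠ 0 := by
      have := hk.1
      exact_mod_cast (by linarith : 0 < t).ne'
    have s1 := summable_rotWeight_mul_eCoef hk hl (a := m + 2) (b := b + 1) (by push_cast; grind)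
    have s2 := summable_rotWeight_mul_eCoef hk hl (a := m + 2) (b := b - 1) (by push_cast; grind)
    have s3 := summable_rotWeight_mul_eCoef hk hl (a := m) (b := b - 1) (by grind)
    have s4 := summable_rotWeight_mul_eCoef hk hl (a := m) (b := b + 1) (by grind)
    rw [← s1.tsum_add s2, ← (s1.add s2).tsum_add s3, ← ((s1.add s2).add s3).tsum_add s4,
      ← tsum_mul_left]
    refine tsum_congr fun n => ?_
    have h := eCoef_recurrence hk n m b
    have h4 : (4 / k : ℂ) = 1 / t := by
      rw [hkt]; push_cast; field_simp
    rw [h4] at h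
    rw [← mul_add, ← mul_add, ← mul_add, ← h]
    field_simp
  · simp

lemma rotGreen_rotate_aux (hk : k ∈ Ioo (0:ℝ) 1) (hl : ‖l‖ = 1) (hl1 : l ≠ 1)
    {a b : ℤ} (ha : 0 ≤ a) (hb : 0 ≤ b) (hab : Even (a + b)) :
    rotGreen k l a b = l * rotGreen k l b (-a) + 2 * Kell k * ePhi k a.toNat b 0 := by
  obtain ⟨a, rfl⟩ := Int.eq_ofNat_of_zero_le ha
  obtain ⟨b, rfl⟩ := Int.eq_ofNat_of_zero_le hb
  have hab2 : Even ((b:ℤ) + -(a:ℤ)) := by grind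
  have hs := hasSum_eCoef hk hab
  have s1 := summable_rotWeight_mul_eCoef hk hl hab
  have s2 := summable_rotWeight_mul_eCoef hk hl hab2
  rw [rotGreen, rotGreen, if_pos hab, if_pos hab2, Int.toNat_natCast, Int.toNat_natCast,
    ← hs.tsum_eq, ← tsum_mul_left, ← (s2.mul_left l).tsum_add hs.summable]
  refine tsum_congr fun n => ?_
  rw [eCoef_shift hk n (by exact_mod_cast hab), rotWeight]
  have := one_sub_mul_zpow_ne_zero (qNome_pos k) (qNome_lt_one hk) hl hl1 n
  field_simp
  ring

lemma rotGreen_rotate (hk : k ∈ Ioo (0:ℝ) 1) (hl : ‖l‖ = 1) (hl1 : l ≠ 1)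
    {a b : ℤ} (ha : 1 ≤ a) (hb : 0 ≤ b) : rotGreen k l a b = l * rotGreen k l b (-a) := by
  by_cases hab : Even (a + b)
  · rw [rotGreen_rotate_aux hk hl hl1 (by omega) hb hab, ePhi, xRe, jsn_zero hk]
    have : a.toNat ≠ 0 := by omega
    simp [this]
  · have hab2 : ¬ Even (b + -a) := by grind
    rw [rotGreen, rotGreen, if_neg hab, if_neg hab2, mul_zero]

lemma rotGreen_zero_left (hk : k ∈ Ioo (0:ℝ) 1) (hl : ‖l‖ = 1) (hl1 : l ≠ 1)
    {b : ℤ} (hb : 0 ≤ b) (hb2 : Even b) :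
    rotGreen k l 0 b = l * rotGreen k l b 0 + 2 * Kell k * Complex.exp (I * b * (π / 2)) := by
  rw [rotGreen_rotate_aux hk hl hl1 le_rfl hb (by simpa using hb2), ePhi, yPow, jam_zero hk]
  simp

lemma rotGreen_zero_zero (hk : k ∈ Ioo (0:ℝ) 1) (l : ℂ) :
    rotGreen k l 0 0 = 2 * Kell k / (1 - l) := by
  rw [rotGreen, if_pos (by simp), tsum_eq_single 0]
  · rw [Int.toNat_zero, eCoef_zero_zero_zero, rotWeight, zpow_zero, mul_one]
    field_simp
  · intro n hn
    rw [Int.toNat_zero, eCoef_zero_zero hk hn, mul_zero]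

end RotGreen

/-- The monodromy `e^{iπb/2}` per quarter turn. -/
def quarterPhase (b : ℝ) : ℂ := Complex.exp (I * b * (π / 2))

lemma norm_quarterPhase (b : ℝ) : ‖quarterPhase b‖ = 1 := by
  rw [quarterPhase, show I * b * (π / 2) = ((b * (π / 2) : ℝ) : ℂ) * I by push_cast; ring,
    Complex.norm_exp_ofReal_mul_I]

lemma quarterPhase_ne_zero (b : ℝ) : quarterPhase b ≠ 0 := Complex.exp_ne_zero _

/-- The twisted lattice function on the right half-plane. -/
def halfGreen (k b : ℝ) (x : ℤ × ℤ) : ℂ :=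
  Complex.exp (-(I * b * (ptC x).arg)) * rotGreen k (quarterPhase b) x.1 x.2

/-- The rotation invariant extension of `halfGreen`. -/
def latticeGreen (k b : ℝ) (x : ℤ × ℤ) : ℂ :=
  if 1 ≤ x.1 then halfGreen k b x
  else if 1 ≤ x.2 then halfGreen k b (x.2, -x.1)
  else if x.1 ≤ -1 then halfGreen k b (-x.1, -x.2)
  else if x.2 ≤ -1 then halfGreen k b (-x.2, x.1)
  else 2 * Kell k * Complex.exp (I * b * (π / 4)) / (1 - quarterPhase b)

section LatticeGreen

variable {k b : ℝ}

lemma ptC_rotate (p q : ℤ) : ptC (-q, p) = I * ptC (p, q) := by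
  simp only [ptC]
  push_cast
  linear_combination (-(q:ℂ)) * I_mul_I

lemma ptC_re (x : ℤ × ℤ) : (ptC x).re = x.1 := by simp [ptC]

lemma abs_arg_ptC_lt {x : ℤ × ℤ} (hx : 1 ≤ x.1) : |(ptC x).arg| < π / 2 := by
  rw [Complex.abs_arg_lt_pi_div_two_iff, ptC_re]
  left
  exact_mod_cast (by omega : 0 < x.1)

lemma arg_ptC_rotate {p q : ℤ} (hp : 1 ≤ p) : (ptC (-q, p)).arg = (ptC (p, q)).arg + π / 2 := by
  have hne : ptC (p, q) ≠ 0 := ptC_ne_zero (by intro h; simp at h; omega)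
  have h := abs_lt.1 (abs_arg_ptC_lt (x := (p, q)) hp)
  rw [ptC_rotate, (Complex.arg_mul_eq_add_arg_iff I_ne_zero hne).2, Complex.arg_I, add_comm]
  rw [Complex.arg_I]
  constructor <;> linarith [h.1, h.2, Real.pi_pos]

lemma arg_ptC_div {x y : ℤ × ℤ} (hx : 1 ≤ x.1) (hy : 0 ≤ y.1) (hy0 : y ≠ 0) :
    (ptC y / ptC x).arg = (ptC y).arg - (ptC x).arg := by
  have h := abs_arg_ptC_lt hx
  have h' := abs_lt.1 h
  have hy' : |(ptC y).arg| ≤ π / 2 := by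
    rw [Complex.abs_arg_le_pi_div_two_iff, ptC_re]; exact_mod_cast hy
  have hy'' := abs_le.1 hy'
  have hx0 : ptC x ≠ 0 := ptC_ne_zero (by rintro rfl; simp at hx)
  have e : (ptC x)⁻¹.arg = -(ptC x).arg := by
    rw [Complex.arg_inv, if_neg]; linarith [h'.2, Real.pi_pos]
  rw [div_eq_mul_inv, (Complex.arg_mul_eq_add_arg_iff (ptC_ne_zero hy0) (inv_ne_zero hx0)).2, e,
    sub_eq_add_neg]
  rw [e]
  constructor <;> linarith [h'.1, h'.2, hy''.1, hy''.2, Real.pi_pos]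

lemma arg_ptC_one_one : (ptC (1, 1)).arg = π / 4 := by
  have h := arg_ptC_rotate (p := 1) (q := -1) le_rfl
  have hc : ptC (1, -1) = (starRingEnd ℂ) (ptC (1, 1)) := by simp [ptC]
  have h1 := abs_lt.1 (abs_arg_ptC_lt (x := (1, 1)) le_rfl)
  rw [neg_neg, hc, Complex.arg_conj, if_neg (by linarith [h1.2, Real.pi_pos])] at h
  linarith

lemma arg_ptC_one_neg_one : (ptC (1, -1)).arg = -(π / 4) := by
  have h := arg_ptC_rotate (p := 1) (q := -1) le_rfl
  rw [neg_neg, arg_ptC_one_one] at h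
  linarith

lemma stepPhase_rotate (b : ℝ) (p q p' q' : ℤ) :
    stepPhase b (-q, p) (-q', p') = stepPhase b (p, q) (p', q') := by
  rw [stepPhase, stepPhase, ptC_rotate, ptC_rotate, mul_div_mul_left _ _ I_ne_zero]

lemma halfGreen_rotate (hk : k ∈ Ioo (0:ℝ) 1) (hb : quarterPhase b ≠ 1) {p q : ℤ} (hp : 1 ≤ p)
    (hq : 1 ≤ q) : halfGreen k b (p, q) = halfGreen k b (q, -p) := by
  have e := arg_ptC_rotate (p := q) (q := -p) hq
  rw [neg_neg] at e
  rw [halfGreen, halfGreen, e, rotGreen_rotate hk (norm_quarterPhase b) hb hp (by omega),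
    ← mul_assoc, quarterPhase, ← Complex.exp_add]
  congr 2
  push_cast
  ring

lemma latticeGreen_of_pos {x : ℤ × ℤ} (hx : 1 ≤ x.1) :
    latticeGreen k b x = halfGreen k b x := if_pos hx

lemma latticeGreen_zero (k b : ℝ) : latticeGreen k b 0 =
    2 * Kell k * Complex.exp (I * b * (π / 4)) / (1 - quarterPhase b) := by
  simp [latticeGreen]

lemma latticeGreen_rotate (hk : k ∈ Ioo (0:ℝ) 1) (hb : quarterPhase b ≠ 1) (p q : ℤ) :
    latticeGreen k b (-q, p) = latticeGreen k b (p, q) := by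
  have key : ∀ {a c : ℤ}, 1 ≤ a → 1 ≤ c → halfGreen k b (a, c) = halfGreen k b (c, -a) :=
    fun ha hc => halfGreen_rotate hk hb ha hc
  unfold latticeGreen
  dsimp only
  split_ifs <;> first
    | omega
    | rfl
    | (rw [key (by omega) (by omega)]; done)
    | (rw [key (by omega) (by omega), neg_neg]; done)
    | (rw [neg_neg]; done)
    | (symm; rw [key (by omega) (by omega)]; done)
    | (symm; rw [key (by omega) (by omega), neg_neg]; done)

lemma latticeGreen_zero_left_pos (hk : k ∈ Ioo (0:ℝ) 1) (hb : quarterPhase b ≠ 1) {r : ℤ}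
    (hr : 1 ≤ r) : latticeGreen k b (0, r) = rotGreen k (quarterPhase b) r 0 := by
  have h := latticeGreen_rotate hk hb r 0
  rw [neg_zero] at h
  rw [h, latticeGreen_of_pos hr, halfGreen]
  have : ptC (r, 0) = ((r : ℝ) : ℂ) := by simp [ptC]
  rw [this, Complex.arg_ofReal_of_nonneg (by exact_mod_cast (by omega : 0 ≤ r))]
  simp

lemma latticeGreen_zero_left_neg (hk : k ∈ Ioo (0:ℝ) 1) (hb : quarterPhase b ≠ 1) {r : ℤ}
    (hr : 1 ≤ r) : latticeGreen k b (0, -r) = rotGreen k (quarterPhase b) r 0 := by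
  have h := latticeGreen_rotate hk hb (-r) 0
  have h' := latticeGreen_rotate hk hb 0 r
  rw [neg_zero] at h
  rw [h, h', latticeGreen_zero_left_pos hk hb hr]

/-- The boundary defect of the multivalued Green's function on the imaginary axis. -/
def axisDefect (k : ℝ) (q r : ℤ) : ℂ :=
  if 1 ≤ q ∧ Even r then 2 * Kell k * Complex.exp (I * r * (π / 2)) else 0

lemma stepPhase_mul_latticeGreen_axis (hk : k ∈ Ioo (0:ℝ) 1) (hb : quarterPhase b ≠ 1)
    (q : ℤ) {r : ℤ} (hr : r = q + 1 ∨ r = q - 1) :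
    stepPhase b (1, q) (0, r) * latticeGreen k b (0, r) = Complex.exp (-(I * b * (ptC (1, q)).arg)) *
      (rotGreen k (quarterPhase b) 0 r - axisDefect k q r) := by
  have hl := norm_quarterPhase b
  have hq0 := quarterPhase_ne_zero b
  have h1b : 1 - quarterPhase b ≠ 0 := sub_ne_zero.2 hb.symm
  rcases lt_trichotomy r 0 with h | h | h
  · obtain ⟨r, rfl⟩ : ∃ s : ℤ, r = -s := ⟨-r, by simp⟩
    have hr1 : 1 ≤ r := by omega
    have hp : ptC (0, -r) = ((r : ℝ) : ℂ) * (-I) := by simp [ptC]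
    have harg : (ptC (0, -r)).arg = -(π / 2) := by
      rw [hp, Complex.arg_real_mul _ (by exact_mod_cast (by omega : 0 < r)), Complex.arg_neg_I]
    have hrot := rotGreen_rotate hk hl hb hr1 le_rfl
    have hd : axisDefect k q (-r) = 0 := if_neg (by omega)
    rw [latticeGreen_zero_left_neg hk hb hr1, stepPhase,
      arg_ptC_div le_rfl le_rfl (by intro h; simp at h; omega), harg, hrot, hd, sub_zero,
      ← mul_assoc]
    congr 1
    rw [quarterPhase, ← Complex.exp_add]
    congr 1
    push_cast
    ring
  · subst h
    have hz : ((0:ℤ), (0:ℤ)) = 0 := rfl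
    have hs : stepPhase b (1, q) 0 = 1 := by simp [stepPhase, ptC_zero]
    rw [hz, hs, latticeGreen_zero, rotGreen_zero_zero hk, one_mul]
    rcases (by omega : q = 1 ∨ q = -1) with rfl | rfl
    · have hd : axisDefect k 1 0 = 2 * Kell k := by simp [axisDefect]
      have e : Complex.exp (I * b * (π / 4)) = Complex.exp (-(I * b * (π / 4))) * quarterPhase b := by
        rw [quarterPhase, ← Complex.exp_add]; congr 1; ring
      rw [hd, arg_ptC_one_one, e]
      push_cast
      field_simp
      ring
    · have hd : axisDefect k (-1) 0 = 0 := by simp [axisDefect]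
      rw [hd, arg_ptC_one_neg_one]
      push_cast
      rw [show -(I * b * -(π / 4 : ℂ)) = I * b * (π / 4) by ring]
      ring
  · have hr1 : 1 ≤ r := by omega
    have hp : ptC (0, r) = ((r : ℝ) : ℂ) * I := by simp [ptC]
    have harg : (ptC (0, r)).arg = π / 2 := by
      rw [hp, Complex.arg_real_mul _ (by exact_mod_cast h), Complex.arg_I]
    rw [latticeGreen_zero_left_pos hk hb hr1, stepPhase,
      arg_ptC_div le_rfl le_rfl (by intro h; simp at h; omega), harg]
    by_cases he : Even r
    · have hq1 : 1 ≤ q := by rcases he with ⟨c, hc⟩; omega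
      rw [axisDefect, if_pos ⟨hq1, he⟩, rotGreen_zero_left hk hl hb (by omega) he,
        add_sub_cancel_right, ← mul_assoc]
      congr 1
      rw [quarterPhase, ← Complex.exp_add]
      congr 1
      push_cast
      ring
    · rw [axisDefect, if_neg (by tauto), rotGreen, if_neg (by simpa using he), rotGreen,
        if_neg (by simpa using he)]
      simp

lemma axisDefect_add (k : ℝ) (q : ℤ) : axisDefect k q (q + 1) + axisDefect k q (q - 1) = 0 := by
  unfold axisDefect
  by_cases hq : 1 ≤ q
  · by_cases he : Even q
    · have h1 : ¬ Even (q + 1) := by rcases he with ⟨c, hc⟩; rintro ⟨d, hd⟩; omega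
      have h2 : ¬ Even (q - 1) := by rcases he with ⟨c, hc⟩; rintro ⟨d, hd⟩; omega
      simp [h1, h2]
    · obtain ⟨c, hc⟩ := Int.not_even_iff_odd.1 he
      have h1 : Even (q + 1) := ⟨c + 1, by omega⟩
      have h2 : Even (q - 1) := ⟨c, by omega⟩
      rw [if_pos ⟨hq, h1⟩, if_pos ⟨hq, h2⟩]
      have e : Complex.exp (I * ((q + 1 : ℤ) : ℂ) * (π / 2)) =
          -Complex.exp (I * ((q - 1 : ℤ) : ℂ) * (π / 2)) := by
        rw [← mul_neg_one, ← Complex.exp_pi_mul_I, ← Complex.exp_add]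
        congr 1
        push_cast
        ring
      rw [e]
      ring
  · simp [hq]

lemma stepPhase_mul_latticeGreen {x y : ℤ × ℤ} (hx : 1 ≤ x.1) (hy : 1 ≤ y.1) :
    stepPhase b x y * latticeGreen k b y = Complex.exp (-(I * b * (ptC x).arg)) *
      rotGreen k (quarterPhase b) y.1 y.2 := by
  rw [latticeGreen_of_pos hy, halfGreen, stepPhase,
    arg_ptC_div hx (by omega) (by rintro rfl; simp at hy), ← mul_assoc, ← Complex.exp_add]
  congr 2
  push_cast
  ring

/-- The twisted discrete Helmholtz equation at a lattice point. -/
def IsMassiveHarmonicAt (t b : ℝ) (h : ℤ × ℤ → ℂ) (x : ℤ × ℤ) : Prop :=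
  h x = t * ∑ s ∈ diagSteps, stepPhase b x (x + s) * h (x + s)

lemma isMassiveHarmonicAt_of_pos {t : ℝ} (hk : k ∈ Ioo (0:ℝ) 1) (hkt : k = 4 * t)
    (hb : quarterPhase b ≠ 1) {p q : ℤ} (hp : 1 ≤ p) :
    IsMassiveHarmonicAt t b (latticeGreen k b) (p, q) := by
  have hrec := rotGreen_recurrence hk hkt (norm_quarterPhase b) hp q
  rw [IsMassiveHarmonicAt, latticeGreen_of_pos hp, halfGreen, sum_diagSteps]
  dsimp only
  rw [hrec]
  simp only [Prod.mk_add_mk, ← sub_eq_add_neg]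
  rw [stepPhase_mul_latticeGreen (x := (p, q)) (y := (p + 1, q + 1)) hp (by simp; omega),
    stepPhase_mul_latticeGreen (x := (p, q)) (y := (p + 1, q - 1)) hp (by simp; omega)]
  rcases hp.lt_or_eq with h | h
  · rw [stepPhase_mul_latticeGreen (x := (p, q)) (y := (p - 1, q - 1)) hp (by simp; omega),
      stepPhase_mul_latticeGreen (x := (p, q)) (y := (p - 1, q + 1)) hp (by simp; omega)]
    ring
  · subst h
    rw [sub_self, stepPhase_mul_latticeGreen_axis hk hb q (Or.inr rfl),
      stepPhase_mul_latticeGreen_axis hk hb q (Or.inl rfl)]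
    linear_combination (t : ℂ) * Complex.exp (-(I * b * (ptC (1, q)).arg)) * axisDefect_add k q

lemma isMassiveHarmonicAt_rotate {t : ℝ} (hk : k ∈ Ioo (0:ℝ) 1) (hb : quarterPhase b ≠ 1)
    {p q : ℤ} (h : IsMassiveHarmonicAt t b (latticeGreen k b) (p, q)) :
    IsMassiveHarmonicAt t b (latticeGreen k b) (-q, p) := by
  have key : ∀ i j : ℤ, stepPhase b (-q, p) (-q + i, p + j) * latticeGreen k b (-q + i, p + j) =
      stepPhase b (p, q) (p + j, q + -i) * latticeGreen k b (p + j, q + -i) := by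
    intro i j
    rw [show -q + i = -(q + -i) by ring, stepPhase_rotate, latticeGreen_rotate hk hb]
  rw [IsMassiveHarmonicAt, sum_diagSteps] at h ⊢
  simp only [Prod.mk_add_mk] at h ⊢
  rw [latticeGreen_rotate hk hb, key, key, key, key, h]
  simp only [neg_neg]
  ring

lemma isMassiveHarmonicAt_latticeGreen {t : ℝ} (hk : k ∈ Ioo (0:ℝ) 1) (hkt : k = 4 * t)
    (hb : quarterPhase b ≠ 1) {x : ℤ × ℤ} (hx : x ≠ 0) :
    IsMassiveHarmonicAt t b (latticeGreen k b) x := by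
  obtain ⟨p, q⟩ := x
  have hpos : ∀ {p q : ℤ}, 1 ≤ p → IsMassiveHarmonicAt t b (latticeGreen k b) (p, q) :=
    fun h => isMassiveHarmonicAt_of_pos hk hkt hb h
  have hrot : ∀ {p q : ℤ}, IsMassiveHarmonicAt t b (latticeGreen k b) (q, -p) →
      IsMassiveHarmonicAt t b (latticeGreen k b) (p, q) := by
    intro p q h
    have h2 := isMassiveHarmonicAt_rotate hk hb h
    rwa [neg_neg] at h2
  have h0 : ¬ (p = 0 ∧ q = 0) := by rintro ⟨rfl, rfl⟩; exact hx rfl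
  by_cases h1 : 1 ≤ p
  · exact hpos h1
  by_cases h2 : 1 ≤ q
  · exact hrot (hpos h2)
  by_cases h3 : p ≤ -1
  · exact hrot (hrot (hpos (by omega)))
  · exact hrot (hrot (hrot (hpos (by omega))))

lemma exists_norm_latticeGreen_le (hk : k ∈ Ioo (0:ℝ) 1) (hb : quarterPhase b ≠ 1) :
    ∃ C : ℝ, 0 ≤ C ∧ ∀ x, ‖latticeGreen k b x‖ ≤ C * (1 + ‖x‖) ^ 2 := by
  obtain ⟨C, hC0, hC⟩ := exists_norm_rotGreen_le hk (norm_quarterPhase b)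
  have key : ∀ (N : ℝ) (p q : ℤ), 1 ≤ p → |(p:ℝ)| ≤ N → |(q:ℝ)| ≤ N →
      ‖halfGreen k b (p, q)‖ ≤ (4 * C + ‖latticeGreen k b 0‖) * (1 + N) ^ 2 := by
    intro N p q hp h1 h2
    have hN : 0 ≤ N := (abs_nonneg _).trans h1
    have e : ‖halfGreen k b (p, q)‖ = ‖rotGreen k (quarterPhase b) p q‖ := by
      rw [halfGreen, norm_mul, show -(I * b * ((ptC (p, q)).arg : ℂ)) =
        ((-(b * (ptC (p, q)).arg) : ℝ) : ℂ) * I by push_cast; ring,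
        Complex.norm_exp_ofReal_mul_I, one_mul]
    rw [e]
    refine (hC p q (by omega)).trans ?_
    have h3 : (1 + |(p:ℝ)| + |(q:ℝ)|) ^ 2 ≤ (2 * (1 + N)) ^ 2 := by
      apply pow_le_pow_left₀ (by positivity)
      linarith
    have h4 := mul_le_mul_of_nonneg_left h3 hC0
    have h5 : 0 ≤ ‖latticeGreen k b 0‖ * (1 + N) ^ 2 := by positivity
    nlinarith
  refine ⟨4 * C + ‖latticeGreen k b 0‖, by positivity, ?_⟩
  rintro ⟨p, q⟩
  have h1 : |(p:ℝ)| ≤ ‖(p, q)‖ := by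
    have := norm_fst_le ((p, q) : ℤ × ℤ); simpa [Int.norm_eq_abs] using this
  have h2 : |(q:ℝ)| ≤ ‖(p, q)‖ := by
    have := norm_snd_le ((p, q) : ℤ × ℤ); simpa [Int.norm_eq_abs] using this
  have h0 : latticeGreen k b (p, q) = if 1 ≤ p then halfGreen k b (p, q)
      else if 1 ≤ q then halfGreen k b (q, -p)
      else if p ≤ -1 then halfGreen k b (-p, -q)
      else if q ≤ -1 then halfGreen k b (-q, p) else latticeGreen k b 0 := by
    rw [latticeGreen_zero]; rfl
  rw [h0]
  split_ifs with c1 c2 c3 c4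
  · exact key _ p q c1 h1 h2
  · exact key _ q (-p) c2 h2 (by push_cast; rwa [abs_neg])
  · exact key _ (-p) (-q) (by omega) (by push_cast; rwa [abs_neg]) (by push_cast; rwa [abs_neg])
  · exact key _ (-q) p (by omega) (by push_cast; rwa [abs_neg]) h1
  · have hn : 0 ≤ ‖((p, q) : ℤ × ℤ)‖ := norm_nonneg _
    have : (1:ℝ) ≤ (1 + ‖((p, q) : ℤ × ℤ)‖) ^ 2 := by nlinarith
    have h5 := mul_le_mul_of_nonneg_left this (norm_nonneg (latticeGreen k b 0))
    nlinarith [sq_nonneg (1 + ‖((p, q) : ℤ × ℤ)‖)]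

/-- The characteristic function in terms of the multivalued Green's function. -/
theorem Fchar_eq_rotGreen {t : ℝ} (ht0 : 0 < t) (ht : t < 1 / 4) (hkt : k = 4 * t)
    (hb : quarterPhase b ≠ 1) :
    Fchar t b = k * rotGreen k (quarterPhase b) 1 1 * (1 - quarterPhase b) /
      (2 * Kell k * quarterPhase b) := by
  have hk : k ∈ Ioo (0:ℝ) 1 := by constructor <;> linarith
  have hK : (Kell k : ℂ) ≠ 0 := by exact_mod_cast (Kell_pos hk).ne'
  have hq0 := quarterPhase_ne_zero b
  have h1b : 1 - quarterPhase b ≠ 0 := sub_ne_zero.2 hb.symm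
  have hL0 : latticeGreen k b 0 ≠ 0 := by
    rw [latticeGreen_zero]
    exact div_ne_zero (mul_ne_zero (mul_ne_zero two_ne_zero hK) (Complex.exp_ne_zero _)) h1b
  obtain ⟨C, hC0, hC⟩ := exists_norm_latticeGreen_le hk hb
  have hmain := Fchar_eq_sum (b := b) ht0 ht (h := fun x => latticeGreen k b x / latticeGreen k b 0)
    (C := C / ‖latticeGreen k b 0‖) (fun x => by
      rw [norm_div, div_mul_eq_mul_div]
      gcongr
      exact hC x) (div_self hL0) (fun x hx => by
      have := isMassiveHarmonicAt_latticeGreen hk hkt hb hx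
      rw [IsMassiveHarmonicAt] at this
      rw [this, mul_div_assoc, Finset.sum_div]
      simp only [mul_div_assoc])
  rw [hmain, sum_diagSteps]
  have r1 : latticeGreen k b (-1, 1) = latticeGreen k b (1, 1) := latticeGreen_rotate hk hb 1 1
  have r2 : latticeGreen k b (-1, -1) = latticeGreen k b (-1, 1) := by
    simpa using latticeGreen_rotate hk hb (-1) 1
  have r3 : latticeGreen k b (1, -1) = latticeGreen k b (-1, -1) := by
    simpa using latticeGreen_rotate hk hb (-1) (-1)
  have e : Complex.exp (I * b * (π / 4)) * Complex.exp (I * b * (π / 4)) = quarterPhase b := by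
    rw [quarterPhase, ← Complex.exp_add]; congr 1; ring
  have e4 : Complex.exp (I * b * (π / 4)) ≠ 0 := Complex.exp_ne_zero _
  rw [r3, r2, r1, latticeGreen_of_pos (x := (1, 1)) le_rfl, halfGreen, latticeGreen_zero,
    arg_ptC_one_one, Complex.exp_neg, hkt]
  push_cast
  rw [hkt] at hK
  push_cast at hK
  rw [← e] at h1b ⊢
  field_simp
  ring

end LatticeGreen

/-- The function `dn` on a horizontal strip of the complex plane. -/
def dnC (k : ℝ) (z : ℂ) : ℂ := (1 - xC k z ^ 2) / (1 + xC k z ^ 2)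

section DeltaAmplitude

variable {k : ℝ}

lemma xC_eq_mk (k : ℝ) (z : ℂ) : xC k z =
    ⟨2 / k * (xRe k z.re * xIm' k z.im / (1 + xRe k z.re ^ 2 * xIm k z.im ^ 2)),
      2 / k * (xIm k z.im * xRe' k z.re / (1 + xRe k z.re ^ 2 * xIm k z.im ^ 2))⟩ := by
  rw [xC, Complex.mk_eq_add_mul_I]
  push_cast
  ring

lemma jcn_pos_of_mem (hk : k ∈ Ioo (0:ℝ) 1) {s : ℝ} (hs : s ∈ Ioo (-Kell k) (Kell k)) :
    0 < jcn k s := by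
  have h1 := strictMono_jam hk hs.1
  have h2 := strictMono_jam hk hs.2
  rw [jam_neg hk, jam_Kell hk] at h1
  rw [jam_Kell hk] at h2
  exact Real.cos_pos_of_mem_Ioo ⟨h1, h2⟩

lemma mem_strip (hk : k ∈ Ioo (0:ℝ) 1) {s : ℝ} (hs : s ∈ Ioo (-Kell (kComp k)) (Kell (kComp k))) :
    s ∈ Ioo (-(2 * Kell (kComp k))) (2 * Kell (kComp k)) := by
  have := Kell_pos (kComp_mem hk)
  exact ⟨by linarith [hs.1], by linarith [hs.2]⟩

lemma xIm_sq_lt_one (hk : k ∈ Ioo (0:ℝ) 1) {s : ℝ}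
    (hs : s ∈ Ioo (-Kell (kComp k)) (Kell (kComp k))) : xIm k s ^ 2 < 1 := by
  have h1 := jcn_pos_of_mem (kComp_mem hk) hs
  have h2 := jcn_add_jdn_pos hk (mem_strip hk hs)
  rw [xIm_sq hk (mem_strip hk hs), div_lt_one h2]
  linarith

lemma normSq_xC (hk : k ∈ Ioo (0:ℝ) 1) {z : ℂ}
    (hs : z.im ∈ Ioo (-Kell (kComp k)) (Kell (kComp k))) :
    (xC k z).re ^ 2 + (xC k z).im ^ 2 = (xRe k z.re ^ 2 + xIm k z.im ^ 2) /
      (1 + xRe k z.re ^ 2 * xIm k z.im ^ 2) := by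
  have hk0 := hk.1.ne'
  have r1 := xRe'_sq hk z.re
  have r2 := xIm'_sq hk (mem_strip hk hs)
  have hP : (0:ℝ) < 1 + xRe k z.re ^ 2 * xIm k z.im ^ 2 := by positivity
  rw [xC_eq_mk]
  dsimp only
  simp only [mul_pow, div_pow, r1, r2]
  field_simp
  ring

lemma re_xC_sq (hk : k ∈ Ioo (0:ℝ) 1) {z : ℂ}
    (hs : z.im ∈ Ioo (-Kell (kComp k)) (Kell (kComp k))) :
    (xC k z).re ^ 2 - (xC k z).im ^ 2 =
      ((xRe k z.re ^ 2 - xIm k z.im ^ 2) * (1 - xRe k z.re ^ 2 * xIm k z.im ^ 2) +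
        (8 / k ^ 2 - 4) * (xRe k z.re ^ 2 * xIm k z.im ^ 2)) /
      (1 + xRe k z.re ^ 2 * xIm k z.im ^ 2) ^ 2 := by
  have hk0 := hk.1.ne'
  have r1 := xRe'_sq hk z.re
  have r2 := xIm'_sq hk (mem_strip hk hs)
  have hP : (0:ℝ) < 1 + xRe k z.re ^ 2 * xIm k z.im ^ 2 := by positivity
  rw [xC_eq_mk]
  dsimp only
  simp only [mul_pow, div_pow, r1, r2]
  field_simp
  ring

lemma normSq_one_add_xC_sq (hk : k ∈ Ioo (0:ℝ) 1) {z : ℂ}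
    (hs : z.im ∈ Ioo (-Kell (kComp k)) (Kell (kComp k))) :
    Complex.normSq (1 + xC k z ^ 2) =
      (((1 + xRe k z.re ^ 2) * (1 - xIm k z.im ^ 2)) ^ 2 +
        16 / k ^ 2 * (xRe k z.re ^ 2 * xIm k z.im ^ 2)) /
      (1 + xRe k z.re ^ 2 * xIm k z.im ^ 2) ^ 2 := by
  have hk0 := hk.1.ne'
  have hP : (0:ℝ) < 1 + xRe k z.re ^ 2 * xIm k z.im ^ 2 := by positivity
  have e : Complex.normSq (1 + xC k z ^ 2) = 1 + 2 * ((xC k z).re ^ 2 - (xC k z).im ^ 2) +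
      ((xC k z).re ^ 2 + (xC k z).im ^ 2) ^ 2 := by
    simp only [Complex.normSq_apply, sq, Complex.add_re, Complex.mul_re, Complex.add_im,
      Complex.mul_im, Complex.one_re, Complex.one_im]
    ring
  rw [e, normSq_xC hk hs, re_xC_sq hk hs]
  field_simp
  ring

lemma re_dnC (hk : k ∈ Ioo (0:ℝ) 1) {z : ℂ}
    (hs : z.im ∈ Ioo (-Kell (kComp k)) (Kell (kComp k))) :
    (dnC k z).re = (1 - (xRe k z.re ^ 2) ^ 2) * (1 - (xIm k z.im ^ 2) ^ 2) /
      (((1 + xRe k z.re ^ 2) * (1 - xIm k z.im ^ 2)) ^ 2 +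
        16 / k ^ 2 * (xRe k z.re ^ 2 * xIm k z.im ^ 2)) := by
  have hk0 := hk.1
  have hP : (0:ℝ) < 1 + xRe k z.re ^ 2 * xIm k z.im ^ 2 := by positivity
  have hb := xIm_sq_lt_one hk hs
  have hQ : 0 < ((1 + xRe k z.re ^ 2) * (1 - xIm k z.im ^ 2)) ^ 2 +
        16 / k ^ 2 * (xRe k z.re ^ 2 * xIm k z.im ^ 2) := by
    have : 0 < 1 - xIm k z.im ^ 2 := by linarith
    positivity
  have e : (dnC k z).re = (1 - ((xC k z).re ^ 2 + (xC k z).im ^ 2) ^ 2) /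
      Complex.normSq (1 + xC k z ^ 2) := by
    rw [dnC, Complex.div_re, ← add_div]
    congr 1
    simp only [sq, Complex.add_re, Complex.mul_re, Complex.add_im, Complex.sub_re, Complex.sub_im,
      Complex.mul_im, Complex.one_re, Complex.one_im]
    ring
  rw [e, normSq_xC hk hs, normSq_one_add_xC_sq hk hs, div_div_eq_mul_div]
  congr 1
  field_simp
  ring

lemma one_add_xC_sq_ne_zero (hk : k ∈ Ioo (0:ℝ) 1) {z : ℂ}
    (hs : z.im ∈ Ioo (-Kell (kComp k)) (Kell (kComp k))) : 1 + xC k z ^ 2 ≠ 0 := by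
  have hk0 := hk.1
  have hb := xIm_sq_lt_one hk hs
  rw [← Complex.normSq_pos, normSq_one_add_xC_sq hk hs]
  have : 0 < 1 - xIm k z.im ^ 2 := by linarith
  positivity

lemma differentiableAt_dnC (hk : k ∈ Ioo (0:ℝ) 1) {z : ℂ}
    (hs : z.im ∈ Ioo (-Kell (kComp k)) (Kell (kComp k))) : DifferentiableAt ℂ (dnC k) z := by
  have h := (differentiableAt_xC hk (mem_strip hk hs)).pow 2
  have hden : DifferentiableAt ℂ (fun w => 1 + xC k w ^ 2) z := h.const_add 1
  have hnum : DifferentiableAt ℂ (fun w => 1 - xC k w ^ 2) z := h.const_sub 1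
  exact hnum.mul (hden.inv (one_add_xC_sq_ne_zero hk hs))

lemma dnC_ofReal (hk : k ∈ Ioo (0:ℝ) 1) (u : ℝ) : dnC k u = jdn k u := by
  have h := jdn_pos hk u
  rw [dnC, xC_ofReal hk]
  norm_cast
  rw [xRe_sq hk]
  field_simp
  ring

lemma dnC_add_two_Kell (hk : k ∈ Ioo (0:ℝ) 1) (z : ℂ) : dnC k (z + 2 * Kell k) = dnC k z := by
  rw [dnC, xC_add_two_Kell hk, neg_sq, dnC]

/-- The Fourier coefficients of `dn`. -/
def dnCoef (k : ℝ) (n : ℤ) : ℝ :=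
  ∫ u in (0:ℝ)..2 * Kell k, jdn k u * Real.cos (π * n * u / Kell k)

lemma continuous_jdn (hk : k ∈ Ioo (0:ℝ) 1) : Continuous (jdn k) :=
  continuous_iff_continuousAt.2 fun u => (hasDerivAt_jdn hk u).continuousAt

lemma integral_jdn (hk : k ∈ Ioo (0:ℝ) 1) : ∫ u in (0:ℝ)..2 * Kell k, jdn k u = π := by
  rw [intervalIntegral.integral_eq_sub_of_hasDerivAt (fun u _ => hasDerivAt_jam hk u)
    ((continuous_jdn hk).intervalIntegrable _ _), jam_zero hk, sub_zero]
  have := jam_add_two_Kell hk 0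
  rwa [zero_add, jam_zero hk, zero_add] at this

lemma jdn_two_Kell_sub (hk : k ∈ Ioo (0:ℝ) 1) (u : ℝ) : jdn k (2 * Kell k - u) = jdn k u := by
  rw [sub_eq_neg_add, jdn_add_two_Kell hk, jdn_neg hk]

lemma integral_jdn_mul_wave (hk : k ∈ Ioo (0:ℝ) 1) (n : ℤ) :
    ∫ u in (0:ℝ)..2 * Kell k, (jdn k u : ℂ) * wave (2 * Kell k) n u = dnCoef k n := by
  have hK := Kell_pos hk
  have hK0 : (Kell k : ℂ) ≠ 0 := by exact_mod_cast hK.ne'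
  have hc : Continuous fun u => (jdn k u : ℂ) :=
    Complex.continuous_ofReal.comp (continuous_jdn hk)
  have hi : ∀ n : ℤ, IntervalIntegrable (fun u : ℝ => (jdn k u : ℂ) * wave (2 * Kell k) n u)
      MeasureTheory.volume 0 (2 * Kell k) := fun n =>
    (hc.mul (continuous_wave_ofReal _ n)).intervalIntegrable _ _
  have h1 : ∫ u in (0:ℝ)..2 * Kell k, (jdn k u : ℂ) * wave (2 * Kell k) n u =
      ∫ u in (0:ℝ)..2 * Kell k, (jdn k u : ℂ) * wave (2 * Kell k) (-n) u := by
    have h := intervalIntegral.integral_comp_sub_left (a := 0) (b := 2 * Kell k)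
      (fun u : ℝ => (jdn k u : ℂ) * wave (2 * Kell k) n u) (2 * Kell k)
    rw [sub_zero, sub_self] at h
    rw [← h]
    refine intervalIntegral.integral_congr fun u _ => ?_
    rw [jdn_two_Kell_sub hk, ← wave_add_period (by positivity) (-n)]
    rw [wave_add_period (by positivity)]
    have : wave (2 * Kell k) n ((2 * Kell k - u : ℝ) : ℂ) = wave (2 * Kell k) n (-u) := by
      rw [← wave_add_period (by positivity) n (-u)]
      congr 1
      push_cast
      ring
    rw [this, wave, wave]
    congr 3
    push_cast
    ring
  have h2 := intervalIntegral.integral_add (hi n) (hi (-n))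
  rw [← h1, ← two_mul] at h2
  rw [dnCoef, ← intervalIntegral.integral_ofReal]
  have h3 : ∫ u in (0:ℝ)..2 * Kell k, ((jdn k u : ℂ) * wave (2 * Kell k) n u +
      (jdn k u : ℂ) * wave (2 * Kell k) (-n) u) = 2 * ∫ u in (0:ℝ)..2 * Kell k,
        ((jdn k u * Real.cos (π * n * u / Kell k) : ℝ) : ℂ) := by
    rw [← intervalIntegral.integral_const_mul]
    refine intervalIntegral.integral_congr fun u _ => ?_
    rw [wave, wave]
    push_cast
    rw [mul_left_comm, Complex.two_cos, ← mul_add]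
    congr 3
    · field_simp
    · field_simp
  rw [h3] at h2
  exact (mul_left_cancel₀ two_ne_zero h2).symm

lemma dnCoef_mul_exp (hk : k ∈ Ioo (0:ℝ) 1) (n : ℤ) {s : ℝ}
    (hs : s ∈ Ioo 0 (Kell (kComp k))) :
    dnCoef k n * Complex.exp (π * n * s / Kell k) =
      ∫ u in (0:ℝ)..2 * Kell k, dnC k (u + s * I) * wave (2 * Kell k) n u := by
  have hK := Kell_pos hk
  have hK0 : (Kell k : ℂ) ≠ 0 := by exact_mod_cast hK.ne'
  have h := integral_period_shift (P := 2 * Kell k) (σ := s)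
    (f := fun z => dnC k z * wave (2 * Kell k) n z)
    (fun z hz => by
      rw [uIcc_of_le hs.1.le] at hz
      exact (differentiableAt_dnC hk ⟨by linarith [hz.1, hs.1, hs.2], by linarith [hz.2, hs.2]⟩).mul
        (differentiable_wave _ n z))
    (fun z => by
      rw [wave_add_period (by positivity)]
      push_cast
      rw [dnC_add_two_Kell hk])
  simp only [dnC_ofReal hk] at h
  rw [← integral_jdn_mul_wave hk, h, mul_comm, ← intervalIntegral.integral_const_mul]
  refine intervalIntegral.integral_congr fun u _ => ?_
  rw [mul_left_comm]
  congr 1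
  rw [wave, wave, ← Complex.exp_add]
  congr 1
  push_cast
  field_simp
  linear_combination ((n:ℂ) * s) * I_sq

lemma continuous_re_dnC (hk : k ∈ Ioo (0:ℝ) 1) {s : ℝ} (hs : s ∈ Ioo 0 (Kell (kComp k))) :
    Continuous fun u : ℝ => dnC k (u + s * I) := by
  refine continuous_iff_continuousAt.2 fun u => ?_
  have h : ContinuousAt (dnC k) (u + s * I) :=
    (differentiableAt_dnC hk (by simpa using ⟨by linarith [hs.1, hs.2], hs.2⟩)).continuousAt
  exact ContinuousAt.comp (f := fun u : ℝ => (u : ℂ) + s * I) h (by fun_prop)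

lemma dnCoef_mul_cosh (hk : k ∈ Ioo (0:ℝ) 1) (n : ℤ) {s : ℝ}
    (hs : s ∈ Ioo 0 (Kell (kComp k))) :
    dnCoef k n * Real.cosh (π * n * s / Kell k) =
      ∫ u in (0:ℝ)..2 * Kell k, (dnC k (u + s * I)).re * Real.cos (π * n * u / Kell k) := by
  have hK := Kell_pos hk
  have hK0 : (Kell k : ℂ) ≠ 0 := by exact_mod_cast hK.ne'
  have hc := continuous_re_dnC hk hs
  have h1 := dnCoef_mul_exp hk n hs
  have h2 := dnCoef_mul_exp hk (-n) hs
  have e : dnCoef k (-n) = dnCoef k n := by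
    rw [dnCoef, dnCoef]
    congr 1
    ext u
    rw [← Real.cos_neg (π * n * u / Kell k)]
    congr 2
    push_cast
    ring
  have hi : ∀ n : ℤ, IntervalIntegrable
      (fun u : ℝ => dnC k (u + s * I) * wave (2 * Kell k) n u)
      MeasureTheory.volume 0 (2 * Kell k) := fun n =>
    (hc.mul (continuous_wave_ofReal _ n)).intervalIntegrable _ _
  have h3 := intervalIntegral.integral_add (hi n) (hi (-n))
  rw [← h1, ← h2, e, ← mul_add] at h3
  have h4 : ∫ u in (0:ℝ)..2 * Kell k, (dnC k (u + s * I) * wave (2 * Kell k) n u +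
      dnC k (u + s * I) * wave (2 * Kell k) (-n) u) = 2 * ∫ u in (0:ℝ)..2 * Kell k,
        dnC k (u + s * I) * (Real.cos (π * n * u / Kell k) : ℂ) := by
    rw [← intervalIntegral.integral_const_mul]
    refine intervalIntegral.integral_congr fun u _ => ?_
    rw [wave, wave]
    push_cast
    rw [mul_left_comm, Complex.two_cos, ← mul_add]
    congr 3
    · field_simp
    · field_simp
  have h5 : Complex.exp (π * n * s / Kell k) + Complex.exp (π * (-n : ℤ) * s / Kell k) =
      2 * (Real.cosh (π * n * s / Kell k) : ℂ) := by
    push_cast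
    rw [Complex.two_cosh]
    congr 2
    ring
  rw [h4, h5, mul_left_comm] at h3
  have h6 := congrArg Complex.re (mul_left_cancel₀ two_ne_zero h3)
  have h_int : IntervalIntegrable
      (fun u : ℝ => dnC k (u + s * I) * (Real.cos (π * n * u / Kell k) : ℂ))
      MeasureTheory.volume 0 (2 * Kell k) :=
    (hc.mul (by fun_prop)).intervalIntegrable _ _
  have h7 := intervalIntegral.intervalIntegral_re h_int
  simp only [RCLike.re_to_complex, Complex.re_mul_ofReal] at h7
  rw [h7, h6, ← Complex.ofReal_mul, Complex.ofReal_re]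

lemma kComp_le_jdn (hk : k ∈ Ioo (0:ℝ) 1) (u : ℝ) : kComp k ≤ jdn k u := by
  have h1 := jdn_sq hk u
  have h2 := jdn_pos hk u
  have h3 := kComp_sq hk
  have h4 := jsn_sq_le_one k u
  exact abs_le_of_sq_le_sq' (by nlinarith [hk.1]) h2.le |>.2

lemma kComp_mul_le_jam (hk : k ∈ Ioo (0:ℝ) 1) {u : ℝ} (hu : 0 ≤ u) :
    kComp k * u ≤ jam k u := by
  have hd : ∀ v, HasDerivAt (fun v => jam k v - kComp k * v) (jdn k v - kComp k) v := fun v =>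
    ((hasDerivAt_jam hk v).sub ((hasDerivAt_id v).const_mul (kComp k))).congr_deriv (by rw [mul_one])
  have hm : Monotone fun v => jam k v - kComp k * v :=
    monotone_of_deriv_nonneg (fun v => (hd v).differentiableAt) fun v => by
      rw [(hd v).deriv]
      linarith [kComp_le_jdn hk v]
  have := hm hu
  simp only [jam_zero hk] at this
  linarith

lemma one_sub_cos_le_of_mem (hk : k ∈ Ioo (0:ℝ) 1) (n : ℤ) {u : ℝ} (hu : u ∈ Icc 0 (Kell k)) :
    1 - Real.cos (π * n * u / Kell k) ≤
      π ^ 4 * n ^ 2 / (2 * Kell k ^ 2 * k ^ 2 * kComp k ^ 2) * xRe k u ^ 2 := by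
  have hK := Kell_pos hk
  have hk0 := hk.1
  have hk' := (kComp_mem hk).1
  have h1 := Real.one_sub_sq_div_two_le_cos (x := π * n * u / Kell k)
  have h2 := kComp_mul_le_jam hk hu.1
  have h3 : jam k u ≤ π / 2 := by
    rw [← jam_Kell hk]; exact (strictMono_jam hk).monotone hu.2
  have h4 : 2 / π * (kComp k * u) ≤ jsn k u :=
    (mul_le_mul_of_nonneg_left h2 (by positivity)).trans
      (Real.mul_le_sin ((mul_nonneg hk'.le hu.1).trans h2) h3)
  have h0 : 0 ≤ 2 / π * (kComp k * u) := mul_nonneg (by positivity) (mul_nonneg hk'.le hu.1)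
  have h5 : k * kComp k * u / π ≤ xRe k u := by
    have hd := jdn_le_one hk u
    have hp := jdn_pos hk u
    rw [xRe, le_div_iff₀ (by linarith)]
    calc k * kComp k * u / π * (1 + jdn k u) ≤ k * kComp k * u / π * 2 := by
          apply mul_le_mul_of_nonneg_left (by linarith)
          exact div_nonneg (mul_nonneg (by positivity) hu.1) Real.pi_pos.le
      _ = k * (2 / π * (kComp k * u)) := by ring
      _ ≤ k * jsn k u := mul_le_mul_of_nonneg_left h4 hk0.le
  have h6 := pow_le_pow_left₀ (div_nonneg (mul_nonneg (by positivity) hu.1) Real.pi_pos.le) h5 2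
  have h7 := mul_le_mul_of_nonneg_left h6
    (by positivity : 0 ≤ π ^ 4 * (n:ℝ) ^ 2 / (2 * Kell k ^ 2 * k ^ 2 * kComp k ^ 2))
  refine le_trans ?_ h7
  have e : π ^ 4 * (n:ℝ) ^ 2 / (2 * Kell k ^ 2 * k ^ 2 * kComp k ^ 2) *
      (k * kComp k * u / π) ^ 2 = (π * n * u / Kell k) ^ 2 / 2 := by
    field_simp
  rw [e]
  linarith

lemma exists_one_sub_cos_le (hk : k ∈ Ioo (0:ℝ) 1) (n : ℤ) : ∃ C : ℝ, 0 ≤ C ∧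
    ∀ u ∈ Icc 0 (2 * Kell k), 1 - Real.cos (π * n * u / Kell k) ≤ C * xRe k u ^ 2 := by
  have hK := Kell_pos hk
  refine ⟨π ^ 4 * n ^ 2 / (2 * Kell k ^ 2 * k ^ 2 * kComp k ^ 2), by positivity, fun u hu => ?_⟩
  rcases le_total u (Kell k) with h | h
  · exact one_sub_cos_le_of_mem hk n ⟨hu.1, h⟩
  · have h1 := one_sub_cos_le_of_mem hk n (u := 2 * Kell k - u)
      ⟨by linarith [hu.2], by linarith⟩
    have e1 : Real.cos (π * n * (2 * Kell k - u) / Kell k) = Real.cos (π * n * u / Kell k) := by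
      rw [← Real.cos_int_mul_two_pi_sub _ n]
      congr 1
      field_simp
      ring
    have e2 : xRe k (2 * Kell k - u) ^ 2 = xRe k u ^ 2 := by
      rw [xRe_sq hk, xRe_sq hk, jdn_two_Kell_sub hk]
    rwa [e1, e2] at h1

lemma xIm_sq_pos (hk : k ∈ Ioo (0:ℝ) 1) {s : ℝ} (hs : s ∈ Ioo 0 (Kell (kComp k))) :
    0 < xIm k s ^ 2 := by
  have hk' := kComp_mem hk
  have h1 := jcn_add_jdn_pos hk (mem_strip hk ⟨by linarith [hs.1, hs.2], hs.2⟩)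
  have h2 := strictMono_jam hk' hs.1
  have h3 := strictMono_jam hk' hs.2
  rw [jam_zero hk'] at h2
  rw [jam_Kell hk'] at h3
  have h4 : 0 < jsn (kComp k) s := Real.sin_pos_of_pos_of_lt_pi h2 (by linarith [Real.pi_pos])
  have := hk.1
  rw [xIm]
  positivity

lemma re_dnC_nonneg (hk : k ∈ Ioo (0:ℝ) 1) {z : ℂ}
    (hs : z.im ∈ Ioo (-Kell (kComp k)) (Kell (kComp k))) : 0 ≤ (dnC k z).re := by
  rw [re_dnC hk hs]
  have h1 := xIm_sq_lt_one hk hs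
  have h2 := (sq_le_one_iff_abs_le_one _).2 (abs_xRe_le_one hk z.re)
  have h3 : 0 ≤ 1 - (xRe k z.re ^ 2) ^ 2 := by
    have := pow_le_one₀ (n := 2) (sq_nonneg (xRe k z.re)) h2
    linarith
  have h4 : 0 ≤ 1 - (xIm k z.im ^ 2) ^ 2 := by
    have := pow_le_one₀ (n := 2) (sq_nonneg (xIm k z.im)) h1.le
    linarith
  have := hk.1
  positivity

lemma re_dnC_mul_xRe_sq_le (hk : k ∈ Ioo (0:ℝ) 1) {z : ℂ} (hs : z.im ∈ Ioo 0 (Kell (kComp k))) :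
    (dnC k z).re * xRe k z.re ^ 2 ≤ k ^ 2 * (1 - (xIm k z.im ^ 2) ^ 2) / (16 * xIm k z.im ^ 2) := by
  have hs' : z.im ∈ Ioo (-Kell (kComp k)) (Kell (kComp k)) := ⟨by linarith [hs.1, hs.2], hs.2⟩
  have h1 := xIm_sq_lt_one hk hs'
  have h0 := xIm_sq_pos hk hs
  have h2 := (sq_le_one_iff_abs_le_one _).2 (abs_xRe_le_one hk z.re)
  have h4 : 0 ≤ 1 - (xIm k z.im ^ 2) ^ 2 := by
    have := pow_le_one₀ (n := 2) (sq_nonneg (xIm k z.im)) h1.le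
    linarith
  have hk0 := hk.1
  rw [re_dnC hk hs']
  set α := xRe k z.re ^ 2
  set β := xIm k z.im ^ 2
  have hα : 0 ≤ α := sq_nonneg _
  have hQ : 0 < ((1 + α) * (1 - β)) ^ 2 + 16 / k ^ 2 * (α * β) := by
    have : 0 < 1 - β := by linarith
    positivity
  rw [div_mul_eq_mul_div, div_le_div_iff₀ hQ (by positivity)]
  have e : k ^ 2 * (1 - β ^ 2) * (((1 + α) * (1 - β)) ^ 2 + 16 / k ^ 2 * (α * β)) =
      k ^ 2 * (1 - β ^ 2) * ((1 + α) * (1 - β)) ^ 2 + (1 - β ^ 2) * α * (16 * β) := by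
    field_simp
  rw [e]
  have h5 : 0 ≤ k ^ 2 * (1 - β ^ 2) * ((1 + α) * (1 - β)) ^ 2 := by positivity
  have h6 : 0 ≤ α ^ 2 * ((1 - β ^ 2) * α * (16 * β)) := by positivity
  nlinarith

lemma abs_dnCoef_mul_cosh_sub_le (hk : k ∈ Ioo (0:ℝ) 1) (n : ℤ) : ∃ C : ℝ, 0 ≤ C ∧
    ∀ s ∈ Ioo 0 (Kell (kComp k)), |dnCoef k n * Real.cosh (π * n * s / Kell k) - π| ≤
      C * (k ^ 2 * (1 - (xIm k s ^ 2) ^ 2) / (16 * xIm k s ^ 2)) := by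
  have hK := Kell_pos hk
  obtain ⟨C, hC0, hC⟩ := exists_one_sub_cos_le hk n
  refine ⟨C * (2 * Kell k), by positivity, fun s hs => ?_⟩
  have hc : Continuous fun u : ℝ => (dnC k (u + s * I)).re :=
    Complex.continuous_re.comp (continuous_re_dnC hk hs)
  have h0 := dnCoef_mul_cosh hk 0 hs
  have hd0 : dnCoef k 0 = π := by simp [dnCoef, integral_jdn hk]
  simp only [hd0, Int.cast_zero, mul_zero, zero_mul, zero_div, Real.cosh_zero, Real.cos_zero,
    mul_one] at h0
  nth_rewrite 2 [h0]
  have hc2 : Continuous fun u : ℝ => (dnC k (u + s * I)).re * Real.cos (π * n * u / Kell k) :=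
    hc.mul (by fun_prop)
  rw [dnCoef_mul_cosh hk n hs, ← intervalIntegral.integral_sub
    (hc2.intervalIntegrable _ _) (hc.intervalIntegrable _ _),
    ← Real.norm_eq_abs]
  have hb := intervalIntegral.norm_integral_le_of_norm_le_const (a := 0) (b := 2 * Kell k)
    (C := C * (k ^ 2 * (1 - (xIm k s ^ 2) ^ 2) / (16 * xIm k s ^ 2)))
    (f := fun u : ℝ => (dnC k (u + s * I)).re * Real.cos (π * n * u / Kell k) -
      (dnC k (u + s * I)).re) fun u hu => by
      rw [uIoc_of_le (by positivity)] at hu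
      have e1 : ((u : ℂ) + s * I).re = u := by simp
      have e2 : ((u : ℂ) + s * I).im = s := by simp
      have g1 := re_dnC_nonneg hk (z := u + s * I) (by rw [e2]; exact ⟨by linarith [hs.1, hs.2], hs.2⟩)
      have g2 := re_dnC_mul_xRe_sq_le hk (z := u + s * I) (by rwa [e2])
      rw [e1, e2] at g2
      have g3 := hC u ⟨hu.1.le, hu.2⟩
      have g4 := Real.cos_le_one (π * n * u / Kell k)
      rw [Real.norm_eq_abs, ← mul_sub_one, abs_mul, abs_of_nonneg g1, abs_sub_comm,
        abs_of_nonneg (by linarith)]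
      calc _ ≤ (dnC k (u + s * I)).re * (C * xRe k u ^ 2) := mul_le_mul_of_nonneg_left g3 g1
        _ = C * ((dnC k (u + s * I)).re * xRe k u ^ 2) := by ring
        _ ≤ _ := mul_le_mul_of_nonneg_left g2 hC0
  rw [sub_zero, abs_of_pos (by positivity)] at hb
  linarith

lemma dnCoef_mul_cosh_eq (hk : k ∈ Ioo (0:ℝ) 1) (n : ℤ) :
    dnCoef k n * Real.cosh (π * n * Kell (kComp k) / Kell k) = π := by
  have hk' := kComp_mem hk
  have hK' := Kell_pos hk'
  obtain ⟨C, hC0, hC⟩ := abs_dnCoef_mul_cosh_sub_le hk n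
  have hmem : Kell (kComp k) ∈ Ioo (-(2 * Kell (kComp k))) (2 * Kell (kComp k)) :=
    ⟨by linarith, by linarith⟩
  have hβ : xIm k (Kell (kComp k)) ^ 2 = 1 := by
    rw [xIm_sq hk hmem, jcn_Kell hk', sub_zero, zero_add, div_self (jdn_pos hk' _).ne']
  have hcont : ContinuousAt (fun s => xIm k s ^ 2) (Kell (kComp k)) :=
    (hasDerivAt_xIm hk hmem).continuousAt.pow 2
  have hR : ContinuousAt (fun s => C * (k ^ 2 * (1 - (xIm k s ^ 2) ^ 2) / (16 * xIm k s ^ 2)))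
      (Kell (kComp k)) :=
    (((hcont.pow 2).const_sub 1 |>.const_mul (k ^ 2)).div (hcont.const_mul 16)
      (by simp only [hβ]; norm_num)).const_mul C
  have hL : ContinuousAt (fun s => |dnCoef k n * Real.cosh (π * n * s / Kell k) - π|)
      (Kell (kComp k)) := by fun_prop
  have hlim := le_of_tendsto_of_tendsto (b := nhdsWithin (Kell (kComp k)) (Iio (Kell (kComp k))))
    (hL.tendsto.mono_left nhdsWithin_le_nhds)
    (hR.tendsto.mono_left nhdsWithin_le_nhds) (by
      filter_upwards [Ioo_mem_nhdsLT hK'] with s hs using hC s hs)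
  rw [hβ] at hlim
  simp only [one_pow, sub_self, mul_zero, zero_div] at hlim
  exact sub_eq_zero.1 (abs_nonpos_iff.1 hlim)

lemma dnCoef_eq (hk : k ∈ Ioo (0:ℝ) 1) (n : ℤ) :
    dnCoef k n = 2 * π * qNome k ^ n / (1 + (qNome k ^ n) ^ 2) := by
  have h := dnCoef_mul_cosh_eq hk n
  have e : qNome k ^ n = Real.exp (-(π * n * Kell (kComp k) / Kell k)) := by
    rw [qNome, ← Real.rpow_intCast, ← Real.exp_mul]
    congr 1
    ring
  rw [Real.cosh_eq, ← neg_neg (π * n * Kell (kComp k) / Kell k), Real.exp_neg, neg_neg, ← e] at h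
  have hp : 0 < qNome k ^ n := zpow_pos (qNome_pos k) n
  rw [eq_div_iff (by positivity), ← h]
  field_simp

/-- The Fourier coefficients of `XY` over the period `2K`. -/
lemma one_add_mul_eCoef_one_one (hk : k ∈ Ioo (0:ℝ) 1) (n : ℤ) :
    (1 + (qNome k : ℂ) ^ n) * eCoef k n 1 1 =
      2 / k * ((if n = 0 then 2 * (Kell k : ℂ) else 0) - dnCoef k n) := by
  have hK := Kell_pos hk
  have hk0 : (k : ℂ) ≠ 0 := by exact_mod_cast hk.1.ne'
  have h : eCoef k n 1 (-1) = (qNome k : ℂ) ^ n * eCoef k n 1 1 := by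
    exact_mod_cast eCoef_shift hk n (a := 1) (b := 1) (by decide)
  have h0 : eCoef k n 0 0 = if n = 0 then 2 * (Kell k : ℂ) else 0 := by
    split_ifs with hn
    · rw [hn, eCoef_zero_zero_zero]
    · exact eCoef_zero_zero hk hn
  have hc : ∀ a b, IntervalIntegrable (fun u : ℝ => ePhi k a b u * wave (2 * Kell k) n u)
      MeasureTheory.volume 0 (2 * Kell k) := fun a b =>
    ((continuous_ePhi hk a b).mul (continuous_wave_ofReal _ n)).intervalIntegrable _ _
  have hd : IntervalIntegrable (fun u : ℝ => (jdn k u : ℂ) * wave (2 * Kell k) n u)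
      MeasureTheory.volume 0 (2 * Kell k) :=
    ((Complex.continuous_ofReal.comp (continuous_jdn hk)).mul
      (continuous_wave_ofReal _ n)).intervalIntegrable _ _
  rw [one_add_mul (α := ℂ), ← h, ← h0, ← integral_jdn_mul_wave hk, eCoef, eCoef, eCoef,
    ← intervalIntegral.integral_add (hc _ _) (hc _ _), ← intervalIntegral.integral_sub (hc _ _) hd,
    ← intervalIntegral.integral_const_mul]
  refine intervalIntegral.integral_congr fun u _ => ?_
  have hp := jdn_pos hk u
  have hs : (jdn k u : ℂ) ^ 2 = 1 - k ^ 2 * jsn k u ^ 2 := by exact_mod_cast jdn_sq hk u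
  have hne : (1 + jdn k u : ℂ) ≠ 0 := by
    have : (0:ℝ) < 1 + jdn k u := by linarith
    exact_mod_cast this.ne'
  simp only [ePhi, pow_zero, yPow_zero, pow_one, yPow_one, yPow_neg_one, xRe]
  push_cast
  field_simp
  linear_combination (2 : ℂ) * wave (2 * Kell k) n u * hs

end DeltaAmplitude

section ThetaProduct

/-- The normalised coefficients in the finite form of the triple product for `θ₁`. -/
def thetaRatio (p : ℝ) (N n : ℕ) : ℝ :=
  ∏ j ∈ Finset.range n, (1 - p ^ (N - j)) / (1 - p ^ (N + 2 + j))

/-- The exponential weight of the `n`-th harmonic of `θ₁`. -/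
def thetaWeight (p : ℝ) (n : ℕ) : ℝ := (-1) ^ n * p ^ (n * (n + 1) / 2)

/-- The sine polynomial given by the finite triple product. -/
def thetaSum (p : ℝ) (N : ℕ) (z : ℝ) : ℝ :=
  ∑ n ∈ Finset.range (N + 1), thetaWeight p n * thetaRatio p N n * Real.sin ((2 * n + 1) * z)

/-- The derivative of `thetaSum`. -/
def thetaSumDeriv (p : ℝ) (N : ℕ) (z : ℝ) : ℝ :=
  ∑ n ∈ Finset.range (N + 1),
    thetaWeight p n * thetaRatio p N n * ((2 * n + 1) * Real.cos ((2 * n + 1) * z))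

variable {p : ℝ}

lemma thetaWeight_succ (p : ℝ) (n : ℕ) :
    thetaWeight p (n + 1) = -(p * p ^ n) * thetaWeight p n := by
  have h : (n + 1) * (n + 1 + 1) / 2 = (n + 1) + n * (n + 1) / 2 := by
    rw [show (n + 1) * (n + 1 + 1) = n * (n + 1) + (n + 1) * 2 by ring,
      Nat.add_mul_div_right _ _ two_pos, add_comm]
  rw [thetaWeight, thetaWeight, h]
  ring

lemma one_sub_pow_ne_zero (h0 : 0 < p) (h1 : p < 1) {n : ℕ} (hn : n ≠ 0) : 1 - p ^ n ≠ 0 := by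
  have := pow_lt_one₀ h0.le h1 hn
  linarith

lemma thetaRatio_succ (p : ℝ) (N n : ℕ) : thetaRatio p N (n + 1) =
    thetaRatio p N n * ((1 - p ^ (N - n)) / (1 - p ^ (N + 2 + n))) := Finset.prod_range_succ _ _

lemma thetaRatio_of_lt (p : ℝ) {N n : ℕ} (h : N < n) : thetaRatio p N n = 0 :=
  Finset.prod_eq_zero (Finset.mem_range.2 h) (by simp)

lemma thetaRatio_succ_succ (h0 : 0 < p) (h1 : p < 1) (N n : ℕ) :
    thetaRatio p (N + 1) (n + 1) * ((1 - p ^ (N + 2 + n)) * (1 - p ^ (N + 3 + n))) =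
      thetaRatio p N n * ((1 - p ^ (N + 1)) * (1 - p ^ (N + 2))) := by
  have e := fun m : ℕ => one_sub_pow_ne_zero h0 h1 (n := m + 1) (by omega)
  induction n with
  | zero =>
    have e3 := e (N + 2)
    simp only [thetaRatio, zero_add, Finset.prod_range_one, Finset.prod_range_zero, Nat.sub_zero]
    rw [show N + 1 + 2 + 0 = N + 2 + 1 by ring, show N + 3 + 0 = N + 2 + 1 by ring, add_zero]
    field_simp
  | succ n ih =>
    have e2 := e (N + n + 1)
    have e3 := e (N + n + 2)
    have e4 := e (N + n + 3)
    rw [thetaRatio_succ p (N + 1), thetaRatio_succ p N, Nat.succ_sub_succ]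
    rw [show N + 2 + n = N + n + 1 + 1 by ring, show N + 3 + n = N + n + 2 + 1 by ring] at ih
    rw [show N + 2 + n = N + n + 1 + 1 by ring, show N + 2 + (n + 1) = N + n + 2 + 1 by ring,
      show N + 3 + (n + 1) = N + n + 3 + 1 by ring]
    field_simp
    linear_combination (1 - p ^ (N - n)) * ih

lemma thetaRatio_recurrence (h0 : 0 < p) (h1 : p < 1) (N n : ℕ) :
    (1 + p ^ (N + 1)) * (1 - p ^ (2 * N + 3)) / (1 - p ^ (N + 2)) *
        (thetaWeight p (n + 1) * thetaRatio p (N + 1) (n + 1)) =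
      (1 + p ^ (2 * N + 2)) * (thetaWeight p (n + 1) * thetaRatio p N (n + 1)) -
        p ^ (N + 1) * (thetaWeight p n * thetaRatio p N n +
          thetaWeight p (n + 2) * thetaRatio p N (n + 2)) := by
  rcases lt_or_ge N n with h | h
  · rw [thetaRatio_of_lt p h, thetaRatio_of_lt p (show N < n + 1 by omega),
      thetaRatio_of_lt p (show N < n + 2 by omega),
      thetaRatio_of_lt p (show N + 1 < n + 1 by omega)]
    ring
  obtain ⟨d, rfl⟩ := Nat.exists_eq_add_of_le h
  have e := fun m : ℕ => one_sub_pow_ne_zero h0 h1 (n := m + 1) (by omega)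
  have r1 : thetaRatio p (n + d) (n + 1) * (1 - p ^ (n + d + 2 + n)) =
      thetaRatio p (n + d) n * (1 - p ^ d) := by
    rw [thetaRatio_succ, Nat.add_sub_cancel_left, mul_assoc, div_mul_cancel₀]
    exact one_sub_pow_ne_zero h0 h1 (by omega)
  have r2 : p * (thetaRatio p (n + d) (n + 2) * (1 - p ^ (n + d + 3 + n))) =
      thetaRatio p (n + d) (n + 1) * (p - p ^ d) := by
    rw [thetaRatio_succ p (n + d) (n + 1), show n + d + 2 + (n + 1) = n + d + 3 + n by ring,
      mul_assoc, div_mul_cancel₀ _ (one_sub_pow_ne_zero h0 h1 (by omega))]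
    rcases d with _ | d
    · rw [thetaRatio_of_lt p (show n + 0 < n + 1 by omega)]
      ring
    · rw [show n + (d + 1) - (n + 1) = d by omega]
      ring
  have r3 := thetaRatio_succ_succ h0 h1 (n + d) n
  have f1 := e (n + d)
  have f2 := e (n + d + 1)
  have f3 := e (n + d + 1 + n)
  have f4 := e (n + d + 2 + n)
  rw [show n + d + 1 + n + 1 = n + d + 2 + n by ring] at f3
  rw [show n + d + 2 + n + 1 = n + d + 3 + n by ring] at f4
  rw [thetaWeight_succ p (n + 1), thetaWeight_succ]
  generalize thetaWeight p n = w
  generalize thetaRatio p (n + d) (n + 1) = R1 at *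
  generalize thetaRatio p (n + d) (n + 2) = R2 at *
  generalize thetaRatio p (n + d) n = R at *
  generalize thetaRatio p (n + d + 1) (n + 1) = R' at *
  have g1 : R1 = R * (1 - p ^ d) / (1 - p ^ (n + d + 2 + n)) := by
    rw [eq_div_iff f3, r1]
  have g3 : R' = R * ((1 - p ^ (n + d + 1)) * (1 - p ^ (n + d + 2))) /
      ((1 - p ^ (n + d + 2 + n)) * (1 - p ^ (n + d + 3 + n))) := by
    rw [eq_div_iff (mul_ne_zero f3 f4), r3]
  have g2 : R2 = R1 * (p - p ^ d) / (p * (1 - p ^ (n + d + 3 + n))) := by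
    rw [eq_div_iff (mul_ne_zero h0.ne' f4), ← r2]
    ring
  rw [g3, g2, g1]
  rw [show n + d + 1 + 1 = n + d + 2 by ring] at f2
  have h0' := h0.ne'
  field_simp
  ring

lemma thetaRatio_recurrence_zero (h0 : 0 < p) (h1 : p < 1) (N : ℕ) :
    (1 + p ^ (N + 1)) * (1 - p ^ (2 * N + 3)) / (1 - p ^ (N + 2)) *
        (thetaWeight p 0 * thetaRatio p (N + 1) 0) =
      (1 + p ^ (2 * N + 2)) * (thetaWeight p 0 * thetaRatio p N 0) -
        p ^ (N + 1) * (-(thetaWeight p 0 * thetaRatio p N 0) +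
          thetaWeight p 1 * thetaRatio p N 1) := by
  have f1 := one_sub_pow_ne_zero h0 h1 (n := N + 2) (by omega)
  simp [thetaRatio, thetaWeight]
  field_simp
  ring

lemma two_mul_cos_mul_sin_odd (n : ℕ) (z : ℝ) :
    2 * Real.cos (2 * z) * Real.sin ((2 * ((n + 1 : ℕ) : ℝ) + 1) * z) =
      Real.sin ((2 * ((n + 2 : ℕ) : ℝ) + 1) * z) + Real.sin ((2 * (n : ℝ) + 1) * z) := by
  push_cast
  rw [show (2 * ((n:ℝ) + 2) + 1) * z = (2 * ((n:ℝ) + 1) + 1) * z + 2 * z by ring,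
    show (2 * (n:ℝ) + 1) * z = (2 * ((n:ℝ) + 1) + 1) * z - 2 * z by ring,
    Real.sin_add, Real.sin_sub]
  ring

lemma thetaSum_step_aux (h0 : 0 < p) (h1 : p < 1) (N M : ℕ) (z : ℝ) :
    (1 - 2 * p ^ (N + 1) * Real.cos (2 * z) + p ^ (2 * N + 2)) *
        ∑ n ∈ Finset.range (M + 1),
          thetaWeight p n * thetaRatio p N n * Real.sin ((2 * n + 1) * z) =
      (1 + p ^ (N + 1)) * (1 - p ^ (2 * N + 3)) / (1 - p ^ (N + 2)) *
        ∑ n ∈ Finset.range (M + 1),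
          thetaWeight p n * thetaRatio p (N + 1) n * Real.sin ((2 * n + 1) * z) +
      p ^ (N + 1) * (thetaWeight p (M + 1) * thetaRatio p N (M + 1) *
          Real.sin ((2 * M + 1) * z) -
        thetaWeight p M * thetaRatio p N M * Real.sin ((2 * ((M + 1 : ℕ) : ℝ) + 1) * z)) := by
  induction M with
  | zero =>
    have h := thetaRatio_recurrence_zero h0 h1 N
    have hs : 2 * Real.cos (2 * z) * Real.sin z =
        Real.sin ((2 * ((0 + 1 : ℕ) : ℝ) + 1) * z) - Real.sin z := by
      rw [zero_add, Nat.cast_one, show ((2:ℝ) * 1 + 1) * z = 2 * z + z by ring, Real.sin_add, Real.sin_two_mul,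
        Real.cos_two_mul]
      ring
    simp only [zero_add, Finset.sum_range_one, Nat.cast_zero, mul_zero, one_mul] at hs h ⊢
    linear_combination (-Real.sin z) * h -
      p ^ (N + 1) * thetaWeight p 0 * thetaRatio p N 0 * hs
  | succ M ih =>
    have h := thetaRatio_recurrence h0 h1 N M
    have hs := two_mul_cos_mul_sin_odd M z
    rw [Finset.sum_range_succ _ (M + 1), Finset.sum_range_succ _ (M + 1), mul_add, mul_add, ih]
    linear_combination (-Real.sin ((2 * ((M + 1 : ℕ) : ℝ) + 1) * z)) * h -
      p ^ (N + 1) * thetaWeight p (M + 1) * thetaRatio p N (M + 1) * hs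

lemma thetaSum_step (h0 : 0 < p) (h1 : p < 1) (N : ℕ) (z : ℝ) :
    (1 - 2 * p ^ (N + 1) * Real.cos (2 * z) + p ^ (2 * N + 2)) * thetaSum p N z =
      (1 + p ^ (N + 1)) * (1 - p ^ (2 * N + 3)) / (1 - p ^ (N + 2)) * thetaSum p (N + 1) z := by
  have h := thetaSum_step_aux h0 h1 N (N + 1) z
  rw [Finset.sum_range_succ, thetaRatio_of_lt p (show N < N + 1 by omega),
    thetaRatio_of_lt p (show N < N + 1 + 1 by omega)] at h
  rw [thetaSum, thetaSum]
  linear_combination h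

lemma hasDerivAt_thetaSum (p : ℝ) (N : ℕ) (z : ℝ) :
    HasDerivAt (thetaSum p N) (thetaSumDeriv p N z) z := by
  refine HasDerivAt.fun_sum fun n _ => ?_
  have h := ((hasDerivAt_id z).const_mul (2 * (n:ℝ) + 1)).sin.const_mul
    (thetaWeight p n * thetaRatio p N n)
  simpa [mul_comm] using h

/-- The logarithmic derivative of the finite product. -/
def thetaLogDeriv (p : ℝ) (N : ℕ) (z : ℝ) : ℝ :=
  Real.cos z / Real.sin z + ∑ m ∈ Finset.range N,
    4 * p ^ (m + 1) * Real.sin (2 * z) / (1 - 2 * p ^ (m + 1) * Real.cos (2 * z) + p ^ (2 * m + 2))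

lemma thetaFactor_ge (h0 : 0 < p) (m : ℕ) (z : ℝ) :
    (1 - p ^ (m + 1)) ^ 2 ≤ 1 - 2 * p ^ (m + 1) * Real.cos (2 * z) + p ^ (2 * m + 2) := by
  have := Real.cos_le_one (2 * z)
  have hp : 0 < p ^ (m + 1) := by positivity
  have e : p ^ (2 * m + 2) = (p ^ (m + 1)) ^ 2 := by ring
  rw [e]
  nlinarith

lemma thetaFactor_pos (h0 : 0 < p) (h1 : p < 1) (m : ℕ) (z : ℝ) :
    0 < 1 - 2 * p ^ (m + 1) * Real.cos (2 * z) + p ^ (2 * m + 2) :=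
  (pow_pos (sub_pos.2 (pow_lt_one₀ h0.le h1 (Nat.succ_ne_zero m))) 2).trans_le
    (thetaFactor_ge h0 m z)

lemma thetaNorm_pos (h0 : 0 < p) (h1 : p < 1) (N : ℕ) :
    0 < (1 + p ^ (N + 1)) * (1 - p ^ (2 * N + 3)) / (1 - p ^ (N + 2)) := by
  have a1 : 0 < 1 - p ^ (2 * N + 3) := sub_pos.2 (pow_lt_one₀ h0.le h1 (by omega))
  have a2 : 0 < 1 - p ^ (N + 2) := sub_pos.2 (pow_lt_one₀ h0.le h1 (by omega))
  positivity

lemma thetaSumDeriv_eq (h0 : 0 < p) (h1 : p < 1) (N : ℕ) {z : ℝ} (hz : Real.sin z ≠ 0) :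
    thetaSumDeriv p N z = thetaLogDeriv p N z * thetaSum p N z := by
  induction N with
  | zero =>
    simp [thetaSumDeriv, thetaLogDeriv, thetaSum, thetaRatio, thetaWeight]
    field_simp
  | succ N ih =>
    set x := p ^ (N + 1) with hx
    have hw := thetaFactor_pos h0 h1 N z
    have hr := thetaNorm_pos h0 h1 N
    set r := (1 + p ^ (N + 1)) * (1 - p ^ (2 * N + 3)) / (1 - p ^ (N + 2))
    have d1 : HasDerivAt (fun z => (1 - 2 * p ^ (N + 1) * Real.cos (2 * z) + p ^ (2 * N + 2)) *
        thetaSum p N z) (4 * x * Real.sin (2 * z) * thetaSum p N z +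
          (1 - 2 * p ^ (N + 1) * Real.cos (2 * z) + p ^ (2 * N + 2)) * thetaSumDeriv p N z) z := by
      have h := ((((hasDerivAt_id z).const_mul (2:ℝ)).cos.const_mul (2 * p ^ (N + 1))).const_sub
        1).add_const (p ^ (2 * N + 2))
      refine (h.fun_mul (hasDerivAt_thetaSum p N z)).congr_deriv ?_
      simp only [id, hx]
      ring
    have d2 := (hasDerivAt_thetaSum p (N + 1) z).const_mul r
    have hd : (fun z => (1 - 2 * p ^ (N + 1) * Real.cos (2 * z) + p ^ (2 * N + 2)) *
        thetaSum p N z) = fun z => r * thetaSum p (N + 1) z :=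
      funext fun z => thetaSum_step h0 h1 N z
    rw [hd] at d1
    have e := d1.unique d2
    have e2 := thetaSum_step h0 h1 N z
    have e3 : thetaLogDeriv p (N + 1) z = thetaLogDeriv p N z + 4 * x * Real.sin (2 * z) /
        (1 - 2 * p ^ (N + 1) * Real.cos (2 * z) + p ^ (2 * N + 2)) := by
      rw [thetaLogDeriv, thetaLogDeriv, Finset.sum_range_succ, add_assoc]
    rw [ih] at e
    refine mul_left_cancel₀ hr.ne' ?_
    replace e2 : _ = r * thetaSum p (N + 1) z := e2
    rw [← e, mul_left_comm r, ← e2, e3]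
    field_simp
    ring

lemma abs_thetaSum_ge (h0 : 0 < p) (h1 : p < 1) (N : ℕ) (z : ℝ) :
    |Real.sin z| * Real.exp (-(4 * ∑ m ∈ Finset.range N, p ^ (m + 1) / (1 - p))) ≤
      |thetaSum p N z| := by
  induction N with
  | zero => simp [thetaSum, thetaRatio, thetaWeight]
  | succ N ih =>
    have hw := thetaFactor_pos h0 h1 N z
    have hw' := thetaFactor_ge h0 N z
    have hr := thetaNorm_pos h0 h1 N
    have hx : 0 < p ^ (N + 1) := by positivity
    have hxp : p ^ (N + 1) ≤ p := pow_le_of_le_one h0.le h1.le (by omega)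
    have e2 := congrArg abs (thetaSum_step h0 h1 N z)
    rw [abs_mul, abs_mul, abs_of_pos hw, abs_of_pos hr] at e2
    have hr' : (1 + p ^ (N + 1)) * (1 - p ^ (2 * N + 3)) / (1 - p ^ (N + 2)) *
        (1 - p ^ (N + 1)) ^ 2 ≤ 1 := by
      have a2 : 0 < 1 - p ^ (N + 2) := sub_pos.2 (pow_lt_one₀ h0.le h1 (by omega))
      have a3 : p ^ (N + 2) ≤ p ^ (N + 1) := pow_le_pow_of_le_one h0.le h1.le (by omega)
      have a4 : 0 < p ^ (2 * N + 3) := by positivity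
      have a5 : p ^ (2 * N + 3) < 1 := pow_lt_one₀ h0.le h1 (by omega)
      rw [div_mul_eq_mul_div, div_le_one a2]
      generalize p ^ (N + 1) = x at *
      generalize p ^ (N + 2) = y at *
      generalize p ^ (2 * N + 3) = s at *
      have hx1 : x < 1 := hxp.trans_lt h1
      have : (1 + x) * (1 - s) * (1 - x) ^ 2 = (1 - x ^ 2) * (1 - s) * (1 - x) := by ring
      rw [this]
      have b1 : (1 - x ^ 2) * (1 - s) ≤ 1 := by nlinarith
      nlinarith
    have hexp : Real.exp (-(p ^ (N + 1) / (1 - p))) ≤ 1 - p ^ (N + 1) := by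
      have h1p : 0 < 1 - p := by linarith
      have h1x : 0 < 1 - p ^ (N + 1) := by linarith
      have h := Real.add_one_le_exp (p ^ (N + 1) / (1 - p))
      rw [Real.exp_neg]
      refine inv_le_of_inv_le₀ h1x (le_trans ?_ h)
      rw [inv_le_iff_one_le_mul₀ h1x]
      have : p ^ (N + 1) / (1 - p ^ (N + 1)) ≤ p ^ (N + 1) / (1 - p) :=
        div_le_div_of_nonneg_left hx.le h1p (by linarith)
      have h3 : p ^ (N + 1) / (1 - p ^ (N + 1)) * (1 - p ^ (N + 1)) = p ^ (N + 1) :=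
        div_mul_cancel₀ _ h1x.ne'
      nlinarith
    have hexp4 : Real.exp (-(4 * (p ^ (N + 1) / (1 - p)))) ≤ (1 - p ^ (N + 1)) ^ 4 := by
      have := pow_le_pow_left₀ (Real.exp_pos _).le hexp 4
      rw [← Real.exp_nat_mul] at this
      refine le_of_eq_of_le (congrArg Real.exp ?_) this
      push_cast
      ring
    rw [Finset.sum_range_succ, mul_add, neg_add, Real.exp_add, ← mul_assoc]
    refine (mul_le_mul ih hexp4 (Real.exp_pos _).le (abs_nonneg _)).trans ?_
    have h5 : |thetaSum p N z| * (1 - p ^ (N + 1)) ^ 2 ≤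
        (1 + p ^ (N + 1)) * (1 - p ^ (2 * N + 3)) / (1 - p ^ (N + 2)) * |thetaSum p (N + 1) z| := by
      rw [← e2, mul_comm]
      exact mul_le_mul_of_nonneg_right hw' (abs_nonneg _)
    have h6 := mul_le_mul_of_nonneg_right h5 (sq_nonneg (1 - p ^ (N + 1)))
    have h7 := mul_le_mul_of_nonneg_left hr' (abs_nonneg (thetaSum p (N + 1) z))
    linarith

end ThetaProduct

section ThetaLimit

open Filter Topology

variable {p : ℝ}

lemma thetaRatio_nonneg (h0 : 0 < p) (h1 : p < 1) (N n : ℕ) : 0 ≤ thetaRatio p N n :=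
  Finset.prod_nonneg fun _ _ => div_nonneg (sub_nonneg.2 (pow_le_one₀ h0.le h1.le))
    (sub_nonneg.2 (pow_le_one₀ h0.le h1.le))

lemma thetaRatio_le_one (h0 : 0 < p) (h1 : p < 1) (N n : ℕ) : thetaRatio p N n ≤ 1 := by
  refine Finset.prod_le_one (fun _ _ => div_nonneg (sub_nonneg.2 (pow_le_one₀ h0.le h1.le))
    (sub_nonneg.2 (pow_le_one₀ h0.le h1.le))) fun j _ => ?_
  rw [div_le_one (sub_pos.2 (pow_lt_one₀ h0.le h1 (by omega)))]
  exact sub_le_sub_left (pow_le_pow_of_le_one h0.le h1.le (by omega)) _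

lemma tendsto_thetaRatio (h0 : 0 < p) (h1 : p < 1) (n : ℕ) :
    Tendsto (fun N => thetaRatio p N n) atTop (𝓝 1) := by
  have hp := tendsto_pow_atTop_nhds_zero_of_lt_one h0.le h1
  have h : Tendsto (fun N => thetaRatio p N n) atTop
      (𝓝 (∏ j ∈ Finset.range n, (1 - 0) / (1 - 0))) := by
    refine tendsto_finsetProd _ fun j _ => ?_
    refine ((hp.comp (tendsto_sub_atTop_nat j)).const_sub 1).div
      ((hp.comp ?_).const_sub 1) (by norm_num)
    exact (tendsto_add_atTop_nat j).comp (tendsto_add_atTop_nat 2)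
  simpa using h

lemma abs_thetaWeight_le (h0 : 0 < p) (h1 : p < 1) (n : ℕ) : |thetaWeight p n| ≤ p ^ n := by
  rw [thetaWeight, abs_mul, abs_pow, abs_neg, abs_one, one_pow, one_mul,
    abs_of_pos (by positivity)]
  refine pow_le_pow_of_le_one h0.le h1.le ?_
  rw [Nat.le_div_iff_mul_le two_pos]
  rcases n with _ | n
  · simp
  · exact Nat.mul_le_mul_left _ (by omega)

lemma summable_odd_mul_pow (h0 : 0 < p) (h1 : p < 1) :
    Summable fun n : ℕ => (2 * (n : ℝ) + 1) * p ^ n := by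
  have hp : ‖p‖ < 1 := by rwa [Real.norm_eq_abs, abs_of_pos h0]
  have h := ((summable_pow_mul_geometric_of_norm_lt_one 1 hp).mul_left 2).add
    (summable_geometric_of_lt_one h0.le h1)
  refine h.congr fun n => ?_
  ring

lemma abs_thetaTerm_le (h0 : 0 < p) (h1 : p < 1) (n : ℕ) {c s : ℝ} (hc : 0 ≤ c) (hc1 : c ≤ 1)
    (hs : |s| ≤ 2 * n + 1) : |thetaWeight p n * c * s| ≤ (2 * (n : ℝ) + 1) * p ^ n := by
  have h := abs_thetaWeight_le h0 h1 n
  have hp : 0 < p ^ n := by positivity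
  rw [abs_mul, abs_mul, abs_of_nonneg hc, mul_comm (2 * (n:ℝ) + 1)]
  refine mul_le_mul ?_ hs (abs_nonneg _) hp.le
  exact (mul_le_of_le_one_right (abs_nonneg _) hc1).trans h

lemma abs_sin_odd_le (n : ℕ) (z : ℝ) : |Real.sin ((2 * n + 1) * z)| ≤ 2 * n + 1 :=
  (Real.abs_sin_le_one _).trans (by linarith [(Nat.cast_nonneg n : (0:ℝ) ≤ n)])

lemma abs_odd_mul_cos_le (n : ℕ) (z : ℝ) :
    |(2 * (n:ℝ) + 1) * Real.cos ((2 * n + 1) * z)| ≤ 2 * n + 1 := by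
  have h : (0:ℝ) ≤ 2 * n + 1 := by positivity
  rw [abs_mul, abs_of_nonneg h]
  exact mul_le_of_le_one_right h (Real.abs_cos_le_one _)

lemma tendsto_sum_thetaTerm (h0 : 0 < p) (h1 : p < 1) {s : ℕ → ℝ}
    (hs : ∀ n : ℕ, |s n| ≤ 2 * n + 1) :
    Tendsto (fun N => ∑ n ∈ Finset.range (N + 1), thetaWeight p n * thetaRatio p N n * s n) atTop
      (𝓝 (∑' n, thetaWeight p n * s n)) := by
  have h := tendsto_tsum_of_dominated_convergence
    (f := fun N n => thetaWeight p n * thetaRatio p N n * s n)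
    (g := fun n => thetaWeight p n * s n) (𝓕 := atTop)
    (summable_odd_mul_pow h0 h1)
    (fun n => by
      simpa using ((tendsto_thetaRatio h0 h1 n).const_mul (thetaWeight p n)).mul_const (s n))
    (Eventually.of_forall fun N n => abs_thetaTerm_le h0 h1 n (thetaRatio_nonneg h0 h1 N n)
      (thetaRatio_le_one h0 h1 N n) (hs n))
  refine h.congr fun N => tsum_eq_sum fun n hn => ?_
  rw [Finset.mem_range, not_lt] at hn
  rw [thetaRatio_of_lt p (by omega)]
  ring

lemma theta1_sqrt (h0 : 0 < p) (z : ℝ) : theta1 z (Real.sqrt p) =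
    2 * p ^ ((1:ℝ) / 8) * ∑' n : ℕ, thetaWeight p n * Real.sin ((2 * n + 1) * z) := by
  rw [theta1, mul_assoc, ← tsum_mul_left (a := p ^ ((1:ℝ) / 8))]
  congr 1
  refine tsum_congr fun n => ?_
  have e : Real.sqrt p ^ (((n:ℝ) + 1 / 2) ^ 2) = p ^ ((1:ℝ) / 8) * p ^ (n * (n + 1) / 2) := by
    have h2 : ((n * (n + 1) / 2 : ℕ) : ℝ) = (n:ℝ) * (n + 1) / 2 := by
      rw [Nat.cast_div_charZero (Nat.even_mul_succ_self n).two_dvd]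
      push_cast
      ring
    rw [Real.sqrt_eq_rpow, ← Real.rpow_mul h0.le, ← Real.rpow_natCast p, ← Real.rpow_add h0, h2]
    congr 1
    ring
  rw [e, thetaWeight]
  ring

lemma theta1'_sqrt (h0 : 0 < p) (h1 : p < 1) (z : ℝ) : theta1' z (Real.sqrt p) =
    2 * p ^ ((1:ℝ) / 8) *
      ∑' n : ℕ, thetaWeight p n * ((2 * n + 1) * Real.cos ((2 * n + 1) * z)) := by
  have hb : ∀ (n : ℕ) {s : ℝ}, |s| ≤ 2 * n + 1 →
      |thetaWeight p n * s| ≤ (2 * (n : ℝ) + 1) * p ^ n := fun n s hs => by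
    simpa using abs_thetaTerm_le h0 h1 n zero_le_one le_rfl hs
  have hs : HasDerivAt (fun z => ∑' n : ℕ, thetaWeight p n * Real.sin ((2 * n + 1) * z))
      (∑' n : ℕ, thetaWeight p n * ((2 * n + 1) * Real.cos ((2 * n + 1) * z))) z := by
    refine hasDerivAt_tsum
      (g := fun (n : ℕ) z => thetaWeight p n * Real.sin ((2 * n + 1) * z))
      (g' := fun (n : ℕ) z => thetaWeight p n * ((2 * n + 1) * Real.cos ((2 * n + 1) * z)))
      (summable_odd_mul_pow h0 h1) (fun n y => ?_)
      (fun n y => hb n (abs_odd_mul_cos_le n y)) (y₀ := 0) ?_ z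
    · have h := ((hasDerivAt_id y).const_mul (2 * (n:ℝ) + 1)).sin.const_mul (thetaWeight p n)
      simpa [mul_comm] using h
    · exact Summable.of_norm_bounded (summable_odd_mul_pow h0 h1)
        fun n => hb n (abs_sin_odd_le n 0)
  rw [theta1', funext fun u => theta1_sqrt h0 u]
  exact (hs.const_mul _).deriv

/-- The logarithmic derivative of `θ₁` as a Lambert-type series. -/
theorem theta1'_div_theta1 (h0 : 0 < p) (h1 : p < 1) {z : ℝ} (hz : Real.sin z ≠ 0) :
    (Summable fun m : ℕ => 4 * p ^ (m + 1) * Real.sin (2 * z) /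
      (1 - 2 * p ^ (m + 1) * Real.cos (2 * z) + p ^ (2 * m + 2))) ∧
    theta1' z (Real.sqrt p) / theta1 z (Real.sqrt p) = Real.cos z / Real.sin z +
      ∑' m : ℕ, 4 * p ^ (m + 1) * Real.sin (2 * z) /
        (1 - 2 * p ^ (m + 1) * Real.cos (2 * z) + p ^ (2 * m + 2)) := by
  have hg : Summable fun m : ℕ => p ^ (m + 1) := by
    simpa [pow_succ] using (summable_geometric_of_lt_one h0.le h1).mul_right p
  have hsum : Summable fun m : ℕ => 4 * p ^ (m + 1) * Real.sin (2 * z) /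
      (1 - 2 * p ^ (m + 1) * Real.cos (2 * z) + p ^ (2 * m + 2)) := by
    refine Summable.of_norm_bounded (hg.mul_left (4 / (1 - p) ^ 2)) fun m => ?_
    have hw := thetaFactor_pos h0 h1 m z
    have hw' := thetaFactor_ge h0 m z
    have hx : 0 < p ^ (m + 1) := by positivity
    have hxp : p ^ (m + 1) ≤ p := pow_le_of_le_one h0.le h1.le (by omega)
    have h1p : 0 < 1 - p := sub_pos.2 h1
    have hs := Real.abs_sin_le_one (2 * z)
    rw [Real.norm_eq_abs, abs_div, abs_mul, abs_of_pos hw, abs_of_pos (by positivity),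
      div_mul_eq_mul_div]
    refine div_le_div₀ (by positivity) (mul_le_of_le_one_right (by positivity) hs)
      (by positivity) (le_trans ?_ hw')
    exact pow_le_pow_left₀ h1p.le (by linarith) 2
  refine ⟨hsum, ?_⟩
  have hS := tendsto_sum_thetaTerm h0 h1 fun n => abs_sin_odd_le n z
  have hD := tendsto_sum_thetaTerm h0 h1 fun n => abs_odd_mul_cos_le n z
  have hL : Tendsto (fun N => thetaLogDeriv p N z) atTop (𝓝 _) :=
    hsum.hasSum.tendsto_sum_nat.const_add (Real.cos z / Real.sin z)
  have hDL : Tendsto (fun N => thetaLogDeriv p N z * thetaSum p N z) atTop (𝓝 _) := hL.mul hS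
  have e := tendsto_nhds_unique (hD.congr fun N => thetaSumDeriv_eq h0 h1 N hz) hDL
  have hbound : |Real.sin z| * Real.exp (-(4 * ∑' m : ℕ, p ^ (m + 1) / (1 - p))) ≤
      |∑' n : ℕ, thetaWeight p n * Real.sin ((2 * n + 1) * z)| := by
    refine le_of_tendsto_of_tendsto' ?_ hS.abs fun N => abs_thetaSum_ge h0 h1 N z
    exact ((Real.continuous_exp.tendsto _).comp
      (((hg.div_const (1 - p)).hasSum.tendsto_sum_nat.const_mul 4).neg)).const_mul _
  have hne : ∑' n : ℕ, thetaWeight p n * Real.sin ((2 * n + 1) * z) ≠ 0 := by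
    refine abs_pos.1 (lt_of_lt_of_le ?_ hbound)
    have := abs_pos.2 hz
    positivity
  have hq : (2 * p ^ ((1:ℝ) / 8)) ≠ 0 := by positivity
  rw [theta1'_sqrt h0 h1, theta1_sqrt h0, mul_div_mul_left _ _ hq, e, mul_div_cancel_right₀ _ hne]

end ThetaLimit

section CharacteristicFunction

variable {k : ℝ}

lemma eCoef_one_one_zero (hk : k ∈ Ioo (0:ℝ) 1) :
    eCoef k 0 1 1 = (2 * Kell k - π) / k := by
  have h := one_add_mul_eCoef_one_one hk 0
  have hk0 : (k:ℂ) ≠ 0 := by exact_mod_cast hk.1.ne'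
  rw [dnCoef_eq hk, if_pos rfl] at h
  push_cast at h
  rw [zpow_zero] at h
  rw [eq_div_iff hk0]
  field_simp at h
  linear_combination h / 4

lemma eCoef_one_one_succ (hk : k ∈ Ioo (0:ℝ) 1) (m : ℕ) :
    eCoef k ((m + 1 : ℕ) : ℤ) 1 1 = -(4 * π / k) * ((qNome k : ℂ) ^ (m + 1) /
      ((1 + (qNome k : ℂ) ^ (m + 1)) * (1 + ((qNome k : ℂ) ^ (m + 1)) ^ 2))) := by
  have h := one_add_mul_eCoef_one_one hk ((m + 1 : ℕ) : ℤ)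
  have hk0 : (k:ℂ) ≠ 0 := by exact_mod_cast hk.1.ne'
  have hq := qNome_pos k
  have h1 : (1 + (qNome k : ℂ) ^ (m + 1)) ≠ 0 := by
    exact_mod_cast (show (0:ℝ) < 1 + qNome k ^ (m + 1) by positivity).ne'
  have h2 : (1 + ((qNome k : ℂ) ^ (m + 1)) ^ 2) ≠ 0 := by
    exact_mod_cast (show (0:ℝ) < 1 + (qNome k ^ (m + 1)) ^ 2 by positivity).ne'
  rw [dnCoef_eq hk, if_neg (by exact_mod_cast Nat.succ_ne_zero m)] at h
  simp only [zpow_natCast, ofReal_div, ofReal_mul, ofReal_pow, ofReal_add, ofReal_one,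
    ofReal_ofNat] at h
  refine mul_left_cancel₀ h1 (h.trans ?_)
  field_simp
  ring

lemma eCoef_one_one_neg_succ (hk : k ∈ Ioo (0:ℝ) 1) (m : ℕ) :
    eCoef k (-((m + 1 : ℕ) : ℤ)) 1 1 = -(4 * π / k) * (((qNome k : ℂ) ^ (m + 1)) ^ 2 /
      ((1 + (qNome k : ℂ) ^ (m + 1)) * (1 + ((qNome k : ℂ) ^ (m + 1)) ^ 2))) := by
  have h := one_add_mul_eCoef_one_one hk (-((m + 1 : ℕ) : ℤ))
  have hk0 : (k:ℂ) ≠ 0 := by exact_mod_cast hk.1.ne'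
  have hq := qNome_pos k
  have h0 : ((qNome k : ℂ) ^ (m + 1)) ≠ 0 := by
    exact_mod_cast (show (0:ℝ) < qNome k ^ (m + 1) by positivity).ne'
  have h1 : (1 + (qNome k : ℂ) ^ (m + 1)) ≠ 0 := by
    exact_mod_cast (show (0:ℝ) < 1 + qNome k ^ (m + 1) by positivity).ne'
  have h2 : (1 + ((qNome k : ℂ) ^ (m + 1)) ^ 2) ≠ 0 := by
    exact_mod_cast (show (0:ℝ) < 1 + (qNome k ^ (m + 1)) ^ 2 by positivity).ne'
  rw [dnCoef_eq hk, if_neg (by omega)] at h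
  simp only [zpow_neg, zpow_natCast, ofReal_div, ofReal_mul, ofReal_pow, ofReal_add, ofReal_one,
    ofReal_ofNat, ofReal_inv] at h
  generalize (qNome k : ℂ) ^ (m + 1) = y at *
  have h3 : 1 + y⁻¹ ≠ 0 := by
    rw [show 1 + y⁻¹ = (1 + y) * y⁻¹ by field_simp; ring]
    exact mul_ne_zero h1 (inv_ne_zero h0)
  have h4 : 1 + y⁻¹ ^ 2 ≠ 0 := by
    rw [show 1 + y⁻¹ ^ 2 = (1 + y ^ 2) * (y⁻¹) ^ 2 by field_simp; ring]
    exact mul_ne_zero h2 (pow_ne_zero 2 (inv_ne_zero h0))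
  refine mul_left_cancel₀ h3 (h.trans ?_)
  rw [show 2 * (π:ℂ) * y⁻¹ / (1 + y⁻¹ ^ 2) = 2 * π * y / (1 + y ^ 2) by
    rw [div_eq_div_iff h4 h2]
    field_simp
    ring]
  field_simp
  ring

lemma hasSum_qNome_sech (hk : k ∈ Ioo (0:ℝ) 1) :
    HasSum (fun m : ℕ => (qNome k : ℂ) ^ (m + 1) / (1 + ((qNome k : ℂ) ^ (m + 1)) ^ 2))
      ((2 * Kell k - π : ℂ) / (4 * π)) := by
  have h := (hasSum_eCoef hk (a := 1) (b := 1) (by decide)).nat_add_neg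
  have h0 : ePhi k 1 1 0 = 0 := by simp [ePhi, xRe, jsn_zero hk]
  have hk0 : (k:ℂ) ≠ 0 := by exact_mod_cast hk.1.ne'
  have hpi : (π:ℂ) ≠ 0 := by exact_mod_cast Real.pi_ne_zero
  have hq := qNome_pos k
  rw [h0, mul_zero, zero_add, ← hasSum_nat_add_iff' 1] at h
  simp only [Finset.sum_range_one, Nat.cast_zero, neg_zero] at h
  rw [eCoef_one_one_zero hk] at h
  have h' := h.mul_left (-(k / (4 * π) : ℂ))
  rw [show -(k / (4 * π) : ℂ) * ((2 * (Kell k : ℂ) - π) / k - ((2 * (Kell k : ℂ) - π) / k +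
      (2 * (Kell k : ℂ) - π) / k)) = (2 * Kell k - π : ℂ) / (4 * π) by field_simp; ring] at h'
  refine (iff_of_eq (congrArg (fun f => HasSum f _) (funext fun m => ?_))).2 h'
  · rw [eCoef_one_one_succ hk, eCoef_one_one_neg_succ hk]
    have h1 : (1 + (qNome k : ℂ) ^ (m + 1)) ≠ 0 := by
      exact_mod_cast (show (0:ℝ) < 1 + qNome k ^ (m + 1) by positivity).ne'
    have h2 : (1 + ((qNome k : ℂ) ^ (m + 1)) ^ 2) ≠ 0 := by
      exact_mod_cast (show (0:ℝ) < 1 + (qNome k ^ (m + 1)) ^ 2 by positivity).ne'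
    field_simp
    ring

lemma hasSum_rotGreen_one_one (hk : k ∈ Ioo (0:ℝ) 1) {l : ℂ} (hl : ‖l‖ = 1) (hl1 : l ≠ 1) :
    HasSum (fun m : ℕ => (qNome k : ℂ) ^ (m + 1) *
        ((qNome k : ℂ) ^ (m + 1) - l * (1 - (qNome k : ℂ) ^ (m + 1) +
          ((qNome k : ℂ) ^ (m + 1)) ^ 2)) /
        ((1 + ((qNome k : ℂ) ^ (m + 1)) ^ 2) * (1 - l * (qNome k : ℂ) ^ (m + 1)) *
          ((qNome k : ℂ) ^ (m + 1) - l)))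
      (((2 * Kell k - π) / (1 - l) - k * rotGreen k l 1 1) / (4 * π)) := by
  have hs := (summable_rotWeight_mul_eCoef hk hl (a := 1) (b := 1) (by decide)).hasSum
  have hr : rotGreen k l 1 1 = ∑' n : ℤ, rotWeight (qNome k) l n * eCoef k n 1 1 := by
    rw [rotGreen, if_pos (by decide)]
    rfl
  have h := hs.nat_add_neg
  have hk0 : (k:ℂ) ≠ 0 := by exact_mod_cast hk.1.ne'
  have hpi : (π:ℂ) ≠ 0 := by exact_mod_cast Real.pi_ne_zero
  have hq := qNome_pos k
  have hl' : 1 - l ≠ 0 := sub_ne_zero.2 hl1.symm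
  rw [← hr, ← hasSum_nat_add_iff' 1] at h
  simp only [Finset.sum_range_one, Nat.cast_zero, neg_zero] at h
  rw [eCoef_one_one_zero hk, rotWeight, zpow_zero, mul_one] at h
  have h' := h.mul_left (-(k / (4 * π) : ℂ))
  rw [show -(k / (4 * π) : ℂ) * (rotGreen k l 1 1 + (1 - l)⁻¹ * ((2 * (Kell k : ℂ) - π) / k) -
      ((1 - l)⁻¹ * ((2 * (Kell k : ℂ) - π) / k) + (1 - l)⁻¹ * ((2 * (Kell k : ℂ) - π) / k))) =
      ((2 * Kell k - π) / (1 - l) - k * rotGreen k l 1 1) / (4 * π) by field_simp; ring] at h'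
  refine (iff_of_eq (congrArg (fun f => HasSum f _) (funext fun m => ?_))).2 h'
  · rw [eCoef_one_one_succ hk, eCoef_one_one_neg_succ hk, rotWeight, rotWeight, zpow_neg,
      zpow_natCast]
    have h0 : ((qNome k : ℂ) ^ (m + 1)) ≠ 0 := by
      exact_mod_cast (show (0:ℝ) < qNome k ^ (m + 1) by positivity).ne'
    have h1 : (1 + (qNome k : ℂ) ^ (m + 1)) ≠ 0 := by
      exact_mod_cast (show (0:ℝ) < 1 + qNome k ^ (m + 1) by positivity).ne'
    have h2 : (1 + ((qNome k : ℂ) ^ (m + 1)) ^ 2) ≠ 0 := by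
      exact_mod_cast (show (0:ℝ) < 1 + (qNome k ^ (m + 1)) ^ 2 by positivity).ne'
    have h3 := one_sub_mul_zpow_ne_zero hq (qNome_lt_one hk) hl hl1 ((m + 1 : ℕ) : ℤ)
    have h4 := one_sub_mul_zpow_ne_zero hq (qNome_lt_one hk) hl hl1 (-((m + 1 : ℕ) : ℤ))
    rw [zpow_natCast] at h3
    rw [zpow_neg, zpow_natCast] at h4
    generalize (qNome k : ℂ) ^ (m + 1) = y at *
    have h5 : y - l ≠ 0 := by
      rw [show y - l = (1 - l * y⁻¹) * y by field_simp]
      exact mul_ne_zero h4 h0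
    rw [show (1 - l * y⁻¹)⁻¹ = y / (y - l) by
      rw [show (1 - l * y⁻¹) = (y - l) / y by field_simp, inv_div]]
    have h6 : 1 - y * l ≠ 0 := by rwa [mul_comm y l]
    field_simp
    ring

lemma Fchar_term_identity {l y : ℂ} (hl : l ≠ 0) (h2 : 1 + y ^ 2 ≠ 0) (h3 : 1 - l * y ≠ 0)
    (h5 : y - l ≠ 0) :
    (1 + l⁻¹ ^ 2) / 2 * (y / (1 + y ^ 2) - (1 - l) * (y * (y - l * (1 - y + y ^ 2)) /
      ((1 + y ^ 2) * (1 - l * y) * (y - l)))) =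
    y / (1 + y ^ 2) - (1 - (l + l⁻¹) / 2) * (y / (1 - y * (l + l⁻¹) + y ^ 2)) := by
  have e : 1 - y * (l + l⁻¹) + y ^ 2 = -((1 - l * y) * (y - l)) / l := by
    field_simp
    ring
  rw [e]
  field_simp
  ring

lemma Fchar_eq_theta {t : ℝ} (ht0 : 0 < t) (ht : t < 1 / 4) (hkt : k = 4 * t) {b : ℝ}
    (hb : ∀ n : ℤ, b ≠ n) :
    Fchar t b = (((1 / Real.cos (π * b / 2)) *
      (1 - π * Real.tan (π * b / 4) / (2 * Kell k) *
        (theta1' (π * b / 4) (Real.sqrt (qNome k)) /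
          theta1 (π * b / 4) (Real.sqrt (qNome k)))) : ℝ) : ℂ) := by
  have hk : k ∈ Ioo (0:ℝ) 1 := by constructor <;> linarith
  have hpi := Real.pi_ne_zero
  have hs : Real.sin (π * b / 4) ≠ 0 := by
    rw [Real.sin_ne_zero_iff]
    intro n hn
    refine hb (4 * n) ?_
    push_cast
    field_simp at hn
    linarith
  have hc : Real.cos (π * b / 4) ≠ 0 := by
    rw [Real.cos_ne_zero_iff]
    intro n hn
    refine hb (2 * (2 * n + 1)) ?_
    push_cast
    field_simp at hn
    linarith
  have hC : Real.cos (π * b / 2) ≠ 0 := by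
    rw [Real.cos_ne_zero_iff]
    intro n hn
    refine hb (2 * n + 1) ?_
    push_cast
    field_simp at hn
    linarith
  set l := quarterPhase b with hldef
  have hl0 : l ≠ 0 := quarterPhase_ne_zero b
  have hl : ‖l‖ = 1 := norm_quarterPhase b
  have hle : l = Complex.exp ((π * b / 2 : ℝ) * I) := by
    rw [hldef, quarterPhase]
    congr 1
    push_cast
    ring
  have hcosl : (Real.cos (π * b / 2) : ℂ) = (l + l⁻¹) / 2 := by
    rw [hle, ← Complex.exp_neg, ofReal_cos, Complex.cos, neg_mul]
  have hl1 : l ≠ 1 := by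
    intro h
    rw [h, inv_one] at hcosl
    have h2 : Real.cos (π * b / 2) = 1 := by
      have : (Real.cos (π * b / 2) : ℂ) = (1 : ℝ) := by rw [hcosl]; norm_num
      exact_mod_cast this
    rw [show π * b / 2 = 2 * (π * b / 4) by ring, Real.cos_two_mul, Real.cos_sq'] at h2
    exact hs (pow_eq_zero_iff two_ne_zero |>.1 (by linarith))
  obtain ⟨hsum, hθ⟩ := theta1'_div_theta1 (qNome_pos k) (qNome_lt_one hk) hs
  set S := ∑' m : ℕ, qNome k ^ (m + 1) /
    (1 - 2 * qNome k ^ (m + 1) * Real.cos (π * b / 2) + (qNome k ^ (m + 1)) ^ 2) with hS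
  have h2z : 2 * (π * b / 4) = π * b / 2 := by ring
  have hs2 : Real.sin (π * b / 2) ≠ 0 := by
    rw [← h2z, Real.sin_two_mul]
    exact mul_ne_zero (mul_ne_zero two_ne_zero hs) hc
  rw [h2z] at hsum hθ
  have hterm : ∀ m : ℕ, 4 * qNome k ^ (m + 1) * Real.sin (π * b / 2) /
      (1 - 2 * qNome k ^ (m + 1) * Real.cos (π * b / 2) + qNome k ^ (2 * m + 2)) =
      (4 * Real.sin (π * b / 2)) * (qNome k ^ (m + 1) /
        (1 - 2 * qNome k ^ (m + 1) * Real.cos (π * b / 2) + (qNome k ^ (m + 1)) ^ 2)) := by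
    intro m
    rw [← pow_mul, show (m + 1) * 2 = 2 * m + 2 by ring]
    ring
  simp only [hterm] at hsum hθ
  rw [tsum_mul_left, ← hS] at hθ
  have hsumS := ((summable_mul_left_iff (mul_ne_zero four_ne_zero hs2)).1 hsum).hasSum
  rw [← hS] at hsumS
  have hsumC : HasSum (fun m : ℕ => (qNome k : ℂ) ^ (m + 1) /
      (1 - (qNome k : ℂ) ^ (m + 1) * (l + l⁻¹) + ((qNome k : ℂ) ^ (m + 1)) ^ 2)) (S : ℂ) := by
    refine (iff_of_eq (congrArg (fun f => HasSum f _) (funext fun m => ?_))).2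
      (hasSum_ofReal.2 hsumS)
    push_cast [-ofReal_cos]
    rw [hcosl]
    congr 3
    ring
  have hD := hasSum_qNome_sech hk
  have hT := hasSum_rotGreen_one_one hk hl hl1
  have hA := (hD.sub (hT.mul_left (1 - l))).mul_left ((1 + l⁻¹ ^ 2) / 2)
  have hB := hD.sub (hsumC.mul_left (1 - (l + l⁻¹) / 2))
  have hq := qNome_pos k
  have h2 : ∀ m : ℕ, (1 + ((qNome k : ℂ) ^ (m + 1)) ^ 2) ≠ 0 := fun m => by
    exact_mod_cast (show (0:ℝ) < 1 + (qNome k ^ (m + 1)) ^ 2 by positivity).ne'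
  have h3 : ∀ m : ℕ, 1 - l * (qNome k : ℂ) ^ (m + 1) ≠ 0 := fun m => by
    have h3 := one_sub_mul_zpow_ne_zero hq (qNome_lt_one hk) hl hl1 ((m + 1 : ℕ) : ℤ)
    rwa [zpow_natCast] at h3
  have h5 : ∀ m : ℕ, (qNome k : ℂ) ^ (m + 1) - l ≠ 0 := fun m => by
    have h0 : ((qNome k : ℂ) ^ (m + 1)) ≠ 0 := by
      exact_mod_cast (show (0:ℝ) < qNome k ^ (m + 1) by positivity).ne'
    have h4 := one_sub_mul_zpow_ne_zero hq (qNome_lt_one hk) hl hl1 (-((m + 1 : ℕ) : ℤ))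
    rw [zpow_neg, zpow_natCast] at h4
    rw [show (qNome k : ℂ) ^ (m + 1) - l =
      (1 - l * ((qNome k : ℂ) ^ (m + 1))⁻¹) * (qNome k : ℂ) ^ (m + 1) by field_simp]
    exact mul_ne_zero h4 h0
  have key := HasSum.unique ((iff_of_eq (congrArg (fun f => HasSum f _) (funext fun m =>
    Fchar_term_identity hl0 (h2 m) (h3 m) (h5 m)))).1 hA) hB
  rw [Fchar_eq_rotGreen ht0 ht hkt hl1, ← hldef]
  have hK : (Kell k : ℂ) ≠ 0 := by exact_mod_cast (Kell_pos hk).ne'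
  have hpi' : (π : ℂ) ≠ 0 := by exact_mod_cast hpi
  have hl1' : 1 - l ≠ 0 := sub_ne_zero.2 hl1.symm
  have hrhs : (1 - π * Real.tan (π * b / 4) / (2 * Kell k) *
      (Real.cos (π * b / 4) / Real.sin (π * b / 4) + 4 * Real.sin (π * b / 2) * S)) =
      1 - π / (2 * Kell k) - 2 * π / Kell k * (1 - Real.cos (π * b / 2)) * S := by
    have hKr := (Kell_pos hk).ne'
    rw [← h2z, Real.sin_two_mul, Real.cos_two_mul, Real.cos_sq', Real.tan_eq_sin_div_cos]
    field_simp
    ring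
  have hC' : (Real.cos (π * b / 2) : ℂ) ≠ 0 := by exact_mod_cast hC
  rw [hθ, hrhs, one_div_mul_eq_div, ofReal_div, eq_div_iff hC', hcosl]
  push_cast [-ofReal_cos]
  rw [hcosl]
  generalize rotGreen k l 1 1 = R at *
  field_simp at key ⊢
  linear_combination key

end CharacteristicFunction

/-- Proposition 12, second part: the explicit form of the characteristic function `F(t,b)`
of the winding angle of excursions, for `b ∈ ℝ∖ℤ`, `b ∈ 4ℤ`, `b ∈ 2ℤ+1` and `b ∈ 4ℤ+2`. -/
theorem statement10 (t : ℝ) (ht : t ∈ Set.Ioo (0 : ℝ) (1 / 4)) (k : ℝ) (hk : k = 4 * t)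
    (b : ℝ) :
    ((∀ n : ℤ, b ≠ (n : ℝ)) →
      Fchar t b = (((1 / Real.cos (π * b / 2)) *
        (1 - π * Real.tan (π * b / 4) / (2 * Kell k) *
          (theta1' (π * b / 4) (Real.sqrt (qNome k)) /
            theta1 (π * b / 4) (Real.sqrt (qNome k)))) : ℝ) : ℂ)) ∧
    ((∃ n : ℤ, b = 4 * (n : ℝ)) → Fchar t b = ((1 - π / (2 * Kell k) : ℝ) : ℂ)) ∧
    ((∃ n : ℤ, b = 2 * (n : ℝ) + 1) → Fchar t b = ((1 - 2 * Eell k / π : ℝ) : ℂ)) ∧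
    ((∃ n : ℤ, b = 4 * (n : ℝ) + 2) →
      Fchar t b = ((-1 + 4 * Eell k / π - (1 - k ^ 2) * (2 * Kell k) / π : ℝ) : ℂ)) := by
  have ht0 : 0 < t := ht.1
  have ht4 : t < 1 / 4 := ht.2
  refine ⟨Fchar_eq_theta ht0 ht4 hk, ?_, ?_, ?_⟩
  · rintro ⟨n, hn⟩
    rw [show b = ((4 * n : ℤ) : ℝ) by rw [hn]; push_cast; ring, Fchar_four_mul ht0 ht4,
      diagGreen_zero_eq ht0 ht4, ← hk, one_div, mul_inv, inv_div, div_mul_eq_mul_div, ← div_eq_mul_inv,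
      div_div, mul_comm (Kell k)]
  · rintro ⟨n, hn⟩
    rw [show b = ((2 * n + 1 : ℤ) : ℝ) by rw [hn]; push_cast; ring, Fchar_odd ht0 ht4,
      diagGreen_sub_eq ht0 ht4, ← hk]
  · rintro ⟨n, hn⟩
    rw [show b = ((4 * n + 2 : ℤ) : ℝ) by rw [hn]; push_cast; ring,
      Fchar_four_mul_add_two ht0 ht4, diagGreen_combination_eq ht0 ht4, ← hk]

end
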